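/- arXiv:2412.18336 — 3 statements merged into one kernel-verified Lean document; each statement's English description precedes it below -/
import Mathlib

section
/- Let k, q ∈ ℕ and r ∈ ℤ with n = (k+3)q + r and 0 ≤ r ≤ k+2. Then there exists an n-vertex digraph G that does not contain the kth power of a Hamilton cycle and whose minimum total degree satisfies: δ(G) = 2⌈(1 − 1/(k+3))n⌉ − 4 if r = k+2; δ(G) = 2⌈(1 − 1/(k+3))n⌉ − 3 if r = k or r = k+1; and δ(G) = 2⌈(1 − 1/(k+3))n⌉ − 2 otherwise. -/
namespace Paper

/-- `G` is a digraph: a loopless directed graph (edges in both directions allowed). -/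
def IsDigraph {n : ℕ} (G : Fin n → Fin n → Prop) : Prop := ∀ v, ¬ G v v

/-- `G` is an oriented graph: no loops and at most one directed edge per pair. -/
def IsOriented {n : ℕ} (G : Fin n → Fin n → Prop) : Prop := ∀ u v, G u v → ¬ G v u

/-- Out-degree of `v` in `G`. -/
noncomputable def outDeg {n : ℕ} (G : Fin n → Fin n → Prop) (v : Fin n) : ℕ :=
  {w | G v w}.ncard

/-- In-degree of `v` in `G`. -/
noncomputable def inDeg {n : ℕ} (G : Fin n → Fin n → Prop) (v : Fin n) : ℕ :=
  {w | G w v}.ncard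

/-- `G` contains the `k`-th power of a Hamilton cycle: a cyclic ordering `f` of all the
vertices such that each vertex sends an edge to the next `k` vertices (indices mod `n`). -/
def HasPowHamCycle {n : ℕ} (k : ℕ) (G : Fin n → Fin n → Prop) : Prop :=
  ∃ f : Fin n ≃ Fin n, ∀ (i : Fin n) (j : ℕ), 1 ≤ j → j ≤ k →
    G (f i) (f ⟨((i : ℕ) + j) % n, Nat.mod_lt _ (Nat.lt_of_le_of_lt (Nat.zero_le _) i.isLt)⟩)

/-- `P` is a `k`-path in `G` (the `k`-th power of a directed path): a list of distinct
vertices in which every vertex sends an edge to each of the next `k` vertices. -/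
def IsKPath {n : ℕ} (k : ℕ) (G : Fin n → Fin n → Prop) (P : List (Fin n)) : Prop :=
  P.Nodup ∧ ∀ i j : Fin P.length, (i : ℕ) < (j : ℕ) → (j : ℕ) ≤ (i : ℕ) + k →
    G (P.get i) (P.get j)

/-- The vertices below `m` are split into independent classes of consecutive vertices of size at
most `s`; the next `a` vertices and the remaining ones form two complete digraphs, and no edge leads
from the latter back to the former. All other edges are present. -/
def blockDigraph (n m a s : ℕ) (u v : Fin n) : Prop :=
  u ≠ v ∧ ¬ ((u : ℕ) < m ∧ (v : ℕ) < m ∧ (u : ℕ) / s = (v : ℕ) / s) ∧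
    ¬ (m + a ≤ (u : ℕ) ∧ m ≤ (v : ℕ) ∧ (v : ℕ) < m + a)

lemma outDeg_add_ncard {n : ℕ} (G : Fin n → Fin n → Prop) (v : Fin n) :
    outDeg G v + {w | ¬ G v w}.ncard = n := by
  have h := Set.ncard_add_ncard_compl {w | G v w}
  rw [Nat.card_eq_fintype_card, Fintype.card_fin] at h
  exact h

lemma inDeg_add_ncard {n : ℕ} (G : Fin n → Fin n → Prop) (v : Fin n) :
    inDeg G v + {w | ¬ G w v}.ncard = n :=
  outDeg_add_ncard (fun x y => G y x) v

lemma ncard_fin_le_of_image_subset {n : ℕ} (S : Set (Fin n)) (T : Finset ℕ)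
    (h : ∀ w ∈ S, (w : ℕ) ∈ T) : S.ncard ≤ T.card := by
  rw [← Set.ncard_coe_finset]
  exact Set.ncard_le_ncard_of_injOn (fun w : Fin n => (w : ℕ)) h
    Fin.val_injective.injOn T.finite_toSet

lemma le_ncard_fin_of_subset_image {n : ℕ} (S : Set (Fin n)) (T : Finset ℕ)
    (h : ∀ x ∈ T, ∃ w ∈ S, (w : ℕ) = x) : T.card ≤ S.ncard := by
  rw [← Set.ncard_coe_finset]
  calc (T : Set ℕ).ncard ≤ ((fun w : Fin n => (w : ℕ)) '' S).ncard :=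
        Set.ncard_le_ncard (fun x hx => h x hx) (S.toFinite.image _)
    _ ≤ S.ncard := Set.ncard_image_le S.toFinite

/-- The edges of a power of a Hamilton cycle, with positions running through all naturals. -/
lemma HasPowHamCycle.exists_periodic {n k : ℕ} {G : Fin n → Fin n → Prop}
    (h : HasPowHamCycle k G) (hn : 0 < n) :
    ∃ g : ℕ → Fin n, (∀ t j, 1 ≤ j → j ≤ k → G (g t) (g (t + j))) ∧
      ∀ v t₀, ∃ t, t₀ ≤ t ∧ g t = v := by
  obtain ⟨f, hf⟩ := h
  refine ⟨fun t => f ⟨t % n, Nat.mod_lt _ hn⟩, fun t j h1 h2 => ?_, fun v t₀ => ?_⟩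
  · simpa using hf ⟨t % n, Nat.mod_lt _ hn⟩ j h1 h2
  · refine ⟨(f.symm v : ℕ) + n * t₀, ?_, ?_⟩
    · nlinarith
    · simp [Nat.mod_eq_of_lt (f.symm v).isLt]

lemma not_hasPowHamCycle_blockDigraph {n m a s k : ℕ} (hs : 0 < s) (hk : 1 ≤ k)
    (hm : m ≤ (k - 1) * s) (ha : 1 ≤ a) (hn : m + a < n) :
    ¬ HasPowHamCycle k (blockDigraph n m a s) := by
  intro h
  obtain ⟨g, hg, hsurj⟩ := h.exists_periodic (by omega)
  have window : ∀ t, ∃ j < k, m ≤ (g (t + j) : ℕ) := by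
    intro t
    by_contra! hc
    have hmap : ∀ j ∈ Finset.range k, (g (t + j) : ℕ) / s ∈ Finset.range (k - 1) := by
      intro j hj
      rw [Finset.mem_range] at hj ⊢
      rw [Nat.div_lt_iff_lt_mul hs]
      exact (hc j hj).trans_le hm
    obtain ⟨x, hx, y, hy, hxy, heq⟩ :=
      Finset.exists_ne_map_eq_of_card_lt_of_maps_to (by simp; omega) hmap
    rw [Finset.mem_range] at hx hy
    wlog hlt : x < y generalizing x y
    · exact this y hy x hx hxy.symm heq.symm (by omega)
    have hedge := hg (t + x) (y - x) (by omega) (by omega)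
    rw [show t + x + (y - x) = t + y by omega] at hedge
    exact hedge.2.1 ⟨hc x hx, hc y hy, heq⟩
  obtain ⟨t₀, -, ht₀⟩ := hsurj ⟨m + a, hn⟩ 0
  have avoid : ∀ t, t₀ ≤ t → ¬ (m ≤ (g t : ℕ) ∧ (g t : ℕ) < m + a) := by
    intro t
    induction t using Nat.strong_induction_on with
    | _ t ih =>
      intro ht hmem
      rcases Nat.lt_or_ge (t₀ + k) t with hfar | hnear
      · obtain ⟨j, hj, hmj⟩ := window (t - k)
        have hprev := ih (t - k + j) (by omega) (by omega)
        have hedge := hg (t - k + j) (k - j) (by omega) (by omega)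
        rw [show t - k + j + (k - j) = t by omega] at hedge
        exact hedge.2.2 ⟨by omega, hmem⟩
      · rcases ht.eq_or_lt with rfl | hlt
        · rw [ht₀] at hmem
          simp at hmem
        · have hedge := hg t₀ (t - t₀) (by omega) (by omega)
          rw [show t₀ + (t - t₀) = t by omega] at hedge
          exact hedge.2.2 ⟨by simp [ht₀], hmem⟩
  obtain ⟨t, ht, hgt⟩ := hsurj ⟨m, by omega⟩ t₀
  exact avoid t ht (by simp [hgt]; omega)

lemma degree_blockDigraph_lower {n m a b s : ℕ} (hs : 0 < s) (hn : n = m + a + b)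
    (hba : b ≤ a) (hsa : 2 * s ≤ a + 2) (v : Fin n) :
    2 * n ≤ outDeg (blockDigraph n m a s) v + inDeg (blockDigraph n m a s) v + (a + 2) := by
  have hout := outDeg_add_ncard (blockDigraph n m a s) v
  have hin := inDeg_add_ncard (blockDigraph n m a s) v
  suffices {w | ¬ blockDigraph n m a s v w}.ncard + {w | ¬ blockDigraph n m a s w v}.ncard
      ≤ a + 2 by omega
  rcases Nat.lt_or_ge v m with hvm | hvm
  · have hclass (w : Fin n) (hw : (v : ℕ) / s = (w : ℕ) / s) :
        (w : ℕ) ∈ Finset.Ico (s * ((v : ℕ) / s)) (s * ((v : ℕ) / s) + s) := by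
      have h1 := Nat.div_add_mod (w : ℕ) s
      have h2 := Nat.mod_lt (w : ℕ) hs
      rw [← hw] at h1
      rw [Finset.mem_Ico]
      omega
    have h1 := ncard_fin_le_of_image_subset {w | ¬ blockDigraph n m a s v w}
      (Finset.Ico (s * ((v : ℕ) / s)) (s * ((v : ℕ) / s) + s)) (by
        intro w hw
        apply hclass
        by_contra hne
        exact hw ⟨fun h => hne (by rw [h]), fun h => hne h.2.2, fun h => by omega⟩)
    have h2 := ncard_fin_le_of_image_subset {w | ¬ blockDigraph n m a s w v}
      (Finset.Ico (s * ((v : ℕ) / s)) (s * ((v : ℕ) / s) + s)) (by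
        intro w hw
        apply hclass
        by_contra hne
        exact hw ⟨fun h => hne (by rw [h]), fun h => hne h.2.2.symm, fun h => by omega⟩)
    simp only [Nat.card_Ico] at h1 h2
    omega
  rcases Nat.lt_or_ge v (m + a) with hva | hva
  · have h1 := ncard_fin_le_of_image_subset {w | ¬ blockDigraph n m a s v w} {(v : ℕ)} (by
      intro w hw
      by_contra hne
      rw [Finset.mem_singleton] at hne
      exact hw ⟨fun h => hne (by rw [h]), fun h => by omega, fun h => by omega⟩)
    have h2 := ncard_fin_le_of_image_subset {w | ¬ blockDigraph n m a s w v}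
      (insert (v : ℕ) (Finset.Ico (m + a) n)) (by
        intro w hw
        by_contra hne
        rw [Finset.mem_insert, Finset.mem_Ico] at hne
        exact hw ⟨fun h => hne (by rw [h]; exact Or.inl rfl), fun h => by omega,
          fun h => by omega⟩)
    have h3 := Finset.card_insert_le (v : ℕ) (Finset.Ico (m + a) n)
    simp only [Nat.card_Ico, Finset.card_singleton] at h1 h2 h3
    omega
  · have h1 := ncard_fin_le_of_image_subset {w | ¬ blockDigraph n m a s w v} {(v : ℕ)} (by
      intro w hw
      by_contra hne
      rw [Finset.mem_singleton] at hne
      exact hw ⟨fun h => hne (by rw [h]), fun h => by omega, fun h => by omega⟩)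
    have h2 := ncard_fin_le_of_image_subset {w | ¬ blockDigraph n m a s v w}
      (insert (v : ℕ) (Finset.Ico m (m + a))) (by
        intro w hw
        by_contra hne
        rw [Finset.mem_insert, Finset.mem_Ico] at hne
        exact hw ⟨fun h => hne (by rw [h]; exact Or.inl rfl), fun h => by omega,
          fun h => by omega⟩)
    have h3 := Finset.card_insert_le (v : ℕ) (Finset.Ico m (m + a))
    simp only [Nat.card_Ico, Finset.card_singleton] at h1 h2 h3
    omega

lemma degree_blockDigraph_upper {n m a s : ℕ} (v : Fin n) (hv : m + a ≤ (v : ℕ)) :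
    outDeg (blockDigraph n m a s) v + inDeg (blockDigraph n m a s) v + (a + 2) ≤ 2 * n := by
  have hout := outDeg_add_ncard (blockDigraph n m a s) v
  have hin := inDeg_add_ncard (blockDigraph n m a s) v
  have h1 := le_ncard_fin_of_subset_image {w | ¬ blockDigraph n m a s w v} {(v : ℕ)} (by
    intro x hx
    rw [Finset.mem_singleton] at hx
    exact ⟨v, fun h => h.1 rfl, hx.symm⟩)
  have h2 := le_ncard_fin_of_subset_image {w | ¬ blockDigraph n m a s v w}
    (insert (v : ℕ) (Finset.Ico m (m + a))) (by
      intro x hx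
      rw [Finset.mem_insert, Finset.mem_Ico] at hx
      rcases hx with rfl | hx
      · exact ⟨v, fun h => h.1 rfl, rfl⟩
      · exact ⟨⟨x, by omega⟩, fun h => h.2.2 ⟨hv, hx⟩, rfl⟩)
  rw [Finset.card_insert_of_notMem (by rw [Finset.mem_Ico]; omega)] at h2
  simp only [Nat.card_Ico, Finset.card_singleton] at h1 h2
  omega

lemma ceil_one_sub_one_div_mul {k q r n : ℕ} (hr : r ≤ k + 2) (hn : n = (k + 3) * q + r) :
    ⌈(1 - 1 / ((k : ℝ) + 3)) * (n : ℝ)⌉ = (n : ℤ) - q := by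
  have hpos : (0 : ℝ) < (k : ℝ) + 3 := by positivity
  have hr' : (r : ℝ) ≤ (k : ℝ) + 2 := by exact_mod_cast hr
  have hval : (1 - 1 / ((k : ℝ) + 3)) * (n : ℝ) = n - q - r / ((k : ℝ) + 3) := by
    rw [hn]
    push_cast
    field_simp
    ring
  have h0 : 0 ≤ (r : ℝ) / ((k : ℝ) + 3) := by positivity
  have h1 : (r : ℝ) / ((k : ℝ) + 3) < 1 := by
    rw [div_lt_one hpos]
    linarith
  rw [Int.ceil_eq_iff, hval]
  push_cast
  constructor <;> linarith

/-- For `k, q ≥ 1` and `0 ≤ r ≤ k+2`, with `n = (k+3)q + r`, there is an `n`-vertex digraph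
without the `k`-th power of a Hamilton cycle whose minimum total degree equals
`2⌈(1 - 1/(k+3))n⌉ - 4` if `r = k+2`, `2⌈(1 - 1/(k+3))n⌉ - 3` if `r ∈ {k, k+1}`, and
`2⌈(1 - 1/(k+3))n⌉ - 2` otherwise. -/
theorem statement_4 (k q r : ℕ) (hk : 1 ≤ k) (hq : 1 ≤ q) (hr : r ≤ k + 2)
    (n : ℕ) (hn : n = (k+3)*q + r) (D : ℤ)
    (hD : D = 2 * ⌈(1 - 1/((k:ℝ)+3)) * (n:ℝ)⌉ -
      (if r = k+2 then 4 else if r = k ∨ r = k+1 then 3 else 2)) :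
    ∃ G : Fin n → Fin n → Prop, IsDigraph G ∧ ¬ HasPowHamCycle k G ∧
      (∀ v, D ≤ (outDeg G v : ℤ) + (inDeg G v : ℤ)) ∧
      (∃ v, (outDeg G v : ℤ) + (inDeg G v : ℤ) = D) := by
  rw [ceil_one_sub_one_div_mul hr hn] at hD
  obtain ⟨m, a, b, hmab, hm, hb, hba, hqa, hDa⟩ : ∃ m a b : ℕ, n = m + a + b ∧
      m ≤ (k - 1) * (q + 1) ∧ 1 ≤ b ∧ b ≤ a ∧ 2 * q ≤ a ∧ D = 2 * n - (a + 2) := by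
    obtain ⟨l, rfl⟩ : ∃ l, k = l + 1 := ⟨k - 1, by omega⟩
    have hn' : n = l * q + 4 * q + r := by rw [hn]; ring
    rw [Nat.add_sub_cancel, show l * (q + 1) = l * q + l by ring]
    split_ifs at hD with h1 h2
    · exact ⟨l * q + l, 2 * q + 2, 2 * q + 1, by omega⟩
    · exact ⟨l * q + l, 2 * q + 1, 2 * q + (r - (l + 1)), by omega⟩
    · exact ⟨l * q + r, 2 * q, 2 * q, by omega⟩
  have hlower := degree_blockDigraph_lower (s := q + 1) (by omega) hmab hba (by omega)
  have hupper := degree_blockDigraph_upper (m := m) (a := a) (s := q + 1)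
    (⟨m + a, by omega⟩ : Fin n) le_rfl
  refine ⟨blockDigraph n m a (q + 1), fun v h => h.1 rfl,
    not_hasPowHamCycle_blockDigraph (by omega) hk hm (by omega) (by omega), fun v => ?_,
    ⟨m + a, by omega⟩, ?_⟩
  · have := hlower v
    omega
  · have := hlower ⟨m + a, by omega⟩
    omega

end Paper
end

section
/- For every integer k ≥ 2 and every η > 0, there exist n₀, T ∈ ℕ such that for every n ≥ n₀ the following holds: if G is an n-vertex digraph with minimum total degree δ(G) ≥ 2(1 − 1/(k+2) + η)n, then G contains a collection of at most T vertex-disjoint k-paths that together cover all but at most ηn vertices of G. -/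
namespace Paper

section
open Finset

/-- In a multigraph with multiplicities `mm` (where `mm x x = 2`), every vertex of `K` has
at most one neighbour in `K`, with multiplicity one. -/
def Full {ι : Type*} (mm : ι → ι → ℕ) (K : Finset ι) : Prop :=
  ∀ x ∈ K, ∑ y ∈ K, mm x y ≤ 3

/-- Twice the total multiplicity inside `K`, plus the diagonal contribution. -/
def heft {ι : Type*} (mm : ι → ι → ℕ) (K : Finset ι) : ℕ :=
  ∑ x ∈ K, ∑ y ∈ K, mm x y

theorem Full.mono {ι : Type*} {mm : ι → ι → ℕ} {K L : Finset ι} (hK : Full mm K) (h : L ⊆ K) :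
    Full mm L := fun x hx =>
  (Finset.sum_le_sum_of_subset h).trans (hK x (h hx))

theorem heft_insert {ι : Type*} [DecidableEq ι] {mm : ι → ι → ℕ} (hsymm : ∀ x y, mm x y = mm y x)
    (hdiag : ∀ x, mm x x = 2) {K : Finset ι} {v : ι} (hv : v ∉ K) :
    heft mm (insert v K) = heft mm K + 2 * ∑ y ∈ K, mm v y + 2 := by
  unfold heft
  rw [sum_insert hv, sum_insert hv, hdiag]
  have : ∀ x ∈ K, ∑ y ∈ insert v K, mm x y = mm v x + ∑ y ∈ K, mm x y := by
    intro x _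
    rw [sum_insert hv, hsymm]
  rw [sum_congr rfl this, sum_add_distrib]
  ring

theorem Full.insert_or_exchange {ι : Type*} [DecidableEq ι] {mm : ι → ι → ℕ}
    (hsymm : ∀ x y, mm x y = mm y x)
    (hdiag : ∀ x, mm x x = 2) {K : Finset ι} (hK : Full mm K) {v : ι}
    (hv : ∑ x ∈ K, mm v x ≤ 1) :
    v ∉ K ∧ (Full mm (insert v K) ∨
      ∃ x ∈ K, Full mm (insert v (K.erase x)) ∧ heft mm (insert v (K.erase x)) < heft mm K) := by
  have hvK : v ∉ K := by
    intro h
    have := single_le_sum (f := fun x => mm v x) (fun _ _ => Nat.zero_le _) h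
    simp only [hdiag] at this
    omega
  refine ⟨hvK, ?_⟩
  by_cases h : ∃ x ∈ K, mm v x ≠ 0 ∧ ∑ y ∈ K, mm x y = 3
  · right
    obtain ⟨x, hx, hvx, hx3⟩ := h
    have hsplit := add_sum_erase K (fun y => mm v y) hx
    have hz : ∑ y ∈ K.erase x, mm v y = 0 := by omega
    have hz' : ∀ y ∈ K.erase x, mm v y = 0 := by simpa using hz
    have hve : v ∉ K.erase x := fun h => hvK (mem_of_mem_erase h)
    refine ⟨x, hx, ?_, ?_⟩
    · intro y hy
      rw [sum_insert hve]
      rcases mem_insert.1 hy with rfl | hy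
      · rw [hz, hdiag]; omega
      · rw [hsymm, hz' y hy, zero_add]
        exact (hK.mono (erase_subset x K)) y hy
    · have h1 := heft_insert hsymm hdiag (K := K.erase x) (v := x) (notMem_erase x K)
      rw [insert_erase hx] at h1
      have h2 := add_sum_erase K (fun y => mm x y) hx
      simp only [hdiag] at h2
      rw [heft_insert hsymm hdiag hve]
      omega
  · left
    push Not at h
    intro x hx
    rw [sum_insert hvK]
    rcases mem_insert.1 hx with rfl | hx
    · rw [hdiag]; omega
    · have h3 := hK x hx
      have h1 := single_le_sum (f := fun x => mm v x) (fun _ _ => Nat.zero_le _) hx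
      rw [hsymm x v]
      by_cases h0 : mm v x = 0
      · omega
      · have := h x hx h0
        omega

/-- A weighted Turán-type statement: small weighted degrees on the support force a full set. -/
theorem exists_full_of_degree {ι : Type*} [Fintype ι] [DecidableEq ι] {mm : ι → ι → ℕ}
    (hsymm : ∀ x y, mm x y = mm y x)
    (hdiag : ∀ x, mm x x = 2) (μ : ι → ℝ) (hμ : ∀ v, 0 ≤ μ v) (hsum : ∑ v, μ v = 1) (E : ℝ)
    (hE : ∀ v, 0 < μ v → ∑ w, mm v w * μ w ≤ E) (l : ℕ) (hl : ((l : ℝ) - 1) * E < 2)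
    (hE0 : 0 ≤ E) :
    ∃ K : Finset ι, K.card = l ∧ Full mm K ∧ ∀ x ∈ K, 0 < μ x := by
  classical
  induction l with
  | zero => exact ⟨∅, by simp, by simp [Full], by simp⟩
  | succ l ih =>
    push_cast at hl
    have hne : (univ.filter fun K : Finset ι => K.card = l ∧ Full mm K ∧ ∀ x ∈ K, 0 < μ x).Nonempty := by
      obtain ⟨K, hK⟩ := ih (by nlinarith)
      exact ⟨K, by simpa using hK⟩
    obtain ⟨K, hK, hmin⟩ := exists_min_image _ (heft mm) hne
    simp only [mem_filter, mem_univ, true_and] at hK hmin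
    obtain ⟨hcard, hfull, hsupp⟩ := hK
    have hex : ∃ u, 0 < μ u ∧ ∑ x ∈ K, mm u x ≤ 1 := by
      by_contra hcon
      push Not at hcon
      have h1 : ∑ v ∈ K, ∑ w, mm v w * μ w ≤ l * E := by
        rw [← hcard, ← nsmul_eq_mul]
        exact sum_le_card_nsmul _ _ _ fun v hv => hE v (hsupp v hv)
      have h2 : ∑ w, 2 * μ w ≤ ∑ v ∈ K, ∑ w, mm v w * μ w := by
        rw [sum_comm]
        refine sum_le_sum fun w _ => ?_
        rw [← sum_mul]
        rcases (hμ w).eq_or_lt with h | h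
        · simp [← h]
        · refine mul_le_mul_of_nonneg_right ?_ (hμ w)
          have := hcon w h
          simp_rw [fun v => hsymm v w]
          exact_mod_cast this
      rw [← mul_sum, hsum] at h2
      linarith
    obtain ⟨u, hu, huK⟩ := hex
    obtain ⟨hnot, hins | ⟨x, hx, hf, hlt⟩⟩ := hfull.insert_or_exchange hsymm hdiag huK
    · refine ⟨insert u K, by rw [card_insert_of_notMem hnot, hcard], hins, ?_⟩
      intro x hx
      rcases mem_insert.1 hx with rfl | hx
      · exact hu
      · exact hsupp x hx
    · exfalso
      refine absurd (hmin (insert u (K.erase x)) ⟨?_, hf, ?_⟩) (not_le.2 hlt)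
      · rw [card_insert_of_notMem fun h => hnot (mem_of_mem_erase h), card_erase_of_mem hx]
        have := card_pos.2 ⟨x, hx⟩
        omega
      · intro y hy
        rcases mem_insert.1 hy with rfl | hy
        · exact hu
        · exact hsupp y (mem_of_mem_erase hy)

/-- The quadratic form of a multigraph with an extra diagonal term of weight `A`. -/
noncomputable def energy {ι : Type*} [Fintype ι] (mm : ι → ι → ℕ) (A : ℝ) (x : ι → ℝ) : ℝ :=
  (∑ v, x v * ∑ w, mm v w * x w) + A * ∑ v, x v ^ 2

/-- Probability weights supported on some member of `𝒰`. -/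
def weightsOn {ι : Type*} [Fintype ι] (𝒰 : Set (Finset ι)) : Set (ι → ℝ) :=
  {x | x ∈ stdSimplex ℝ ι ∧ ∃ U ∈ 𝒰, ∀ v ∉ U, x v = 0}

theorem isCompact_weightsOn {ι : Type*} [Fintype ι] (𝒰 : Set (Finset ι)) :
    IsCompact (weightsOn 𝒰) := by
  have : weightsOn 𝒰 = stdSimplex ℝ ι ∩ ⋃ U ∈ 𝒰, {x | ∀ v ∉ U, x v = 0} := by
    ext x; simp [weightsOn]
  rw [this]
  refine (isCompact_stdSimplex ℝ ι).inter_right ?_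
  refine (Set.toFinite 𝒰).isClosed_biUnion fun U _ => ?_
  simp only [Set.ofPred_forall]
  exact isClosed_iInter fun v => isClosed_iInter fun _ =>
    isClosed_eq (continuous_apply v) continuous_const

theorem exists_energy_minimizer {ι : Type*} [Fintype ι] {mm : ι → ι → ℕ}
    (hle : ∀ x y, mm x y ≤ 2) (𝒰 : Set (Finset ι)) (U₀ : Finset ι) (hU₀ : U₀ ∈ 𝒰)
    (a : ℝ) (ha : 0 < a) (haU : a ≤ U₀.card) (T : ℕ) (hT : 0 < T) :
    ∃ A, a / 2 ^ T ≤ A ∧ A ≤ a ∧ ∃ x ∈ weightsOn 𝒰, A * ∑ v, x v ^ 2 ≤ 6 / T ∧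
      ∀ y ∈ weightsOn 𝒰, energy mm A x ≤ energy mm A y := by
  classical
  have hc : (0 : ℝ) < U₀.card := ha.trans_le haU
  let μ₀ : ι → ℝ := fun v => if v ∈ U₀ then (U₀.card : ℝ)⁻¹ else 0
  have hμ₀ : μ₀ ∈ weightsOn 𝒰 := by
    refine ⟨⟨fun v => ?_, ?_⟩, U₀, hU₀, fun v hv => by simp [μ₀, hv]⟩
    · simp only [μ₀]; split_ifs <;> positivity
    · simp [μ₀, sum_ite_mem, hc.ne']
  have hmin : ∀ A : ℝ, ∃ x ∈ weightsOn 𝒰, ∀ y ∈ weightsOn 𝒰, energy mm A x ≤ energy mm A y := by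
    intro A
    obtain ⟨x, hx, h⟩ := (isCompact_weightsOn 𝒰).exists_isMinOn ⟨μ₀, hμ₀⟩
      (f := energy mm A) (by unfold energy; fun_prop)
    exact ⟨x, hx, fun y hy => h hy⟩
  choose x hx hxmin using hmin
  by_contra! hcon
  have hbig : ∀ t < T, 6 / T < a / 2 ^ t * ∑ v, x (a / 2 ^ t) v ^ 2 := by
    intro t ht
    by_contra! h
    obtain ⟨y, hy, hlt⟩ := hcon (a / 2 ^ t) (by gcongr; norm_num) (div_le_self ha.le (one_le_pow₀ (by norm_num)))
      _ (hx _) h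
    exact absurd (hxmin _ y hy) (not_le.2 hlt)
  have hstep : ∀ t ≤ T, energy mm (a / 2 ^ t) (x (a / 2 ^ t)) + t * (3 / T) ≤
      energy mm a (x a) := by
    intro t
    induction t with
    | zero => simp
    | succ t ih =>
      intro ht
      have h1 := ih (by omega)
      have h2 := hxmin (a / 2 ^ (t + 1)) _ (hx (a / 2 ^ t))
      have h3 := hbig t (by omega)
      have h4 : energy mm (a / 2 ^ t) (x (a / 2 ^ t)) = energy mm (a / 2 ^ (t + 1)) (x (a / 2 ^ t)) +
          (a / 2 ^ t * ∑ v, x (a / 2 ^ t) v ^ 2) / 2 := by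
        unfold energy; rw [pow_succ]; field_simp; ring
      have h5 : (6 : ℝ) / T = 2 * (3 / T) := by ring
      push_cast
      linarith
  have hupper : energy mm a (x a) ≤ 3 := by
    refine (hxmin a _ hμ₀).trans ?_
    have hs : ∑ v, μ₀ v = 1 := hμ₀.1.2
    have h0 := hμ₀.1.1
    have h1 : ∀ v, ∑ w, mm v w * μ₀ w ≤ 2 := fun v => by
      calc ∑ w, mm v w * μ₀ w ≤ ∑ w, 2 * μ₀ w := by
            refine sum_le_sum fun w _ => mul_le_mul_of_nonneg_right ?_ (h0 w)
            exact_mod_cast hle v w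
        _ = 2 := by rw [← mul_sum, hs, mul_one]
    have h2 : ∑ v, μ₀ v * ∑ w, mm v w * μ₀ w ≤ 2 := by
      calc _ ≤ ∑ v, μ₀ v * 2 := sum_le_sum fun v _ => mul_le_mul_of_nonneg_left (h1 v) (h0 v)
        _ = 2 := by rw [← sum_mul, hs, one_mul]
    have h3 : ∑ v, μ₀ v ^ 2 = (U₀.card : ℝ)⁻¹ := by
      have : ∀ v, μ₀ v ^ 2 = (U₀.card : ℝ)⁻¹ * μ₀ v := by
        intro v; simp only [μ₀]; split_ifs <;> ring
      simp_rw [this]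
      rw [← mul_sum, hs, mul_one]
    have h4 : a * ∑ v, μ₀ v ^ 2 ≤ 1 := by
      rw [h3, ← div_eq_mul_inv]; exact (div_le_one hc).2 haU
    unfold energy
    linarith
  have hT' := hstep T le_rfl
  have hlast : 0 < energy mm (a / 2 ^ T) (x (a / 2 ^ T)) := by
    have h0 := (hx (a / 2 ^ T)).1
    unfold energy
    refine add_pos_of_nonneg_of_pos ?_ ?_
    · exact sum_nonneg fun v _ => mul_nonneg (h0.1 v) (sum_nonneg fun w _ =>
        mul_nonneg (Nat.cast_nonneg _) (h0.1 w))
    · refine mul_pos (by positivity) ?_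
      obtain ⟨v, -, hv⟩ := exists_ne_zero_of_sum_ne_zero (h0.2.symm ▸ one_ne_zero :
        ∑ v, x (a / 2 ^ T) v ≠ 0)
      exact sum_pos' (fun v _ => sq_nonneg _) ⟨v, mem_univ _, by positivity⟩
  have : (T : ℝ) * (3 / T) = 3 := by field_simp
  linarith

/-- The gradient of `energy`, up to the factor two. -/
noncomputable def slope {ι : Type*} [Fintype ι] (mm : ι → ι → ℕ) (A : ℝ) (x : ι → ℝ) (v : ι) : ℝ :=
  (∑ w, mm v w * x w) + A * x v

theorem energy_eq_sum_slope {ι : Type*} [Fintype ι] (mm : ι → ι → ℕ) (A : ℝ) (x : ι → ℝ) :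
    energy mm A x = ∑ v, x v * slope mm A x v := by
  unfold energy slope
  rw [mul_sum, ← sum_add_distrib]
  exact sum_congr rfl fun v _ => by ring

theorem slope_nonneg {ι : Type*} [Fintype ι] (mm : ι → ι → ℕ) {A : ℝ} (hA : 0 ≤ A) {x : ι → ℝ}
    (hx : ∀ v, 0 ≤ x v) (v : ι) : 0 ≤ slope mm A x v :=
  add_nonneg (sum_nonneg fun w _ => mul_nonneg (Nat.cast_nonneg _) (hx w)) (mul_nonneg hA (hx v))

theorem energy_nonneg {ι : Type*} [Fintype ι] (mm : ι → ι → ℕ) {A : ℝ} (hA : 0 ≤ A) {x : ι → ℝ}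
    (hx : ∀ v, 0 ≤ x v) : 0 ≤ energy mm A x := by
  rw [energy_eq_sum_slope]
  exact sum_nonneg fun v _ => mul_nonneg (hx v) (slope_nonneg mm hA hx v)

theorem slope_add_smul {ι : Type*} [Fintype ι] (mm : ι → ι → ℕ) (A t : ℝ) (x y : ι → ℝ) (v : ι) :
    slope mm A (fun v => x v + t * y v) v = slope mm A x v + t * slope mm A y v := by
  unfold slope
  have : ∑ w, (mm v w : ℝ) * (x w + t * y w) = ∑ w, mm v w * x w + t * ∑ w, mm v w * y w := by
    rw [mul_sum, ← sum_add_distrib]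
    exact sum_congr rfl fun w _ => by ring
  rw [this]; ring

theorem sum_mul_slope_comm {ι : Type*} [Fintype ι] {mm : ι → ι → ℕ}
    (hsymm : ∀ x y, mm x y = mm y x) (A : ℝ) (x y : ι → ℝ) :
    ∑ v, x v * slope mm A y v = ∑ v, y v * slope mm A x v := by
  unfold slope
  simp_rw [mul_add, mul_sum, sum_add_distrib]
  congr 1
  · rw [sum_comm]
    refine sum_congr rfl fun v _ => sum_congr rfl fun w _ => ?_
    rw [hsymm w v]; ring
  · exact sum_congr rfl fun v _ => by ring

theorem energy_add_smul {ι : Type*} [Fintype ι] {mm : ι → ι → ℕ}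
    (hsymm : ∀ x y, mm x y = mm y x) (A t : ℝ) (x y : ι → ℝ) :
    energy mm A (fun v => x v + t * y v) =
      energy mm A x + 2 * t * (∑ v, y v * slope mm A x v) + t ^ 2 * energy mm A y := by
  simp_rw [energy_eq_sum_slope, slope_add_smul]
  have h := sum_mul_slope_comm hsymm A x y
  calc _ = ∑ v, x v * slope mm A x v + t * (∑ v, x v * slope mm A y v)
        + t * (∑ v, y v * slope mm A x v) + t ^ 2 * ∑ v, y v * slope mm A y v := by
        simp_rw [mul_sum]
        simp_rw [← sum_add_distrib]
        exact sum_congr rfl fun v _ => by ring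
    _ = _ := by rw [h]; ring

theorem energy_le {ι : Type*} [Fintype ι] {mm : ι → ι → ℕ}
    (hle : ∀ x y, mm x y ≤ 2) {A : ℝ} (hA : 0 ≤ A) {x : ι → ℝ} (hx : ∀ v, 0 ≤ x v) :
    energy mm A x ≤ (2 + A) * (∑ v, x v) ^ 2 := by
  rw [energy_eq_sum_slope]
  have h : ∀ v, slope mm A x v ≤ (2 + A) * ∑ v, x v := by
    intro v
    unfold slope
    rw [add_mul, mul_sum]
    refine add_le_add (sum_le_sum fun w _ => mul_le_mul_of_nonneg_right ?_ (hx w))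
      (mul_le_mul_of_nonneg_left (single_le_sum (fun w _ => hx w) (mem_univ v)) hA)
    exact_mod_cast hle v w
  calc _ ≤ ∑ v, x v * ((2 + A) * ∑ v, x v) :=
        sum_le_sum fun v _ => mul_le_mul_of_nonneg_left (h v) (hx v)
    _ = _ := by rw [← sum_mul]; ring

theorem energy_smul {ι : Type*} [Fintype ι] (mm : ι → ι → ℕ) (A t : ℝ) (x : ι → ℝ) :
    energy mm A (fun v => t * x v) = t ^ 2 * energy mm A x := by
  simp_rw [energy_eq_sum_slope, mul_sum]
  refine sum_congr rfl fun v _ => ?_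
  have := slope_add_smul mm A t (fun _ => 0) x v
  simp only [zero_add, slope, mul_zero, sum_const_zero] at this
  simp only [slope]
  rw [this]; ring

theorem min_energy_mul_sq_le {ι : Type*} [Fintype ι] {mm : ι → ι → ℕ} {A E : ℝ} (hA : 0 ≤ A)
    {𝒰 : Set (Finset ι)} (hmin : ∀ y ∈ weightsOn 𝒰, E ≤ energy mm A y)
    {y : ι → ℝ} (hy : ∀ v, 0 ≤ y v) {U : Finset ι} (hU : U ∈ 𝒰) (hyU : ∀ v ∉ U, y v = 0) :
    E * (∑ v, y v) ^ 2 ≤ energy mm A y := by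
  rcases (sum_nonneg fun v _ => hy v : 0 ≤ ∑ v, y v).eq_or_lt with h | h
  · rw [← h]; simpa using energy_nonneg mm hA hy
  · have := hmin (fun v => (∑ v, y v)⁻¹ * y v) ⟨⟨fun v => mul_nonneg (by positivity) (hy v), by
      rw [← mul_sum, inv_mul_cancel₀ h.ne']⟩, U, hU, fun v hv => by simp [hyU v hv]⟩
    rw [energy_smul, inv_pow, ← div_eq_inv_mul, le_div_iff₀ (by positivity)] at this
    exact this

/-- Moving a little weight `z` of an energy minimizer `x` to a vertex `u` shows that the slope
at `u` is almost as large as the minimal energy. -/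
theorem min_energy_le_slope {ι : Type*} [Fintype ι] [DecidableEq ι] {mm : ι → ι → ℕ}
    (hsymm : ∀ x y, mm x y = mm y x) (hle : ∀ x y, mm x y ≤ 2)
    {A : ℝ} (hA : 0 ≤ A)
    {𝒰 : Set (Finset ι)} {x : ι → ℝ} (hx : x ∈ stdSimplex ℝ ι)
    (hmin : ∀ y ∈ weightsOn 𝒰, energy mm A x ≤ energy mm A y)
    {z : ι → ℝ} (hz : ∀ v, 0 ≤ z v) (hzx : ∀ v, z v ≤ x v)
    (hzE : ∑ v, z v * slope mm A x v = energy mm A x * ∑ v, z v) {t : ℝ} (ht : 0 < t)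
    (hzt : ∑ v, z v ≤ t) {u : ι} {U : Finset ι} (hU : U ∈ 𝒰) (huU : u ∈ U)
    (hxU : ∀ v ∉ U, z v = x v) :
    energy mm A x ≤ slope mm A x u + (2 + A) * t := by
  set E := energy mm A x with hE
  have hE0 : 0 ≤ E := energy_nonneg mm hA hx.1
  let e : ι → ℝ := fun v => if v = u then 1 else 0
  have he0 : ∀ v, 0 ≤ e v := fun v => by simp only [e]; split_ifs <;> norm_num
  have hes : ∑ v, e v = 1 := by simp [e]
  have hesl : ∀ f : ι → ℝ, ∑ v, e v * f v = f u := fun f => by simp [e]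
  let y : ι → ℝ := fun v => (x v + (-1) * z v) + t * e v
  have hy := min_energy_mul_sq_le hA hmin (y := y)
    (fun v => add_nonneg (by linarith [hzx v]) (mul_nonneg ht.le (he0 v))) hU (by
      intro v hv
      have : v ≠ u := fun h => hv (h ▸ huU)
      simp [y, e, this, hxU v hv])
  have hysum : ∑ v, y v = 1 - ∑ v, z v + t := by
    simp only [y]
    rw [sum_add_distrib, sum_add_distrib, ← mul_sum, ← mul_sum, hes, hx.2]; ring
  have hexp : energy mm A y = energy mm A x - 2 * (E * ∑ v, z v) + energy mm A z +
      2 * t * (slope mm A x u - slope mm A z u) + t ^ 2 * energy mm A e := by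
    simp only [y]
    rw [energy_add_smul hsymm A t (fun v => x v + (-1) * z v) e,
      energy_add_smul hsymm, hzE, hesl, slope_add_smul]
    ring
  have h1 := energy_le hle hA hz
  have h2 := energy_le hle hA he0
  have h3 := slope_nonneg mm hA hz u
  have hρ : 0 ≤ ∑ v, z v := sum_nonneg fun v _ => hz v
  rw [hes] at h2
  rw [hysum, hexp] at hy
  set ρ := ∑ v, z v
  have h4 : ρ ^ 2 ≤ t ^ 2 := by gcongr
  have h5 : (2 + A) * ρ ^ 2 ≤ (2 + A) * t ^ 2 := by gcongr
  have h6 : t ^ 2 * energy mm A e ≤ t ^ 2 * (2 + A) := by gcongr; linarith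
  have h7 : 0 ≤ E * (t - ρ) ^ 2 := by positivity
  have h8 : 0 ≤ t * slope mm A z u := by positivity
  have h9 : t * E ≤ t * (slope mm A x u + (2 + A) * t) := by nlinarith
  exact le_of_mul_le_mul_left h9 ht

theorem min_energy_le_slope_of_mem {ι : Type*} [Fintype ι] [DecidableEq ι] {mm : ι → ι → ℕ}
    (hsymm : ∀ x y, mm x y = mm y x) (hle : ∀ x y, mm x y ≤ 2)
    {A : ℝ} (hA : 0 ≤ A)
    {𝒰 : Set (Finset ι)} {x : ι → ℝ} (hx : x ∈ stdSimplex ℝ ι)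
    (hmin : ∀ y ∈ weightsOn 𝒰, energy mm A x ≤ energy mm A y)
    {u : ι} {U : Finset ι} (hU : U ∈ 𝒰) (huU : u ∈ U)
    (hxU : ∀ v ∉ U, x v = 0) :
    energy mm A x ≤ slope mm A x u := by
  refine le_of_forall_pos_le_add fun ε hε => ?_
  have := min_energy_le_slope hsymm hle hA hx hmin (z := fun _ => 0) (t := ε / (2 + A))
    (fun _ => le_rfl) hx.1 (by simp) (by positivity) (by simp; positivity) hU huU
    (fun v hv => (hxU v hv).symm)
  rwa [mul_div_cancel₀ _ (by positivity)] at this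

theorem slope_eq_min_energy {ι : Type*} [Fintype ι] [DecidableEq ι] {mm : ι → ι → ℕ}
    (hsymm : ∀ x y, mm x y = mm y x) (hle : ∀ x y, mm x y ≤ 2)
    {A : ℝ} (hA : 0 ≤ A)
    {𝒰 : Set (Finset ι)} {x : ι → ℝ} (hx : x ∈ stdSimplex ℝ ι)
    (hmin : ∀ y ∈ weightsOn 𝒰, energy mm A x ≤ energy mm A y)
    {U : Finset ι} (hU : U ∈ 𝒰) (hxU : ∀ v ∉ U, x v = 0) {u : ι} (hu : 0 < x u) :
    slope mm A x u = energy mm A x := by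
  have hge : ∀ v ∈ univ, x v * energy mm A x ≤ x v * slope mm A x v := by
    intro v _
    by_cases hv : v ∈ U
    · exact mul_le_mul_of_nonneg_left
        (min_energy_le_slope_of_mem hsymm hle hA hx hmin hU hv hxU) (hx.1 v)
    · simp [hxU v hv]
  have heq : ∑ v, x v * energy mm A x = ∑ v, x v * slope mm A x v := by
    rw [← energy_eq_sum_slope, ← sum_mul, hx.2, one_mul]
  exact (mul_left_cancel₀ hu.ne' ((sum_eq_sum_iff_of_le hge).1 heq u (mem_univ u))).symm

/-- A family of pairwise disjoint full sets of size `s`. -/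
def IsFullTiling {ι : Type*} (mm : ι → ι → ℕ) (s : ℕ) (𝒞 : Finset (Finset ι)) : Prop :=
  (∀ C ∈ 𝒞, C.card = s ∧ Full mm C) ∧ (𝒞 : Set (Finset ι)).PairwiseDisjoint id

theorem IsFullTiling.card_biUnion {ι : Type*} [DecidableEq ι] {mm : ι → ι → ℕ} {s : ℕ}
    {𝒞 : Finset (Finset ι)} (h : IsFullTiling mm s 𝒞) : (𝒞.biUnion id).card = s * 𝒞.card := by
  rw [Finset.card_biUnion h.2]
  simp only [id]
  rw [sum_congr rfl fun C hC => (h.1 C hC).1, sum_const, smul_eq_mul,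
    mul_comm]

theorem IsFullTiling.insert {ι : Type*} [DecidableEq ι] {mm : ι → ι → ℕ} {s : ℕ} (hs : 0 < s)
    {𝒞 : Finset (Finset ι)} (h : IsFullTiling mm s 𝒞) {K : Finset ι} (hK : K.card = s)
    (hfull : Full mm K) (hdisj : Disjoint K (𝒞.biUnion id)) :
    K ∉ 𝒞 ∧ IsFullTiling mm s (insert K 𝒞) := by
  have hd : ∀ C ∈ 𝒞, Disjoint K C := fun C hC =>
    hdisj.mono_right (subset_biUnion_of_mem id hC)
  refine ⟨fun hKC => ?_, ?_, ?_⟩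
  · have := hd K hKC
    rw [disjoint_self_iff_empty] at this
    simp [this] at hK
    omega
  · intro C hC
    rcases mem_insert.1 hC with rfl | hC
    · exact ⟨hK, hfull⟩
    · exact h.1 C hC
  · rw [coe_insert]
    exact h.2.insert fun C hC _ => hd C hC

theorem IsFullTiling.erase {ι : Type*} [DecidableEq ι] {mm : ι → ι → ℕ} {s : ℕ}
    {𝒞 : Finset (Finset ι)} (h : IsFullTiling mm s 𝒞) (C : Finset ι) :
    IsFullTiling mm s (𝒞.erase C) :=
  ⟨fun K hK => h.1 K (mem_of_mem_erase hK), h.2.subset (by simp)⟩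

set_option maxHeartbeats 1000000 in
/-- Either a tiling of maximal size misses few vertices, or an energy argument enlarges it. -/
theorem exists_fullTiling_aux {ι : Type*} [Fintype ι] [DecidableEq ι] {mm : ι → ι → ℕ}
    (hsymm : ∀ x y, mm x y = mm y x) (hle : ∀ x y, mm x y ≤ 2) (hdiag : ∀ x, mm x x = 2)
    {s T : ℕ} (hs : 2 ≤ s) {η κ : ℝ} (hη : 0 < η) (hκ : 0 < κ) (hκ1 : 3 * s * κ * s ≤ η / 2)
    (hκ2 : 3 * s * κ < 2 / (s - 1) - 2 / s) (hT : 24 / (κ * η) < T)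
    (hm : 2 ^ T ≤ η * Fintype.card ι)
    (hdeg : ∀ v, ∑ w, (mm v w : ℝ) ≤ (2 / s - 2 * η) * Fintype.card ι) :
    ∃ 𝒞, IsFullTiling mm s 𝒞 ∧
      (Fintype.card ι : ℝ) - s * 𝒞.card ≤ η * Fintype.card ι := by
  classical
  have hs0 : (0 : ℝ) < s := by positivity
  have hs2 : (2 : ℝ) ≤ s := by exact_mod_cast hs
  set m : ℝ := (Fintype.card ι : ℝ) with hmdef
  obtain ⟨𝒞₀, h𝒞₀, hmax⟩ := exists_max_image (univ.filter (IsFullTiling mm s)) card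
    ⟨∅, by simp [IsFullTiling]⟩
  simp only [mem_filter, mem_univ, true_and] at h𝒞₀ hmax
  by_contra! hcon
  set p := 𝒞₀.card with hp
  let 𝒰 : Set (Finset ι) := {U | ∃ 𝒞, IsFullTiling mm s 𝒞 ∧ 𝒞.card = p ∧ U = (𝒞.biUnion id)ᶜ}
  have hcardU : ∀ 𝒞, IsFullTiling mm s 𝒞 → (((𝒞.biUnion id)ᶜ : Finset ι).card : ℝ) = m - s * 𝒞.card := by
    intro 𝒞 h
    rw [card_compl, Nat.cast_sub (card_le_univ _), h.card_biUnion]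
    push_cast; rfl
  have hηm : 0 < η * m := lt_of_lt_of_le (by positivity) hm
  have hT0 : 0 < T := by
    have : (0 : ℝ) < T := lt_trans (by positivity) hT
    exact_mod_cast this
  obtain ⟨A, hA1, hA2, x, hx, hxS, hmin⟩ := exists_energy_minimizer hle 𝒰 (𝒞₀.biUnion id)ᶜ
    ⟨𝒞₀, h𝒞₀, rfl, rfl⟩ (η * m) hηm
    (by rw [hcardU _ h𝒞₀]; exact (hcon _ h𝒞₀).le) T hT0
  have hA1 : 1 ≤ A := le_trans (by rw [le_div_iff₀ (by positivity), one_mul]; exact hm) hA1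
  have hA0 : 0 ≤ A := by linarith
  obtain ⟨hxs, U, ⟨𝒞, h𝒞, h𝒞p, hUdef⟩, hxU⟩ := hx
  have hU𝒰 : U ∈ 𝒰 := ⟨𝒞, h𝒞, h𝒞p, hUdef⟩
  have hUcard : (U.card : ℝ) = m - s * p := by rw [hUdef, hcardU _ h𝒞, h𝒞p]
  set E := energy mm A x with hE
  have hE0 : 0 ≤ E := energy_nonneg mm hA0 hxs.1
  let d : ι → ℝ := fun v => ∑ w, mm v w * x w
  have hd0 : ∀ v, 0 ≤ d v := fun v => sum_nonneg fun w _ =>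
    mul_nonneg (Nat.cast_nonneg _) (hxs.1 w)
  have hslope : ∀ v, slope mm A x v = d v + A * x v := fun _ => rfl
  have hsl : ∀ v ∈ U, E ≤ d v + A * x v := fun v hv =>
    min_energy_le_slope_of_mem hsymm hle hA0 hxs hmin hU𝒰 hv hxU
  have hsl' : ∀ v, 0 < x v → d v + A * x v = E := fun v hv =>
    slope_eq_min_energy hsymm hle hA0 hxs hmin hU𝒰 hxU hv
  have hdE : ∀ v, 0 < x v → d v ≤ E := fun v hv => by
    have := hsl' v hv
    nlinarith
  have hsupp : ∀ v, 0 < x v → v ∈ U := fun v hv => by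
    by_contra h
    exact hv.ne' (hxU v h)
  have hElow : 2 / ((s : ℝ) - 1) ≤ E := by
    by_contra! h
    rw [lt_div_iff₀ (by linarith)] at h
    obtain ⟨K, hK, hKf, hKx⟩ := exists_full_of_degree hsymm hdiag x hxs.1 hxs.2 E hdE s
      (by linarith) hE0
    have hdis : Disjoint K (𝒞.biUnion id) := by
      rw [← subset_compl_iff_disjoint_right, ← hUdef]
      exact fun v hv => hsupp v (hKx v hv)
    obtain ⟨hn, ht⟩ := h𝒞.insert (by omega) hK hKf hdis
    have := hmax _ ht
    rw [card_insert_of_notMem hn] at this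
    omega
  -- some member of the tiling has small weighted degree sum
  have hC : ∃ C ∈ 𝒞, ∑ u ∈ C, d u ≤ 2 - η := by
    have h1 : ∑ v, d v ≤ (2 / s - 2 * η) * m := by
      simp only [d]
      rw [sum_comm]
      calc _ = ∑ w, (∑ v, (mm w v : ℝ)) * x w := by
            refine sum_congr rfl fun w _ => ?_
            rw [← sum_mul]
            simp_rw [fun v => hsymm v w]
        _ ≤ ∑ w, ((2 / s - 2 * η) * m) * x w :=
            sum_le_sum fun w _ => mul_le_mul_of_nonneg_right (hdeg w) (hxs.1 w)
        _ = _ := by rw [← mul_sum, hxs.2, mul_one]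
    have h2 : E * U.card - A ≤ ∑ v ∈ U, d v := by
      have h3 : ∑ v ∈ U, (E - A * x v) ≤ ∑ v ∈ U, d v :=
        sum_le_sum fun v hv => by linarith [hsl v hv]
      have h4 : ∑ v ∈ U, x v ≤ 1 := by
        rw [← hxs.2]
        exact sum_le_sum_of_subset_of_nonneg (subset_univ _) fun v _ _ => hxs.1 v
      rw [sum_sub_distrib, sum_const, ← mul_sum, nsmul_eq_mul] at h3
      nlinarith
    have h3 : ∑ v, d v = ∑ C ∈ 𝒞, ∑ u ∈ C, d u + ∑ v ∈ U, d v := by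
      have h5 : ∑ v ∈ 𝒞.biUnion id, d v = ∑ C ∈ 𝒞, ∑ u ∈ C, d u := sum_biUnion h𝒞.2
      rw [hUdef, ← sum_add_sum_compl (𝒞.biUnion id), h5]
    have h4 : 2 / s ≤ E := le_trans (by gcongr <;> linarith) hElow
    have h5 : 2 / s * (U.card : ℝ) ≤ E * U.card := by gcongr
    rw [hUcard] at h5 h2
    have h6 : 2 / s * (m - s * p) = 2 / s * m - 2 * p := by field_simp
    by_contra! h
    have h7 : ∑ C ∈ 𝒞, (2 - η) ≤ ∑ C ∈ 𝒞, ∑ u ∈ C, d u := sum_le_sum fun C hC => (h C hC).le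
    rw [sum_const, nsmul_eq_mul, h𝒞p] at h7
    have h8 : 0 ≤ (U.card : ℝ) := by positivity
    rw [hUcard] at h8
    have h9 : (p : ℝ) < m := by
      by_contra! h9
      have : (0 : ℝ) ≤ p := by positivity
      have hm0 : 0 < m := by
        by_contra! h
        nlinarith
      nlinarith
    have h10 := mul_lt_mul_of_pos_left h9 hη
    linarith
  obtain ⟨C, hC𝒞, hCd⟩ := hC
  have hCs := (h𝒞.1 C hC𝒞).1
  have hCU : ∀ u ∈ C, u ∉ U := fun u hu h => by
    rw [hUdef, mem_compl] at h
    exact h (mem_biUnion.2 ⟨C, hC𝒞, hu⟩)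
  let Typ : Finset ι := univ.filter fun v => 0 < x v ∧ A * x v ≤ κ
  have hTyp : ∀ v ∈ Typ, 0 < x v ∧ A * x v ≤ κ := fun v hv => by simpa [Typ] using hv
  have hswap : ∀ C', C'.card = s → Full mm C' → C' ⊆ C ∪ Typ → ∀ u ∈ C, u ∉ C' →
      E ≤ d u + 3 * s * κ := by
    intro C' hC's hC'f hsub u huC huC'
    have hxu : x u = 0 := hxU u (hCU u huC)
    let 𝒟 := 𝒞.erase C
    have h𝒟 : IsFullTiling mm s 𝒟 := h𝒞.erase C
    have hC'𝒟 : Disjoint C' (𝒟.biUnion id) := by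
      rw [disjoint_left]
      intro v hv hv'
      obtain ⟨K, hK, hvK⟩ := mem_biUnion.1 hv'
      obtain ⟨hKC, hK𝒞⟩ := mem_erase.1 hK
      rcases mem_union.1 (hsub hv) with h | h
      · exact disjoint_left.1 (h𝒞.2 hK𝒞 hC𝒞 hKC) hvK h
      · have := hsupp v (hTyp v h).1
        rw [hUdef, mem_compl] at this
        exact this (mem_biUnion.2 ⟨K, hK𝒞, hvK⟩)
    obtain ⟨hn, ht⟩ := h𝒟.insert (by omega) hC's hC'f hC'𝒟
    have hU' : ((insert C' 𝒟).biUnion id)ᶜ ∈ 𝒰 := by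
      refine ⟨_, ht, ?_, rfl⟩
      rw [card_insert_of_notMem hn, card_erase_of_mem hC𝒞, h𝒞p]
      have := card_pos.2 ⟨C, hC𝒞⟩
      omega
    let z : ι → ℝ := fun v => if v ∈ C' then x v else 0
    have hzsum : ∑ v, z v ≤ s * (κ / A) := by
      simp only [z]
      rw [sum_ite_mem, univ_inter, ← hC's, ← nsmul_eq_mul]
      refine sum_le_card_nsmul _ _ _ fun v hv => ?_
      rcases mem_union.1 (hsub hv) with h | h
      · rw [hxU v (hCU v h)]; positivity
      · rw [le_div_iff₀ (by linarith)]; linarith [(hTyp v h).2]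
    have := min_energy_le_slope hsymm hle hA0 hxs hmin (z := z) (t := s * (κ / A)) (u := u)
      (fun v => by simp only [z]; split_ifs; exacts [hxs.1 v, le_rfl])
      (fun v => by simp only [z]; split_ifs; exacts [le_rfl, hxs.1 v])
      (by
        rw [mul_sum]
        refine sum_congr rfl fun v _ => ?_
        simp only [z]
        split_ifs with h
        · rcases (hxs.1 v).eq_or_lt with h0 | h0
          · simp [← h0]
          · rw [hslope, hsl' v h0]; ring
        · simp)
      (by positivity) hzsum hU'
      (by
        rw [mem_compl, biUnion_insert, mem_union, not_or]
        refine ⟨huC', fun h => ?_⟩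
        obtain ⟨K, hK, huK⟩ := mem_biUnion.1 h
        obtain ⟨hKC, hK𝒞⟩ := mem_erase.1 hK
        exact disjoint_left.1 (h𝒞.2 hK𝒞 hC𝒞 hKC) huK huC)
      (by
        intro v hv
        simp only [z]
        split_ifs with h
        · rfl
        · symm
          apply hxU
          rw [mem_compl, not_not, biUnion_insert, mem_union] at hv
          have hv := hv.resolve_left h
          obtain ⟨K, hK, hvK⟩ := mem_biUnion.1 hv
          rw [hUdef, mem_compl, not_not]
          exact mem_biUnion.2 ⟨K, (mem_erase.1 hK).2, hvK⟩)
    rw [hslope, hxu] at this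
    have h2 : (2 + A) * (s * (κ / A)) ≤ 3 * s * κ := by
      calc (2 + A) * (s * (κ / A)) ≤ (3 * A) * (s * (κ / A)) := by gcongr; linarith
        _ = 3 * s * κ := by field_simp
    linarith
  obtain ⟨C', hC', hC'min⟩ := exists_min_image
    (univ.filter fun K : Finset ι => K.card = s ∧ Full mm K ∧ K ⊆ C ∪ Typ) (heft mm)
    ⟨C, by simp [hCs, (h𝒞.1 C hC𝒞).2]⟩
  simp only [mem_filter, mem_univ, true_and] at hC' hC'min
  obtain ⟨hC's, hC'f, hC'sub⟩ := hC'
  have hκ0 : 0 ≤ 3 * s * κ := by positivity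
  have hdC' : ∑ u ∈ C', d u ≤ 2 - η / 2 := by
    have h1 : ∑ u ∈ C' \ C, d u ≤ (C' \ C).card * E := by
      rw [← nsmul_eq_mul]
      refine sum_le_card_nsmul _ _ _ fun v hv => hdE v ?_
      obtain ⟨hv, hvC⟩ := mem_sdiff.1 hv
      exact (hTyp v ((mem_union.1 (hC'sub hv)).resolve_left hvC)).1
    have h2 : (C \ C').card * (E - 3 * s * κ) ≤ ∑ u ∈ C \ C', d u := by
      rw [← nsmul_eq_mul]
      refine card_nsmul_le_sum _ _ _ fun v hv => ?_
      obtain ⟨hv, hvC⟩ := mem_sdiff.1 hv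
      linarith [hswap C' hC's hC'f hC'sub v hv hvC]
    have h3 : (C \ C').card = (C' \ C).card := card_sdiff_comm (by rw [hCs, hC's])
    have h4 : ((C \ C').card : ℝ) ≤ s := by
      rw [← hCs]; exact_mod_cast card_le_card sdiff_subset
    have h5 := sum_inter_add_sum_sdiff C C' d
    have h6 := sum_inter_add_sum_sdiff C' C d
    rw [inter_comm] at h6
    rw [← h3] at h1
    nlinarith
  have hv : ∃ v ∈ Typ, ∑ y ∈ C', mm v y ≤ 1 := by
    by_contra! hcon
    have h1 : ∑ u ∈ C', d u = ∑ v, (∑ y ∈ C', (mm v y : ℝ)) * x v := by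
      simp only [d]
      rw [sum_comm]
      refine sum_congr rfl fun w _ => ?_
      rw [← sum_mul]
      simp_rw [fun v => hsymm v w]
    have h2 : ∀ v, 2 * x v - 2 * (A * x v ^ 2 / κ) ≤ (∑ y ∈ C', (mm v y : ℝ)) * x v := by
      intro v
      rcases (hxs.1 v).eq_or_lt with h0 | h0
      · simp [← h0]
      · by_cases hvT : v ∈ Typ
        · have h3 : (2 : ℝ) ≤ ∑ y ∈ C', (mm v y : ℝ) := by exact_mod_cast hcon v hvT
          have : 0 ≤ A * x v ^ 2 / κ := by positivity
          nlinarith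
        · have h3 : κ < A * x v := by
            by_contra! h
            exact hvT (by simp [Typ, h0, h])
          have h4 : x v ≤ A * x v ^ 2 / κ := by
            rw [le_div_iff₀ hκ]; nlinarith
          have : 0 ≤ (∑ y ∈ C', (mm v y : ℝ)) * x v := by positivity
          linarith
    have h3 := sum_le_sum fun v (_ : v ∈ univ) => h2 v
    rw [← h1, sum_sub_distrib, ← mul_sum, ← mul_sum, ← sum_div, ← mul_sum, hxs.2] at h3
    have h4 : A * ∑ v, x v ^ 2 / κ = (A * ∑ v, x v ^ 2) / κ := by rw [← sum_div]; ring
    have h5 : (A * ∑ v, x v ^ 2) / κ < η / 4 := by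
      rw [div_lt_iff₀ (by positivity)] at hT
      rw [div_lt_iff₀ hκ]
      refine hxS.trans_lt ?_
      rw [div_lt_iff₀ (by positivity)]
      nlinarith
    linarith
  obtain ⟨v, hvT, hvC'⟩ := hv
  obtain ⟨hvn, hins | ⟨y, hy, hyf, hlt⟩⟩ := hC'f.insert_or_exchange hsymm hdiag hvC'
  · obtain ⟨u, huC', hud⟩ : ∃ u ∈ C', d u < 2 / s := by
      by_contra! h
      have := card_nsmul_le_sum C' d _ h
      rw [hC's, nsmul_eq_mul, mul_div_cancel₀ _ hs0.ne'] at this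
      linarith
    by_cases huC : u ∈ C
    · have := hswap (insert v (C'.erase u)) (by
          rw [card_insert_of_notMem fun h => hvn (mem_of_mem_erase h), card_erase_of_mem huC']
          omega) (hins.mono (insert_subset_insert _ (erase_subset _ _)))
        (insert_subset (mem_union_right _ hvT) ((erase_subset _ _).trans hC'sub)) u huC
        (by
          rw [mem_insert, not_or]
          exact ⟨fun h => hvn (h ▸ huC'), notMem_erase _ _⟩)
      linarith
    · obtain ⟨h1, h2⟩ := hTyp u ((mem_union.1 (hC'sub huC')).resolve_left huC)
      have := hsl' u h1
      have : κ ≤ 3 * s * κ := by nlinarith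
      linarith
  · refine absurd (hC'min (insert v (C'.erase y)) ⟨?_, hyf, ?_⟩) (not_le.2 hlt)
    · rw [card_insert_of_notMem fun h => hvn (mem_of_mem_erase h), card_erase_of_mem hy]
      omega
    · exact insert_subset (mem_union_right _ hvT) ((erase_subset _ _).trans hC'sub)

/-- A multigraph with small degrees has an almost perfect tiling with full `s`-sets. -/
theorem exists_fullTiling (s : ℕ) (hs : 2 ≤ s) (η : ℝ) (hη : 0 < η) :
    ∃ m₀ : ℕ, ∀ m ≥ m₀, ∀ mm : Fin m → Fin m → ℕ, (∀ x y, mm x y = mm y x) →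
      (∀ x y, mm x y ≤ 2) → (∀ x, mm x x = 2) →
      (∀ v, ∑ w, (mm v w : ℝ) ≤ (2 / s - 2 * η) * m) →
      ∃ 𝒞, IsFullTiling mm s 𝒞 ∧ (m : ℝ) - s * 𝒞.card ≤ η * m := by
  have hs2 : (2 : ℝ) ≤ s := by exact_mod_cast hs
  have hs1 : (0 : ℝ) < s - 1 := by linarith
  set κ : ℝ := min (η / (6 * s ^ 2)) (1 / (2 * s ^ 3)) with hκdef
  have hκ : 0 < κ := by positivity
  have h1 : κ ≤ η / (6 * s ^ 2) := min_le_left _ _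
  have h2 : κ ≤ 1 / (2 * s ^ 3) := min_le_right _ _
  obtain ⟨T, hT⟩ := exists_nat_gt (24 / (κ * η))
  obtain ⟨m₀, hm₀⟩ := exists_nat_ge (2 ^ T / η)
  refine ⟨m₀, fun m hm mm hsymm hle hdiag hdeg => ?_⟩
  have := exists_fullTiling_aux hsymm hle hdiag hs hη hκ (T := T) ?_ ?_ hT ?_ (by simpa using hdeg)
  · simpa using this
  · calc 3 * s * κ * s ≤ 3 * s * (η / (6 * s ^ 2)) * s := by gcongr
      _ = η / 2 := by field_simp; norm_num
  · calc 3 * s * κ ≤ 3 * s * (1 / (2 * s ^ 3)) := by gcongr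
      _ < 2 / (s * (s - 1)) := by
        rw [mul_one_div, div_lt_div_iff₀ (by positivity) (by positivity)]
        have : 0 < (s : ℝ) ^ 2 := by positivity
        nlinarith
      _ = 2 / (s - 1) - 2 / s := by field_simp; ring
  · rw [Fintype.card_fin, ← div_le_iff₀' hη]
    exact hm₀.trans (by exact_mod_cast hm)

open Classical in
/-- The number of missing edges (out of two) between two vertices of a digraph. -/
noncomputable def defect {ι : Type*} (H : ι → ι → Prop) (x y : ι) : ℕ :=
  (if H x y then 0 else 1) + (if H y x then 0 else 1)

theorem defect_comm {ι : Type*} (H : ι → ι → Prop) (x y : ι) : defect H x y = defect H y x :=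
  add_comm _ _

theorem defect_le_two {ι : Type*} (H : ι → ι → Prop) (x y : ι) : defect H x y ≤ 2 := by
  unfold defect; split_ifs <;> omega

theorem defect_self {ι : Type*} {H : ι → ι → Prop} (hH : ∀ v, ¬ H v v) (x : ι) :
    defect H x x = 2 := by
  simp [defect, hH]

theorem defect_eq_zero {ι : Type*} {H : ι → ι → Prop} {x y : ι} :
    defect H x y = 0 ↔ H x y ∧ H y x := by
  unfold defect; split_ifs <;> simp_all

/-- A blow-up pattern for powers of paths: all edges, except possibly those from a position to
the previous one. -/
def Tile {ι : Type*} (H : ι → ι → Prop) {s : ℕ} (t : Fin s → ι) : Prop :=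
  ∀ i j : Fin s, i ≠ j → (i : ℕ) ≠ j + 1 → H (t i) (t j)

theorem exists_list_of_full {ι : Type*} [DecidableEq ι] {H : ι → ι → Prop} (hH : ∀ v, ¬ H v v)
    (n : ℕ) (K : Finset ι) (hn : K.card = n) (hK : Full (defect H) K) :
    ∃ l : List ι, l.Nodup ∧ l.toFinset = K ∧ ∀ i j a b, l[i]? = some a → l[j]? = some b → i < j →
      H a b ∧ (i + 1 < j → H b a) := by
  induction n using Nat.strong_induction_on generalizing K with
  | _ n ih =>
  by_cases h : ∃ x ∈ K, ∃ y ∈ K, x ≠ y ∧ defect H x y ≠ 0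
  · obtain ⟨x, hx, y, hy, hxy, hdef, hHxy⟩ : ∃ x ∈ K, ∃ y ∈ K, x ≠ y ∧ defect H x y ≠ 0 ∧ H x y := by
      obtain ⟨x, hx, y, hy, hxy, hdef⟩ := h
      have h1 : defect H x y ≤ 1 := by
        have h2 := hK x hx
        have h3 : ∑ z ∈ {x, y}, defect H x z ≤ ∑ z ∈ K, defect H x z :=
          sum_le_sum_of_subset (by simp [insert_subset_iff, hx, hy])
        rw [sum_pair hxy, defect_self hH] at h3
        omega
      by_cases hxy' : H x y
      · exact ⟨x, hx, y, hy, hxy, hdef, hxy'⟩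
      · refine ⟨y, hy, x, hx, hxy.symm, by rwa [defect_comm], ?_⟩
        by_contra hyx
        simp [defect, hxy', hyx] at h1
    have key : ∀ x ∈ K, ∀ y ∈ K, x ≠ y → defect H x y ≠ 0 → ∀ z ∈ (K.erase x).erase y,
        H x z ∧ H z x := by
      intro x hx y hy hxy hdef z hz
      simp only [mem_erase] at hz
      have h2 := hK x hx
      have h3 : ∑ z ∈ {x, y, z}, defect H x z ≤ ∑ z ∈ K, defect H x z :=
        sum_le_sum_of_subset (by simp [insert_subset_iff, hx, hy, hz])
      rw [sum_insert (by simp [hxy, hz.2.1.symm]), sum_pair hz.1.symm, defect_self hH] at h3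
      exact defect_eq_zero.1 (by omega)
    have kx := key x hx y hy hxy hdef
    have ky := key y hy x hx hxy.symm (by rwa [defect_comm])
    rw [erase_right_comm] at ky
    obtain ⟨l, hl, hlK, hlH⟩ := ih ((K.erase x).erase y).card
      (hn ▸ card_lt_card ((erase_subset _ _).trans_ssubset (erase_ssubset hx))) _ rfl
      (hK.mono ((erase_subset _ _).trans (erase_subset _ _)))
    have hmem : ∀ z, z ∈ l ↔ z ∈ (K.erase x).erase y := fun z => by rw [← hlK, List.mem_toFinset]
    refine ⟨x :: y :: l, ?_, ?_, ?_⟩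
    · simp [hmem, hl, hxy]
    · rw [List.toFinset_cons, List.toFinset_cons, hlK, insert_erase (by simp [hxy.symm, hy]),
        insert_erase hx]
    · intro i j a b ha hb hij
      have hml : ∀ i a, l[i]? = some a → a ∈ (K.erase x).erase y := fun i a h =>
        (hmem a).1 (List.mem_of_getElem? h)
      match i, j with
      | 0, 0 => omega
      | 0, 1 =>
        simp only [List.getElem?_cons_zero, List.getElem?_cons_succ, Option.some.injEq] at ha hb
        subst ha hb
        exact ⟨hHxy, by omega⟩
      | 0, j + 2 =>
        simp only [List.getElem?_cons_zero, List.getElem?_cons_succ, Option.some.injEq] at ha hb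
        subst ha
        exact ⟨(kx b (hml _ _ hb)).1, fun _ => (kx b (hml _ _ hb)).2⟩
      | 1, j + 2 =>
        simp only [List.getElem?_cons_zero, List.getElem?_cons_succ, Option.some.injEq] at ha hb
        subst ha
        exact ⟨(ky b (hml _ _ hb)).1, fun _ => (ky b (hml _ _ hb)).2⟩
      | i + 1, 0 => omega
      | i + 1, 1 => omega
      | i + 2, j + 2 =>
        simp only [List.getElem?_cons_succ] at ha hb
        have := hlH i j a b ha hb (by omega)
        exact ⟨this.1, fun h => this.2 (by omega)⟩
  · push Not at h
    refine ⟨K.toList, K.nodup_toList, by simp, ?_⟩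
    intro i j a b ha hb hij
    have hab : a ≠ b := by
      rintro rfl
      obtain ⟨h1, rfl⟩ := List.getElem?_eq_some_iff.1 ha
      obtain ⟨h2, h3⟩ := List.getElem?_eq_some_iff.1 hb
      have := (K.nodup_toList.getElem_inj_iff).1 h3
      omega
    have := defect_eq_zero.1 (h a (by simpa using List.mem_of_getElem? ha) b
      (by simpa using List.mem_of_getElem? hb) hab)
    exact ⟨this.1, fun _ => this.2⟩

theorem exists_tile_of_full {ι : Type*} [DecidableEq ι] {H : ι → ι → Prop} (hH : ∀ v, ¬ H v v)
    {s : ℕ} {K : Finset ι} (hs : K.card = s) (hK : Full (defect H) K) :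
    ∃ t : Fin s → ι, Function.Injective t ∧ (∀ i, t i ∈ K) ∧ Tile H t := by
  obtain ⟨l, hl, hlK, hlH⟩ := exists_list_of_full hH s K hs hK
  have hlen : l.length = s := by rw [← hs, ← hlK, List.toFinset_card_of_nodup hl]
  subst hlen
  refine ⟨fun i => l[i], fun i j h => ?_, fun i => ?_, fun i j hij hij' => ?_⟩
  · exact Fin.ext ((hl.getElem_inj_iff).1 h)
  · rw [← hlK, List.mem_toFinset]; exact List.getElem_mem _
  · rcases lt_or_gt_of_ne (Fin.val_ne_of_ne hij) with h | h
    · exact (hlH i j _ _ (by simp) (by simp) h).1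
    · exact (hlH j i _ _ (by simp) (by simp) h).2 (by omega)

/-- A family of tiles in the pullback of a digraph along `f`, missing few of the vertices. -/
theorem exists_tiles_pullback (s : ℕ) (hs : 2 ≤ s) (η : ℝ) (hη : 0 < η) (hηs : 2 * η < 2 / s) :
    ∃ m₀ : ℕ, ∀ m ≥ m₀, ∀ H : Fin m → Fin m → Prop, (∀ v, ¬ H v v) →
      ∃ 𝒯 : Finset (Fin s → Fin m), (∀ t ∈ 𝒯, Tile H t) ∧
        (∀ t ∈ 𝒯, ∀ t' ∈ 𝒯, ∀ i i', t i = t' i' → t = t' ∧ i = i') ∧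
        (1 - η) * m / s - ((univ.filter fun i =>
          (2 / s - 2 * η) * m < ∑ j, (defect H i j : ℝ)).card : ℝ) ≤ 𝒯.card := by
  classical
  have hs0 : (0 : ℝ) < s := by positivity
  obtain ⟨m₀, hm₀⟩ := exists_fullTiling s hs η hη
  obtain ⟨m₁, hm₁⟩ := exists_nat_ge (2 / (2 / s - 2 * η))
  refine ⟨max m₀ m₁, fun m hm H hH => ?_⟩
  set bad := univ.filter fun i => (2 / s - 2 * η) * m < ∑ j, (defect H i j : ℝ) with hbad
  let mm : Fin m → Fin m → ℕ := fun i j =>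
    if i = j then 2 else if i ∈ bad ∨ j ∈ bad then 0 else defect H i j
  have hmm_le : ∀ i j, i ∉ bad → mm i j ≤ defect H i j := by
    intro i j hi
    simp only [mm]
    split_ifs with h1 h2
    · rw [h1, defect_self hH]
    · omega
    · exact le_rfl
  have hmm_eq : ∀ i j, i ∉ bad → j ∉ bad → mm i j = defect H i j := by
    intro i j hi hj
    simp only [mm]
    split_ifs with h1 h2
    · rw [h1, defect_self hH]
    · tauto
    · rfl
  obtain ⟨𝒞, h𝒞, hcard⟩ := hm₀ m ((le_max_left _ _).trans hm) mm
    (fun i j => by simp only [mm, eq_comm (a := i), or_comm (a := i ∈ bad), defect_comm H i])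
    (fun i j => by simp only [mm]; split_ifs <;> simp [defect_le_two])
    (fun i => by simp [mm])
    (fun i => by
      by_cases hi : i ∈ bad
      · have h1 : ∑ j, (mm i j : ℝ) = 2 := by
          have : ∀ j, (mm i j : ℝ) = if i = j then 2 else 0 := by
            intro j; simp only [mm, hi, true_or, if_true]; split_ifs <;> simp
          simp [this]
        rw [h1, ← div_le_iff₀' (by linarith)]
        exact hm₁.trans (by exact_mod_cast (le_max_right _ _).trans hm)
      · have h2 : ∑ j, (defect H i j : ℝ) ≤ (2 / s - 2 * η) * m := by simpa [hbad] using hi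
        refine le_trans (sum_le_sum fun j _ => ?_) h2
        exact_mod_cast hmm_le i j hi)
  let 𝒟 := 𝒞.filter fun C => Disjoint C bad
  have h𝒟 : ∀ C ∈ 𝒟, ∃ t : Fin s → Fin m, Function.Injective t ∧ (∀ i, t i ∈ C) ∧ Tile H t := by
    intro C hC
    obtain ⟨hC𝒞, hCb⟩ := mem_filter.1 hC
    refine exists_tile_of_full hH (h𝒞.1 C hC𝒞).1 fun x hx => ?_
    refine le_trans (le_of_eq (sum_congr rfl fun y hy => ?_)) ((h𝒞.1 C hC𝒞).2 x hx)
    exact (hmm_eq x y (disjoint_left.1 hCb hx) (disjoint_left.1 hCb hy)).symm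
  have hm0 : 0 < m := by
    have h1 : (0 : ℝ) < m₁ := lt_of_lt_of_le (by apply div_pos <;> linarith) hm₁
    have h2 : 0 < m₁ := by exact_mod_cast h1
    exact h2.trans_le ((le_max_right _ _).trans hm)
  have : Nonempty (Fin m) := ⟨⟨0, hm0⟩⟩
  choose! t htinj htC htile using h𝒟
  have hdisj : ∀ C ∈ 𝒟, ∀ C' ∈ 𝒟, ∀ i i', t C i = t C' i' → C = C' ∧ i = i' := by
    intro C hC C' hC' i i' h
    have hCC' : C = C' := by
      by_contra hne
      have h1 := htC C hC i
      rw [h] at h1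
      exact disjoint_left.1 (h𝒞.2 (mem_filter.1 hC).1 (mem_filter.1 hC').1 hne) h1 (htC C' hC' i')
    subst hCC'
    exact ⟨rfl, htinj C hC h⟩
  refine ⟨𝒟.image t, ?_, ?_, ?_⟩
  · intro x hx
    obtain ⟨C, hC, rfl⟩ := mem_image.1 hx
    exact htile C hC
  · intro x hx y hy i i' h
    obtain ⟨C, hC, rfl⟩ := mem_image.1 hx
    obtain ⟨C', hC', rfl⟩ := mem_image.1 hy
    obtain ⟨rfl, rfl⟩ := hdisj C hC C' hC' i i' h
    exact ⟨rfl, rfl⟩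
  · rw [card_image_of_injOn]
    · have h1 : (𝒞.filter fun C => ¬ Disjoint C bad).card ≤ bad.card := by
        have : ∀ C ∈ 𝒞.filter fun C => ¬ Disjoint C bad, ∃ v, v ∈ C ∧ v ∈ bad := fun C hC =>
          not_disjoint_iff.1 (mem_filter.1 hC).2
        choose! g hg using this
        refine card_le_card_of_injOn g (fun C hC => (hg C hC).2) fun C hC C' hC' h => ?_
        by_contra hne
        have h1 := (hg C hC).1
        rw [h] at h1
        exact disjoint_left.1 (h𝒞.2 (mem_filter.1 hC).1 (mem_filter.1 hC').1 hne) h1 (hg C' hC').1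
      have h2 : (𝒟.card : ℝ) + (𝒞.filter fun C => ¬ Disjoint C bad).card = 𝒞.card := by
        exact_mod_cast card_filter_add_card_filter_not (s := 𝒞) (fun C => Disjoint C bad)
      have h3 : (1 - η) * m / s ≤ 𝒞.card := by
        rw [div_le_iff₀ hs0]; linarith
      have h4 : ((𝒞.filter fun C => ¬ Disjoint C bad).card : ℝ) ≤ bad.card := by exact_mod_cast h1
      linarith
    · intro C hC C' hC' h
      exact (hdisj C hC C' hC' ⟨0, by omega⟩ ⟨0, by omega⟩ (by rw [h])).1

theorem sum_fun_eq_zero_of_coord {V : Type*} [Fintype V] {m : ℕ} {c : V → V → ℝ}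
    (hc : ∀ v, ∑ w, c v w = 0) {i j j' : Fin m} (hij : i ≠ j) (hjj' : j' ≠ j) :
    ∑ f : Fin m → V, c (f i) (f j) * c (f i) (f j') = 0 := by
  rw [← (Equiv.funSplitAt j V).symm.sum_comp, Fintype.sum_prod_type_right]
  refine sum_eq_zero fun r _ => ?_
  simp only [Equiv.funSplitAt_symm_apply, hij, hjj', dite_true, dite_false]
  rw [← sum_mul, hc, zero_mul]

theorem sum_sq_fun_le {V : Type*} [Fintype V] {m : ℕ} {c : V → V → ℝ}
    (hc : ∀ v, ∑ w, c v w = 0) (hc2 : ∀ v w, c v w ^ 2 ≤ 4) (i : Fin m) :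
    ∑ f : Fin m → V, (∑ j ∈ univ.erase i, c (f i) (f j)) ^ 2 ≤ 4 * m * (Fintype.card V : ℝ) ^ m := by
  simp_rw [sq (Finset.sum _ _), sum_mul_sum]
  rw [sum_comm]
  have h : ∀ j ∈ univ.erase i, ∑ f : Fin m → V, ∑ j' ∈ univ.erase i, c (f i) (f j) * c (f i) (f j')
      ≤ 4 * (Fintype.card V : ℝ) ^ m := by
    intro j hj
    rw [sum_comm, sum_eq_single_of_mem j hj]
    · have : ∀ f ∈ (univ : Finset (Fin m → V)), c (f i) (f j) * c (f i) (f j) ≤ 4 := fun f _ => by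
        rw [← sq]; exact hc2 _ _
      refine (sum_le_card_nsmul _ _ _ this).trans ?_
      rw [card_univ, Fintype.card_fun, Fintype.card_fin, nsmul_eq_mul]
      push_cast; linarith
    · intro j' _ hne
      exact sum_fun_eq_zero_of_coord hc (mem_erase.1 hj).1.symm hne
  refine (sum_le_card_nsmul _ _ _ h).trans ?_
  rw [nsmul_eq_mul, card_erase_of_mem (mem_univ _), card_univ, Fintype.card_fin]
  have : ((m - 1 : ℕ) : ℝ) ≤ m := by exact_mod_cast Nat.sub_le _ _
  have h0 : 0 ≤ 4 * (Fintype.card V : ℝ) ^ m := by positivity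
  nlinarith

theorem card_fun_comp_eq_mul_le {V : Type*} [Fintype V] [DecidableEq V] {m s : ℕ}
    {t : Fin s → Fin m} (ht : Function.Injective t) (x : Fin s → V) :
    (univ.filter fun f : Fin m → V => f ∘ t = x).card * Fintype.card V ^ s ≤
      Fintype.card V ^ m := by
  have h : ((univ.filter fun f : Fin m → V => f ∘ t = x) ×ˢ (univ : Finset (Fin s → V))).card ≤
      (univ : Finset (Fin m → V)).card := by
    refine card_le_card_of_injOn (fun p => Function.extend t p.2 p.1) (fun _ _ => by simp) ?_
    rintro ⟨f, y⟩ hf ⟨f', y'⟩ hf' h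
    simp only [coe_product, Set.mem_prod, mem_coe, mem_filter, mem_univ, true_and, and_true,
      coe_univ, Set.mem_univ] at hf hf' h
    have hy : y = y' := by
      funext i
      have := congrFun h (t i)
      rwa [ht.extend_apply, ht.extend_apply] at this
    subst hy
    congr 1
    funext j
    by_cases hj : ∃ i, t i = j
    · obtain ⟨i, rfl⟩ := hj
      exact congrFun (hf.trans hf'.symm) i
    · have := congrFun h j
      rwa [Function.extend_apply' _ _ _ hj, Function.extend_apply' _ _ _ hj] at this
  rw [card_product, card_univ, card_univ, Fintype.card_fun, Fintype.card_fun] at h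
  simpa using h

/-- In a random sample of vertices, few samples see too large a defect. -/
theorem sum_card_bad_le {n m : ℕ} (hn : 0 < n) {G : Fin n → Fin n → Prop} {q η : ℝ} (hη : 0 < η)
    (hdeg : ∀ v, ∑ w, (defect G v w : ℝ) ≤ q * n) (hm : 4 ≤ η * m) :
    ∑ f : Fin m → Fin n, ((univ.filter fun i =>
      (q + η) * m < ∑ j, (defect G (f i) (f j) : ℝ)).card : ℝ) ≤ 16 / η ^ 2 * n ^ m := by
  have hn' : (0 : ℝ) < n := by exact_mod_cast hn
  have hm0 : (0 : ℝ) < m := by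
    by_contra! h
    nlinarith
  let avg : Fin n → ℝ := fun v => (∑ w, (defect G v w : ℝ)) / n
  let c : Fin n → Fin n → ℝ := fun v w => defect G v w - avg v
  have hdle : ∀ v w, (defect G v w : ℝ) ≤ 2 := fun v w => by exact_mod_cast defect_le_two G v w
  have havg0 : ∀ v, 0 ≤ avg v := fun v => by positivity
  have havg2 : ∀ v, avg v ≤ 2 := fun v => by
    simp only [avg]
    rw [div_le_iff₀ hn']
    have := sum_le_card_nsmul univ _ _ fun w _ => hdle v w
    simp only [card_univ, Fintype.card_fin, nsmul_eq_mul] at this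
    linarith
  have hc0 : ∀ v, ∑ w, c v w = 0 := fun v => by
    simp only [c, avg, sum_sub_distrib, sum_const, card_univ, Fintype.card_fin, nsmul_eq_mul]
    field_simp
    ring
  have hc2 : ∀ v w, c v w ^ 2 ≤ 4 := fun v w => by
    have h1 := hdle v w
    have h2 : (0 : ℝ) ≤ defect G v w := by positivity
    have h3 := havg0 v
    have h4 := havg2 v
    have : |c v w| ≤ 2 := abs_le.2 ⟨by simp only [c]; linarith, by simp only [c]; linarith⟩
    nlinarith [abs_nonneg (c v w), sq_abs (c v w)]
  have hpt : ∀ f : Fin m → Fin n, ((univ.filter fun i =>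
      (q + η) * m < ∑ j, (defect G (f i) (f j) : ℝ)).card : ℝ) ≤
      ∑ i, (∑ j ∈ univ.erase i, c (f i) (f j)) ^ 2 * (4 / (η * m) ^ 2) := by
    intro f
    rw [card_eq_sum_ones, sum_filter]
    push_cast
    refine sum_le_sum fun i _ => ?_
    split_ifs with h
    · rw [mul_div_assoc', le_div_iff₀ (by positivity)]
      have h1 : ∑ j ∈ univ.erase i, c (f i) (f j) = ∑ j, (defect G (f i) (f j) : ℝ)
          - m * avg (f i) - c (f i) (f i) := by
        rw [eq_sub_iff_add_eq, sum_erase_add _ _ (mem_univ i)]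
        simp [c, sum_sub_distrib]
      have h2 : avg (f i) ≤ q := by
        simp only [avg]; rw [div_le_iff₀ hn']; exact hdeg _
      have h3 : c (f i) (f i) ≤ 2 := by simp only [c]; linarith [hdle (f i) (f i), havg0 (f i)]
      have h4 : η * m / 2 ≤ ∑ j ∈ univ.erase i, c (f i) (f j) := by
        rw [h1]; nlinarith
      nlinarith [mul_pos hη hm0]
    · positivity
  refine (sum_le_sum fun f _ => hpt f).trans ?_
  rw [sum_comm]
  have h5 : ∀ i ∈ (univ : Finset (Fin m)), ∑ f : Fin m → Fin n,
      (∑ j ∈ univ.erase i, c (f i) (f j)) ^ 2 * (4 / (η * m) ^ 2) ≤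
      (4 * m * (n : ℝ) ^ m) * (4 / (η * m) ^ 2) := by
    intro i _
    rw [← sum_mul]
    refine mul_le_mul_of_nonneg_right ?_ (by positivity)
    simpa using sum_sq_fun_le hc0 hc2 i
  refine (sum_le_card_nsmul _ _ _ h5).trans (le_of_eq ?_)
  rw [card_univ, Fintype.card_fin, nsmul_eq_mul]
  field_simp
  norm_num

/-- Averaging families of tiles in samples of `m` vertices, over all samples. -/
noncomputable def sampleWeight {n m s : ℕ} (𝒯 : (Fin m → Fin n) → Finset (Fin s → Fin m))
    (x : Fin s → Fin n) : ℝ :=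
  (n : ℝ) / (m * n ^ m) * ∑ f, (((𝒯 f).filter fun t => f ∘ t = x).card : ℝ)

theorem sampleWeight_mul_le {n m s : ℕ} (hn : 0 < n) (hm : 0 < m)
    (𝒯 : (Fin m → Fin n) → Finset (Fin s → Fin m))
    (hinj : ∀ f, ∀ t ∈ 𝒯 f, Function.Injective t) (x : Fin s → Fin n) :
    sampleWeight 𝒯 x * n ^ s ≤ m ^ s * n := by
  classical
  have hn' : (0 : ℝ) < n := by exact_mod_cast hn
  have hm' : (0 : ℝ) < m := by exact_mod_cast hm
  have h1 : ∑ f, (((𝒯 f).filter fun t => f ∘ t = x).card : ℝ) ≤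
      ∑ t : Fin s → Fin m, if Function.Injective t then
        ((univ.filter fun f : Fin m → Fin n => f ∘ t = x).card : ℝ) else 0 := by
    have : ∀ f, (((𝒯 f).filter fun t => f ∘ t = x).card : ℝ) ≤ ∑ t : Fin s → Fin m,
        if Function.Injective t then (if f ∘ t = x then 1 else 0) else 0 := by
      intro f
      rw [← sum_filter, ← sum_filter, sum_const, nsmul_eq_mul, mul_one]
      refine Nat.cast_le.2 (card_le_card fun t ht => ?_)
      obtain ⟨ht1, ht2⟩ := mem_filter.1 ht
      exact mem_filter.2 ⟨mem_filter.2 ⟨mem_univ _, hinj f t ht1⟩, ht2⟩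
    refine (sum_le_sum fun f _ => this f).trans (le_of_eq ?_)
    rw [sum_comm]
    refine sum_congr rfl fun t _ => ?_
    split_ifs
    · rw [← sum_filter, sum_const, nsmul_eq_mul, mul_one]
    · rw [sum_const_zero]
  have h2 : (∑ t : Fin s → Fin m, if Function.Injective t then
        ((univ.filter fun f : Fin m → Fin n => f ∘ t = x).card : ℝ) else 0) * n ^ s ≤
        m ^ s * n ^ m := by
    rw [sum_mul]
    refine (sum_le_card_nsmul univ _ ((n : ℝ) ^ m) fun t _ => ?_).trans (le_of_eq ?_)
    · split_ifs with ht
      · have := card_fun_comp_eq_mul_le ht x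
        simp only [Fintype.card_fin] at this
        exact_mod_cast this
      · rw [zero_mul]; positivity
    · rw [card_univ, Fintype.card_fun, nsmul_eq_mul]; simp
  unfold sampleWeight
  calc _ = (n : ℝ) / (m * n ^ m) *
          ((∑ f, (((𝒯 f).filter fun t => f ∘ t = x).card : ℝ)) * n ^ s) := by ring
    _ ≤ (n : ℝ) / (m * n ^ m) * (m ^ s * n ^ m) := by
        refine mul_le_mul_of_nonneg_left (le_trans ?_ h2) (by positivity)
        exact mul_le_mul_of_nonneg_right h1 (by positivity)
    _ = m ^ s * n / m := by field_simp
    _ ≤ m ^ s * n := div_le_self (by positivity) (by exact_mod_cast hm)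

theorem sum_sampleWeight_le {n m s : ℕ} (hn : 0 < n) (hm : 0 < m)
    (𝒯 : (Fin m → Fin n) → Finset (Fin s → Fin m))
    (hdisj : ∀ f, ∀ t ∈ 𝒯 f, ∀ t' ∈ 𝒯 f, ∀ i i', t i = t' i' → t = t' ∧ i = i') (v : Fin n) :
    ∑ i, ∑ x with x i = v, sampleWeight 𝒯 x ≤ 1 := by
  classical
  have hn' : (0 : ℝ) < n := by exact_mod_cast hn
  have hm' : (0 : ℝ) < m := by exact_mod_cast hm
  have h1 : ∀ i : Fin s, ∑ x with x i = v, sampleWeight 𝒯 x = (n : ℝ) / (m * n ^ m) *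
      ∑ f, (((𝒯 f).filter fun t => f (t i) = v).card : ℝ) := by
    intro i
    unfold sampleWeight
    rw [← mul_sum, sum_comm]
    congr 1
    refine sum_congr rfl fun f _ => ?_
    rw [card_eq_sum_card_fiberwise (f := fun t => f ∘ t)
      (t := univ.filter fun x : Fin s → Fin n => x i = v)]
    · push_cast
      refine sum_congr rfl fun x hx => ?_
      rw [filter_filter]
      congr 2
      refine filter_congr fun t _ => ?_
      constructor
      · rintro rfl
        exact ⟨(mem_filter.1 hx).2, rfl⟩
      · exact fun h => h.2
    · intro t ht
      have := (mem_filter.1 (mem_coe.1 ht)).2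
      simpa using this
  have h2 : ∀ f, ∑ i, (((𝒯 f).filter fun t => f (t i) = v).card : ℝ) ≤
      ((univ.filter fun j => f j = v).card : ℝ) := by
    intro f
    rw [← Nat.cast_sum, ← card_sigma]
    refine Nat.cast_le.2 (card_le_card_of_injOn (fun p => p.2 p.1) ?_ ?_)
    · rintro ⟨i, t⟩ h
      simp only [coe_sigma, Set.mem_sigma_iff, mem_coe, mem_filter] at h
      simpa using h.2.2
    · rintro ⟨i, t⟩ h ⟨i', t'⟩ h' heq
      simp only [coe_sigma, Set.mem_sigma_iff, mem_coe, mem_filter] at h h' heq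
      obtain ⟨rfl, rfl⟩ := hdisj f t h.2.1 t' h'.2.1 i i' heq
      rfl
  have h3 : (∑ f : Fin m → Fin n, ((univ.filter fun j => f j = v).card : ℝ)) * n ≤ m * n ^ m := by
    have : ∑ f : Fin m → Fin n, ((univ.filter fun j => f j = v).card : ℝ) =
        ∑ j : Fin m, ((univ.filter fun f : Fin m → Fin n => f j = v).card : ℝ) := by
      simp_rw [card_eq_sum_ones, sum_filter]
      push_cast
      rw [sum_comm]
    rw [this, sum_mul]
    refine (sum_le_card_nsmul univ _ ((n : ℝ) ^ m) fun j _ => ?_).trans (le_of_eq ?_)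
    · have := card_fun_comp_eq_mul_le (V := Fin n) (t := fun _ : Fin 1 => j)
        (fun _ _ _ => Subsingleton.elim _ _) (fun _ => v)
      simp only [Fintype.card_fin, pow_one] at this
      have heq : (univ.filter fun f : Fin m → Fin n => f ∘ (fun _ : Fin 1 => j) = fun _ => v) =
          univ.filter fun f : Fin m → Fin n => f j = v :=
        filter_congr fun f _ => ⟨fun h => congrFun h 0, fun h => funext fun _ => h⟩
      rw [heq] at this
      exact_mod_cast this
    · rw [card_univ, Fintype.card_fin, nsmul_eq_mul]
  simp_rw [h1]
  rw [← mul_sum, sum_comm]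
  calc _ ≤ (n : ℝ) / (m * n ^ m) * ∑ f : Fin m → Fin n, ((univ.filter fun j => f j = v).card : ℝ) := by
        gcongr with f; exact h2 f
    _ ≤ 1 := by
        rw [div_mul_eq_mul_div, div_le_one (by positivity)]
        linarith

theorem sum_sampleWeight {n m s : ℕ}
    (𝒯 : (Fin m → Fin n) → Finset (Fin s → Fin m)) :
    ∑ x, sampleWeight 𝒯 x = (n : ℝ) / (m * n ^ m) * ∑ f, ((𝒯 f).card : ℝ) := by
  unfold sampleWeight
  rw [← mul_sum, sum_comm]
  congr 1
  refine sum_congr rfl fun f _ => ?_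
  rw [card_eq_sum_card_fiberwise (f := fun t => f ∘ t) (t := univ) (fun _ _ => by simp)]
  push_cast
  rfl

theorem tile_of_sampleWeight_pos {n m s : ℕ} {G : Fin n → Fin n → Prop}
    (𝒯 : (Fin m → Fin n) → Finset (Fin s → Fin m))
    (htile : ∀ f, ∀ t ∈ 𝒯 f, Tile (fun i j => G (f i) (f j)) t) {x : Fin s → Fin n}
    (hx : 0 < sampleWeight 𝒯 x) : Tile G x := by
  have h1 := pos_of_mul_pos_right hx (by positivity)
  obtain ⟨f, -, hf⟩ := exists_lt_of_sum_lt (f := fun _ => (0 : ℝ)) (by simpa using h1)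
  obtain ⟨t, htx⟩ := card_pos.1 (by exact_mod_cast hf :
    0 < ((𝒯 f).filter fun t => f ∘ t = x).card)
  obtain ⟨ht, rfl⟩ := mem_filter.1 htx
  exact fun i j hij hij' => htile f t ht i j hij hij'

/-- Averaging the tilings of random samples gives a spread-out fractional tiling. -/
theorem exists_spread_weights (s : ℕ) (hs : 2 ≤ s) (η : ℝ) (hη : 0 < η) :
    ∃ c : ℝ, 0 < c ∧ ∀ n : ℕ, 0 < n → ∀ G : Fin n → Fin n → Prop, (∀ v, ¬ G v v) →
      (∀ v, ∑ w, (defect G v w : ℝ) ≤ (2 / s - 2 * η) * n) →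
      ∃ w : (Fin s → Fin n) → ℝ, (∀ x, 0 ≤ w x) ∧ (∀ x, 0 < w x → Tile G x) ∧
        (∀ x, w x * n ^ s ≤ c * n) ∧ (∀ v, ∑ i, ∑ x with x i = v, w x ≤ 1) ∧
        (1 - η) * n ≤ s * ∑ x, w x := by
  by_cases hq : 2 / s - 2 * η < 0
  · refine ⟨1, one_pos, fun n hn G hG hdeg => ?_⟩
    have h1 := hdeg ⟨0, hn⟩
    have h2 : (0 : ℝ) ≤ ∑ w, (defect G ⟨0, hn⟩ w : ℝ) := by positivity
    have : (0 : ℝ) < n := by exact_mod_cast hn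
    nlinarith
  push Not at hq
  have hs0 : (0 : ℝ) < s := by positivity
  obtain ⟨m₀, hm₀⟩ := exists_tiles_pullback s hs (η / 2) (by positivity) (by linarith)
  obtain ⟨m₁, hm₁⟩ := exists_nat_ge (4 / η)
  obtain ⟨m₂, hm₂⟩ := exists_nat_ge (2 * s * (16 / η ^ 2) / η)
  obtain ⟨m, hmm₀, hmm₁, hmm₂⟩ : ∃ m, m₀ ≤ m ∧ m₁ ≤ m ∧ m₂ ≤ m :=
    ⟨m₀ + m₁ + m₂, by omega, by omega, by omega⟩
  have hm1 : 4 ≤ η * m := by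
    rw [← div_le_iff₀' hη]
    exact hm₁.trans (by exact_mod_cast hmm₁)
  have hm2 : 2 * s * (16 / η ^ 2) ≤ η * m := by
    rw [← div_le_iff₀' hη]
    exact hm₂.trans (by exact_mod_cast hmm₂)
  have hm0 : (0 : ℝ) < m := by
    by_contra! h
    nlinarith
  have hm : 0 < m := by exact_mod_cast hm0
  refine ⟨m ^ s, by positivity, fun n hn G hG hdeg => ?_⟩
  have hn' : (0 : ℝ) < n := by exact_mod_cast hn
  have hT := fun f : Fin m → Fin n => hm₀ m hmm₀ (fun i j => G (f i) (f j))
    (fun i => hG (f i))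
  choose 𝒯 hT1 hT2 hT3 using hT
  refine ⟨sampleWeight 𝒯, fun x => by unfold sampleWeight; positivity,
    fun x hx => tile_of_sampleWeight_pos 𝒯 hT1 hx,
    sampleWeight_mul_le hn hm 𝒯 fun f t ht i i' h => (hT2 f t ht t ht i i' h).2,
    sum_sampleWeight_le hn hm 𝒯 hT2, ?_⟩
  rw [sum_sampleWeight]
  have h1 := sum_card_bad_le (m := m) hn hη hdeg hm1
  have h2 := sum_le_sum fun f (_ : f ∈ univ) => hT3 f
  rw [sum_sub_distrib, sum_const, card_univ, Fintype.card_fun, nsmul_eq_mul] at h2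
  simp only [Fintype.card_fin] at h2
  have h3 : ∀ f : Fin m → Fin n, (univ.filter fun i => (2 / s - 2 * (η / 2)) * m <
      ∑ j, (defect (fun i j => G (f i) (f j)) i j : ℝ)) = univ.filter fun i =>
      ((2 / s - 2 * η) + η) * m < ∑ j, (defect G (f i) (f j) : ℝ) := by
    intro f
    refine filter_congr fun i _ => ?_
    rw [show (2 / (s : ℝ) - 2 * (η / 2)) = 2 / s - 2 * η + η by ring]
    rfl
  simp_rw [h3] at h2
  push_cast at h2
  have h4 : (n : ℝ) ^ m * ((1 - η / 2) * m / s - 16 / η ^ 2) ≤ ∑ f, ((𝒯 f).card : ℝ) := by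
    linarith
  calc (1 - η) * n ≤ n * ((1 - η / 2) - s * (16 / η ^ 2) / m) := by
        have : s * (16 / η ^ 2) / m ≤ η / 2 := by
          rw [div_le_iff₀ hm0]; linarith
        nlinarith
    _ = s * (n / (m * n ^ m) * ((n : ℝ) ^ m * ((1 - η / 2) * m / s - 16 / η ^ 2))) := by
        field_simp
    _ ≤ _ := by gcongr

theorem mod_add_two_ne {k t j : ℕ} (h1 : t < j) (h2 : j ≤ t + k) :
    t % (k + 2) ≠ j % (k + 2) ∧ t % (k + 2) ≠ j % (k + 2) + 1 := by
  obtain ⟨c, rfl⟩ := Nat.exists_eq_add_of_lt h1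
  have hr := Nat.mod_lt t (show 0 < k + 2 by omega)
  have h : (t + c + 1) % (k + 2) = (t % (k + 2) + (c + 1)) % (k + 2) := by
    rw [add_assoc, Nat.mod_add_mod]
  rw [h]
  generalize t % (k + 2) = r at hr
  by_cases hlt : r + (c + 1) < k + 2
  · rw [Nat.mod_eq_of_lt hlt]; omega
  · rw [Nat.mod_eq_sub_mod (by omega), Nat.mod_eq_of_lt (by omega)]; omega

theorem card_filter_mod_le (s L t r : ℕ) (ht : t ≤ s * L) :
    ((range t).filter fun i => i % s = r).card ≤ L := by
  rw [← card_range L]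
  refine card_le_card_of_injOn (fun i => i / s) (fun i hi => ?_) fun i hi j hj h => ?_
  · simp only [coe_filter, mem_range, Set.mem_ofPred_eq] at hi
    simp only [coe_range, Set.mem_Iio]
    exact Nat.div_lt_of_lt_mul (by omega)
  · simp only [coe_filter, mem_range, Set.mem_ofPred_eq] at hi hj h
    rw [← Nat.div_add_mod i s, ← Nat.div_add_mod j s, h, hi.2, hj.2]

open Classical in
/-- Vertices that may still be used at time `j` by a partial path `v 0, …, v (t - 1)`. -/
noncomputable def candidates {V : Type*} (G : V → V → Prop) (k : ℕ) (Y : ℕ → Finset V) (v : ℕ → V)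
    (t j : ℕ) : Finset V :=
  (Y (j % (k + 2))).filter fun y => (∀ i < t, v i ≠ y) ∧ ∀ i < t, j ≤ i + k → G (v i) y

/-- Greedy embedding of a `k`-path winding around `k + 2` disjoint clusters. -/
theorem exists_winding_path {V : Type*} {G : V → V → Prop} {k L : ℕ}
    {Y : ℕ → Finset V} {a b d : ℝ} (ha : 0 < a) (hd : 0 < d) (hd1 : d ≤ 1) (hb : 0 ≤ b)
    (hab : (k + 1) * a ≤ d ^ k * b)
    (hdisj : ∀ i < k + 2, ∀ j < k + 2, i ≠ j → Disjoint (Y i) (Y j))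
    (hcard : ∀ i < k + 2, L + b ≤ (Y i).card)
    (hLD : ∀ i < k + 2, ∀ j < k + 2, i ≠ j → i ≠ j + 1 → ∀ A ⊆ Y i, ∀ B ⊆ Y j, a ≤ A.card →
      a ≤ B.card → ∃ x ∈ A, ∃ N ⊆ B, d * B.card ≤ N.card ∧ ∀ y ∈ N, G x y)
    (v₀ : V) (t : ℕ) (ht : t ≤ (k + 2) * L) :
    ∃ v : ℕ → V, (∀ i < t, v i ∈ Y (i % (k + 2))) ∧ (∀ i < t, ∀ j < t, v i = v j → i = j) ∧
      (∀ i j, i < j → j < t → j ≤ i + k → G (v i) (v j)) ∧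
      ∀ j, t ≤ j → j ≤ t + k → d ^ (t + k - j) * b ≤ (candidates G k Y v t j).card := by
  classical
  have hmod : ∀ j, j % (k + 2) < k + 2 := fun j => Nat.mod_lt _ (by omega)
  -- the candidates for a time that no earlier vertex constrains
  have hfresh : ∀ (v : ℕ → V) (t : ℕ), t ≤ (k + 2) * L → (∀ i < t, v i ∈ Y (i % (k + 2))) →
      b ≤ (candidates G k Y v t (t + k)).card := by
    intro v t ht hv
    set r := (t + k) % (k + 2) with hr
    have h1 : Y r ⊆ candidates G k Y v t (t + k) ∪
        ((range t).filter fun i => i % (k + 2) = r).image v := by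
      intro y hy
      by_cases hyv : ∃ i < t, v i = y
      · obtain ⟨i, hi, rfl⟩ := hyv
        refine mem_union_right _ (mem_image.2 ⟨i, mem_filter.2 ⟨mem_range.2 hi, ?_⟩, rfl⟩)
        by_contra hne
        exact disjoint_left.1 (hdisj _ (hmod i) _ (hmod (t + k)) hne) (hv i hi) hy
      · push Not at hyv
        exact mem_union_left _ (mem_filter.2 ⟨hy, hyv, fun i hi h => by omega⟩)
    have h2 := (card_le_card h1).trans (card_union_le _ _)
    have h3 := card_image_le (s := (range t).filter fun i => i % (k + 2) = r) (f := v)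
    have h4 := card_filter_mod_le (k + 2) L t r ht
    have h5 := hcard r (hmod _)
    have h6 : ((Y r).card : ℝ) ≤ (candidates G k Y v t (t + k)).card + L := by
      exact_mod_cast (by omega)
    linarith
  induction t with
  | zero =>
    refine ⟨fun _ => v₀, by simp, by simp, by simp, fun j _ hj => ?_⟩
    have hcand : candidates G k Y (fun _ => v₀) 0 j = Y (j % (k + 2)) := by simp [candidates]
    rw [hcand]
    have h1 : d ^ (0 + k - j) * b ≤ b := mul_le_of_le_one_left hb (pow_le_one₀ hd.le hd1)
    have h2 := hcard _ (hmod j)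
    have : (0 : ℝ) ≤ L := by positivity
    linarith
  | succ t ih =>
    obtain ⟨v, hvY, hvinj, hvG, hvc⟩ := ih (by omega)
    have hlow : ∀ j, t ≤ j → j ≤ t + k → (k + 1) * a ≤ (candidates G k Y v t j).card := by
      intro j h1 h2
      refine hab.trans (le_trans ?_ (hvc j h1 h2))
      exact mul_le_mul_of_nonneg_right (pow_le_pow_of_le_one hd.le hd1 (by omega)) hb
    have hka : a ≤ (k + 1) * a := by nlinarith [show (0 : ℝ) ≤ k by positivity]
    let nb : V → ℕ → Finset V := fun x j => (candidates G k Y v t j).filter fun y => G x y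
    let bad : ℕ → Finset V := fun j => (candidates G k Y v t t).filter fun x =>
      ((nb x j).card : ℝ) < d * (candidates G k Y v t j).card
    have hbad : ∀ j ∈ Ioc t (t + k), ((bad j).card : ℝ) ≤ a := by
      intro j hj
      obtain ⟨h1, h2⟩ := mem_Ioc.1 hj
      by_contra! hlt
      obtain ⟨hne1, hne2⟩ := mod_add_two_ne h1 h2
      obtain ⟨x, hx, N, hNB, hN, hNG⟩ := hLD _ (hmod t) _ (hmod j) hne1 hne2 (bad j)
        ((filter_subset _ _).trans (filter_subset _ _)) (candidates G k Y v t j)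
        (filter_subset _ _) hlt.le (hka.trans (hlow j h1.le h2))
      have hx2 := (mem_filter.1 hx).2
      have : (N.card : ℝ) ≤ (nb x j).card := by
        exact_mod_cast card_le_card fun y hy => mem_filter.2 ⟨hNB hy, hNG y hy⟩
      linarith
    obtain ⟨x, hxc, hxb⟩ : ∃ x ∈ candidates G k Y v t t, x ∉ (Ioc t (t + k)).biUnion bad := by
      by_contra! hcon
      have h1 : (candidates G k Y v t t).card ≤ ((Ioc t (t + k)).biUnion bad).card :=
        card_le_card hcon
      have h2 : ((candidates G k Y v t t).card : ℝ) ≤ ∑ j ∈ Ioc t (t + k), ((bad j).card : ℝ) := by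
        exact_mod_cast h1.trans card_biUnion_le
      have h3 := sum_le_card_nsmul _ _ _ hbad
      rw [Nat.card_Ioc, nsmul_eq_mul, Nat.add_sub_cancel_left] at h3
      have h4 := hlow t le_rfl (by omega)
      linarith
    obtain ⟨hxY, hxv, hxG⟩ := mem_filter.1 hxc
    have hlt : ∀ i < t, Function.update v t x i = v i := fun i hi =>
      Function.update_of_ne hi.ne _ _
    have hvY' : ∀ i < t + 1, Function.update v t x i ∈ Y (i % (k + 2)) := by
      intro i hi
      rcases Nat.lt_succ_iff_lt_or_eq.1 hi with h | rfl
      · rw [hlt i h]; exact hvY i h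
      · rwa [Function.update_self]
    refine ⟨Function.update v t x, hvY', ?_, ?_, ?_⟩
    · intro i hi j hj h
      rcases Nat.lt_succ_iff_lt_or_eq.1 hi with h1 | rfl <;>
      rcases Nat.lt_succ_iff_lt_or_eq.1 hj with h2 | rfl
      · rw [hlt i h1, hlt j h2] at h
        exact hvinj i h1 j h2 h
      · rw [hlt i h1, Function.update_self] at h
        exact absurd h (hxv i h1)
      · rw [hlt j h2, Function.update_self] at h
        exact absurd h.symm (hxv j h2)
      · rfl
    · intro i j hij hj hjk
      rcases Nat.lt_succ_iff_lt_or_eq.1 hj with h2 | rfl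
      · rw [hlt i (by omega), hlt j h2]
        exact hvG i j hij h2 hjk
      · rw [hlt i hij, Function.update_self]
        exact hxG i hij hjk
    · intro j h1 h2
      by_cases hj : j = t + 1 + k
      · subst hj
        simpa using hfresh _ (t + 1) ht hvY'
      · have hjI : j ∈ Ioc t (t + k) := mem_Ioc.2 ⟨by omega, by omega⟩
        have h3 : d * (candidates G k Y v t j).card ≤ (nb x j).card := by
          by_contra! h
          exact hxb (mem_biUnion.2 ⟨j, hjI, mem_filter.2 ⟨hxc, h⟩⟩)
        have h4 : nb x j ⊆ candidates G k Y (Function.update v t x) (t + 1) j := by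
          intro y hy
          obtain ⟨hy1, hy2⟩ := mem_filter.1 hy
          obtain ⟨hy3, hy4, hy5⟩ := mem_filter.1 hy1
          refine mem_filter.2 ⟨hy3, fun i hi => ?_, fun i hi hij => ?_⟩
          · rcases Nat.lt_succ_iff_lt_or_eq.1 hi with h | rfl
            · rw [hlt i h]; exact hy4 i h
            · rw [Function.update_self]
              rintro rfl
              exact disjoint_left.1 (hdisj _ (hmod i) _ (hmod j)
                (mod_add_two_ne (by omega) (by omega)).1) hxY hy3
          · rcases Nat.lt_succ_iff_lt_or_eq.1 hi with h | rfl
            · rw [hlt i h]; exact hy5 i h hij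
            · rwa [Function.update_self]
        have h5 := hvc j (by omega) (by omega)
        have h6 : ((nb x j).card : ℝ) ≤
            (candidates G k Y (Function.update v t x) (t + 1) j).card := by
          exact_mod_cast card_le_card h4
        have h7 : d ^ (t + 1 + k - j) = d * d ^ (t + k - j) := by
          rw [← pow_succ']; congr 1; omega
        rw [h7, mul_assoc]
        exact (mul_le_mul_of_nonneg_left h5 hd.le).trans (h3.trans h6)

/-- Large subsets of `X` and `Y` contain a vertex of `X` with out-density `d` into `Y`. -/
def LowerDense {V : Type*} (G : V → V → Prop) (a d : ℝ) (X Y : Finset V) : Prop :=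
  ∀ A ⊆ X, ∀ B ⊆ Y, a ≤ A.card → a ≤ B.card →
    ∃ x ∈ A, ∃ N ⊆ B, d * B.card ≤ N.card ∧ ∀ y ∈ N, G x y

theorem exists_kPath_of_box {n k L : ℕ} {G : Fin n → Fin n → Prop}
    {Y : Fin (k + 2) → Finset (Fin n)} {a b d : ℝ} (ha : 0 < a) (hd : 0 < d) (hd1 : d ≤ 1)
    (hb : 0 < b) (hab : (k + 1) * a ≤ d ^ k * b)
    (hdisj : ∀ i j, i ≠ j → Disjoint (Y i) (Y j)) (hcard : ∀ i, L + b ≤ (Y i).card)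
    (hLD : ∀ i j : Fin (k + 2), i ≠ j → (i : ℕ) ≠ j + 1 → LowerDense G a d (Y i) (Y j)) :
    ∃ P : List (Fin n), IsKPath k G P ∧ P.length = (k + 2) * L ∧ (∀ v ∈ P, ∃ i, v ∈ Y i) ∧
      ∀ i, (P.toFinset ∩ Y i).card ≤ L := by
  classical
  let Z : ℕ → Finset (Fin n) := fun r => if h : r < k + 2 then Y ⟨r, h⟩ else ∅
  have hZ : ∀ r (h : r < k + 2), Z r = Y ⟨r, h⟩ := fun r h => dif_pos h
  have hne : (Y 0).Nonempty := by
    rw [← card_pos]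
    have h1 := hcard 0
    have : (0 : ℝ) < (Y 0).card := by
      have : (0 : ℝ) ≤ L := by positivity
      linarith
    exact_mod_cast this
  obtain ⟨v₀, -⟩ := hne
  have hmod : ∀ j, j % (k + 2) < k + 2 := fun j => Nat.mod_lt _ (by omega)
  obtain ⟨v, hvY, hvinj, hvG, -⟩ := exists_winding_path (G := G) (L := L) (Y := Z) ha hd hd1 hb.le hab
    (fun i hi j hj hij => by
      rw [hZ i hi, hZ j hj]; exact hdisj _ _ fun h => hij (congrArg Fin.val h))
    (fun i hi => by rw [hZ i hi]; exact hcard _)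
    (fun i hi j hj hij hij' => by
      rw [hZ i hi, hZ j hj]
      exact hLD _ _ (fun h => hij (congrArg Fin.val h)) hij') v₀ ((k + 2) * L) le_rfl
  have hvY' : ∀ t < (k + 2) * L, v t ∈ Y ⟨t % (k + 2), hmod t⟩ := fun t ht => by
    rw [← hZ]; exact hvY t ht
  refine ⟨(List.range ((k + 2) * L)).map v, ⟨?_, ?_⟩, by simp, ?_, ?_⟩
  · refine List.Nodup.map_on ?_ List.nodup_range
    intro i hi j hj h
    exact hvinj i (List.mem_range.1 hi) j (List.mem_range.1 hj) h
  · intro i j hij hijk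
    have hj := j.isLt
    simp only [List.length_map, List.length_range] at hj
    simpa using hvG i j hij hj hijk
  · intro x hx
    obtain ⟨t, ht, rfl⟩ := List.mem_map.1 hx
    exact ⟨_, hvY' t (List.mem_range.1 ht)⟩
  · intro i
    refine le_trans (card_le_card (t := ((range ((k + 2) * L)).filter
      fun t => t % (k + 2) = i).image v) ?_)
      (card_image_le.trans (card_filter_mod_le (k + 2) L _ i le_rfl))
    intro x hx
    obtain ⟨hx1, hx2⟩ := mem_inter.1 hx
    obtain ⟨t, ht, rfl⟩ := List.mem_map.1 (List.mem_toFinset.1 hx1)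
    have ht' := List.mem_range.1 ht
    refine mem_image.2 ⟨t, mem_filter.2 ⟨mem_range.2 ht', ?_⟩, rfl⟩
    by_contra hne
    exact disjoint_left.1 (hdisj ⟨t % (k + 2), hmod t⟩ i fun h => hne (congrArg Fin.val h))
      (hvY' t ht') hx2

/-- Disjoint `k`-paths, one for each box, sharing the clusters they wind around. -/
theorem exists_kPaths_of_boxes {n k : ℕ} {G : Fin n → Fin n → Prop} {Q : Type*} [DecidableEq Q]
    {Y : Q → Fin (k + 2) → Finset (Fin n)} {a b d : ℝ} (ha : 0 < a) (hd : 0 < d) (hd1 : d ≤ 1)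
    (hb : 0 < b) (hab : (k + 1) * a ≤ d ^ k * b)
    (hdisj : ∀ q i q' i', ¬ (q = q' ∧ i = i') → Disjoint (Y q i) (Y q' i'))
    (ℬ : Finset (Fin (k + 2) → Q)) (L : (Fin (k + 2) → Q) → ℕ)
    (hcard : ∀ B ∈ ℬ, ∀ i, ((∑ B' ∈ ℬ with B' i = B i, L B' : ℕ) : ℝ) + b ≤ (Y (B i) i).card)
    (hLD : ∀ B ∈ ℬ, ∀ i j : Fin (k + 2), i ≠ j → (i : ℕ) ≠ j + 1 →
      LowerDense G a d (Y (B i) i) (Y (B j) j)) :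
    ∃ Ps : List (List (Fin n)), Ps.length = ℬ.card ∧ (∀ P ∈ Ps, IsKPath k G P) ∧
      List.Pairwise (fun P Q => ∀ v ∈ P, v ∉ Q) Ps ∧
      (Ps.map List.length).sum = (k + 2) * ∑ B ∈ ℬ, L B ∧
      ∀ q i, (Ps.flatten.toFinset ∩ Y q i).card ≤ ∑ B ∈ ℬ with B i = q, L B := by
  classical
  induction ℬ using Finset.induction_on with
  | empty => exact ⟨[], by simp⟩
  | insert B ℬ hB ih =>
    obtain ⟨Ps, hlen, hpath, hpair, hsum, hused⟩ := ih
      (fun B' hB' i => by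
        refine le_trans (by
          gcongr
          exact subset_insert _ _) (hcard B' (mem_insert_of_mem hB') i))
      (fun B' hB' => hLD B' (mem_insert_of_mem hB'))
    set used := Ps.flatten.toFinset with hused_def
    have hmemused : ∀ v, v ∈ used ↔ ∃ P ∈ Ps, v ∈ P := fun v => by simp [hused_def]
    have hins : ∀ q i, ∑ B' ∈ insert B ℬ with B' i = q, L B' =
        (if B i = q then L B else 0) + ∑ B' ∈ ℬ with B' i = q, L B' := by
      intro q i
      rw [sum_filter, sum_insert hB, ← sum_filter]
    obtain ⟨P, hP, hPlen, hPY, hPcard⟩ := exists_kPath_of_box (G := G) (L := L B)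
      (Y := fun i => Y (B i) i \ used) ha hd hd1 hb hab
      (fun i j hij => (hdisj _ _ _ _ fun h => hij h.2).mono sdiff_subset sdiff_subset)
      (fun i => by
        have h1 := hcard B (mem_insert_self _ _) i
        rw [hins, if_pos rfl] at h1
        have h2 := hused (B i) i
        have h3 := card_sdiff_add_card_inter (Y (B i) i) used
        rw [inter_comm] at h3
        have h4 : ((Y (B i) i).card : ℝ) ≤ (Y (B i) i \ used).card +
            ((∑ B' ∈ ℬ with B' i = B i, L B' : ℕ) : ℝ) := by exact_mod_cast (by omega)
        rw [Nat.cast_add] at h1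
        linarith)
      (fun i j hij hij' A hA C hC => hLD B (mem_insert_self _ _) i j hij hij' A
        (hA.trans sdiff_subset) C (hC.trans sdiff_subset))
    refine ⟨P :: Ps, ?_, ?_, ?_, ?_, ?_⟩
    · rw [List.length_cons, hlen, card_insert_of_notMem hB]
    · intro P' hP'
      rcases List.mem_cons.1 hP' with rfl | h
      · exact hP
      · exact hpath P' h
    · refine List.pairwise_cons.2 ⟨fun P' hP' v hv hv' => ?_, hpair⟩
      obtain ⟨i, hi⟩ := hPY v hv
      exact (mem_sdiff.1 hi).2 ((hmemused v).2 ⟨P', hP', hv'⟩)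
    · rw [List.map_cons, List.sum_cons, hsum, hPlen, sum_insert hB]; ring
    · intro q i
      rw [hins, List.flatten_cons, List.toFinset_append, union_inter_distrib_right]
      refine (card_union_le _ _).trans (add_le_add ?_ (hused q i))
      split_ifs with h
      · subst h
        refine le_trans (card_le_card fun v hv => ?_) (hPcard i)
        obtain ⟨h1, h2⟩ := mem_inter.1 hv
        obtain ⟨j, hj⟩ := hPY v (List.mem_toFinset.1 h1)
        exact mem_inter.2 ⟨h1, mem_sdiff.2 ⟨h2, (mem_sdiff.1 hj).2⟩⟩
      · rw [Nat.le_zero, card_eq_zero, eq_empty_iff_forall_notMem]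
        intro v hv
        obtain ⟨h1, h2⟩ := mem_inter.1 hv
        obtain ⟨j, hj⟩ := hPY v (List.mem_toFinset.1 h1)
        refine disjoint_left.1 (hdisj (B j) j q i ?_) (mem_sdiff.1 hj).1 h2
        rintro ⟨rfl, rfl⟩
        exact h rfl

/-- A colouring form of the regularity lemma. -/
theorem exists_regular_coloring {d e : ℝ} (he : 0 < e) (hed : e ≤ d) :
    ∃ M N : ℕ, 0 < N ∧ ∀ {α : Type} [Fintype α] [DecidableEq α] (H : SimpleGraph α)
      [DecidableRel H.Adj], N ≤ Fintype.card α →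
      ∃ (m : ℕ) (c : α → Fin m) (R : Fin m → Fin m → Prop), 0 < m ∧ m ≤ M ∧
        (∀ q, (#{p | c p = q} : ℝ) ≤ 2 * Fintype.card α / m) ∧
        (∀ q q', R q q' → H.IsUniform e ({p | c p = q} : Finset α) {p | c p = q'} ∧
          d ≤ H.edgeDensity ({p | c p = q} : Finset α) {p | c p = q'}) ∧
        Set.ncard {p : α × α | H.Adj p.1 p.2 ∧ ¬ R (c p.1) (c p.2)}
          ≤ 9 * d * (Fintype.card α : ℝ) ^ 2 := by
  classical
  set l := ⌈4 / e⌉₊ with hl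
  have hlpos : 0 < l := Nat.ceil_pos.2 (by positivity)
  refine ⟨SzemerediRegularity.bound e l, l, hlpos, ?_⟩
  intro α _ _ H _ hcard
  obtain ⟨P, hP, hlP, hPM, hPe⟩ := szemeredi_regularity H he hcard
  have hne : Nonempty α := Fintype.card_pos_iff.1 (hlpos.trans_le hcard)
  set m := #P.parts with hm
  have hmpos : 0 < m := hlpos.trans_le hlP
  let φ : P.parts ≃ Fin m := P.parts.equivFin
  let c : α → Fin m := fun p => φ ⟨P.part p, P.part_mem.2 (mem_univ p)⟩
  have hc : ∀ q, ({p | c p = q} : Finset α) = (φ.symm q : Finset α) := by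
    intro q
    ext p
    simp only [mem_filter, mem_univ, true_and, c]
    rw [← Equiv.eq_symm_apply, Subtype.ext_iff]
    constructor
    · intro h
      rw [← h]
      exact P.mem_part (mem_univ p)
    · intro h
      exact P.part_eq_of_mem (φ.symm q).2 h
  have hcc : ∀ p, (φ.symm (c p) : Finset α) = P.part p := by
    intro p
    simp [c]
  refine ⟨m, c, fun q q' => q ≠ q' ∧ H.IsUniform e ({p | c p = q} : Finset α) {p | c p = q'} ∧
      d ≤ H.edgeDensity ({p | c p = q} : Finset α) {p | c p = q'}, hmpos, hPM, ?_,
      fun q q' h => h.2, ?_⟩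
  · intro q
    rw [hc]
    have h1 := hP.card_part_le_average_add_one (φ.symm q).2
    have h2 : m ≤ Fintype.card α := by
      simpa [hm] using P.card_parts_le_card
    have hmR : (0 : ℝ) < m := by exact_mod_cast hmpos
    have h3 : ((#(univ : Finset α) / #P.parts : ℕ) : ℝ) ≤ Fintype.card α / m := by
      simpa [hm] using (Nat.cast_div_le (α := ℝ) (m := Fintype.card α) (n := m))
    have h4 : (1 : ℝ) ≤ Fintype.card α / m := by
      rw [le_div_iff₀ hmR]; simpa using (by exact_mod_cast h2 : (m : ℝ) ≤ Fintype.card α)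
    have h5 : ((#(φ.symm q : Finset α) : ℕ) : ℝ) ≤
        ((#(univ : Finset α) / #P.parts : ℕ) : ℝ) + 1 := by exact_mod_cast h1
    rw [mul_div_assoc]
    linarith
  · let A := (P.nonUniforms H e).biUnion fun (U, V) ↦ U ×ˢ V
    let B := P.parts.biUnion offDiag
    let C := (P.sparsePairs H d).biUnion fun (U, V) ↦ H.interedges U V
    have hsub : {p : α × α | H.Adj p.1 p.2 ∧ ¬ (c p.1 ≠ c p.2 ∧
        H.IsUniform e ({x | c x = c p.1} : Finset α) {x | c x = c p.2} ∧
        d ≤ H.edgeDensity ({x | c x = c p.1} : Finset α) {x | c x = c p.2})} ⊆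
        ((A ∪ B ∪ C : Finset (α × α)) : Set (α × α)) := by
      rintro ⟨x, y⟩ ⟨hadj, hnot⟩
      simp only [hc, hcc] at hnot
      have hx := P.part_mem.2 (mem_univ x)
      have hy := P.part_mem.2 (mem_univ y)
      have hx' := P.mem_part (mem_univ x)
      have hy' := P.mem_part (mem_univ y)
      simp only [coe_union, Set.mem_union, mem_coe, A, B, C, mem_biUnion, mem_offDiag,
        Prod.exists, mem_product, Finpartition.mk_mem_nonUniforms,
        Finpartition.mk_mem_sparsePairs, SimpleGraph.mem_interedges_iff]
      by_cases hxy : P.part x = P.part y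
      · exact Or.inl (Or.inr ⟨_, hx, hx', hxy ▸ hy', hadj.ne⟩)
      have hcne : c x ≠ c y := by
        intro h
        apply hxy
        rw [← hcc, ← hcc, h]
      by_cases hu : H.IsUniform e (P.part x) (P.part y)
      · refine Or.inr ⟨_, _, ⟨hx, hy, hxy, ?_⟩, hx', hy', hadj⟩
        by_contra hd
        exact hnot ⟨hcne, hu, not_lt.1 hd⟩
      · exact Or.inl (Or.inl ⟨_, _, ⟨hx, hy, hxy, hu⟩, hx', hy'⟩)
    have h4e : 4 / e ≤ #P.parts := (Nat.le_ceil _).trans (by exact_mod_cast hlP)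
    have hA : (#A : ℝ) < 4 * e * (Fintype.card α : ℝ) ^ 2 := by
      simpa using hP.sum_nonUniforms_lt univ_nonempty he hPe
    have hB : (#B : ℝ) ≤ e / 2 * (Fintype.card α : ℝ) ^ 2 := by
      simpa using hP.card_biUnion_offDiag_le he h4e
    have hC : (#C : ℝ) ≤ 4 * d * (Fintype.card α : ℝ) ^ 2 := by
      simpa using hP.card_interedges_sparsePairs_le (G := H) (ε := d) (he.le.trans hed)
    have hcardle := Set.ncard_le_ncard hsub (Finset.finite_toSet _)
    rw [Set.ncard_coe_finset] at hcardle
    have hU : #(A ∪ B ∪ C) ≤ #A + #B + #C :=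
      (card_union_le _ _).trans (Nat.add_le_add_right (card_union_le _ _) _)
    have hU' : ((Set.ncard {p : α × α | H.Adj p.1 p.2 ∧ ¬ (c p.1 ≠ c p.2 ∧
        H.IsUniform e ({x | c x = c p.1} : Finset α) {x | c x = c p.2} ∧
        d ≤ H.edgeDensity ({x | c x = c p.1} : Finset α) {x | c x = c p.2})} : ℕ) : ℝ) ≤
        #A + #B + #C := by exact_mod_cast hcardle.trans hU
    have hsq : (0 : ℝ) ≤ (Fintype.card α : ℝ) ^ 2 := by positivity
    have := mul_le_mul_of_nonneg_right hed hsq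
    nlinarith

/-- Two large subsets of a dense uniform pair contain a vertex of large degree. -/
theorem exists_degree_ge_of_isUniform {α : Type*} [DecidableEq α] {H : SimpleGraph α}
    [DecidableRel H.Adj] {e d : ℝ} (hed : e < d) {X Y A B : Finset α} (hU : H.IsUniform e X Y)
    (hd : d ≤ H.edgeDensity X Y) (hA : A ⊆ X) (hB : B ⊆ Y) (hAc : #X * e ≤ #A)
    (hBc : #Y * e ≤ #B) : ∃ x ∈ A, (d - e) * #B ≤ #{y ∈ B | H.Adj x y} := by
  have h1 := hU hA hB hAc hBc
  have h2 : d - e < H.edgeDensity A B := by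
    have := (abs_lt.1 h1).1
    linarith
  by_contra! hcon
  have hsum : #(H.interedges A B) = ∑ x ∈ A, #{y ∈ B | H.Adj x y} := by
    rw [SimpleGraph.interedges, Rel.interedges, card_filter, sum_product]
    simp only [card_filter]
  have hle : (#(H.interedges A B) : ℝ) ≤ (d - e) * (#A * #B) := by
    rw [hsum]
    push_cast
    calc ∑ x ∈ A, (#{y ∈ B | H.Adj x y} : ℝ) ≤ ∑ x ∈ A, (d - e) * #B :=
          sum_le_sum fun x hx => (hcon x hx).le
      _ = _ := by rw [sum_const, nsmul_eq_mul]; ring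
  rw [SimpleGraph.edgeDensity_def] at h2
  push_cast at h2
  rcases (by positivity : (0 : ℝ) ≤ #A * #B).eq_or_lt with h0 | h0
  · rw [← h0, div_zero] at h2
    linarith
  · rw [lt_div_iff₀ h0] at h2
    linarith

/-- The auxiliary graph on vertex-role pairs whose edges record compatibility in a tile. -/
def roleGraph {n : ℕ} (s : ℕ) (G : Fin n → Fin n → Prop) : SimpleGraph (Fin n × Fin s) where
  Adj p q := p.2 ≠ q.2 ∧ ((p.2 : ℕ) ≠ q.2 + 1 → G p.1 q.1) ∧ ((q.2 : ℕ) ≠ p.2 + 1 → G q.1 p.1)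
  symm := ⟨fun _ _ h => ⟨h.1.symm, h.2.2, h.2.1⟩⟩
  loopless := ⟨fun _ h => h.1 rfl⟩

theorem Tile.roleGraph_adj {n s : ℕ} {G : Fin n → Fin n → Prop} {x : Fin s → Fin n}
    (hx : Tile G x) {i j : Fin s} (hij : i ≠ j) : (roleGraph s G).Adj (x i, i) (x j, j) :=
  ⟨hij, fun h => hx i j hij h, fun h => hx j i hij.symm h⟩

theorem LowerDense.mono {V : Type*} {G : V → V → Prop} {a d : ℝ} {X Y X' Y' : Finset V}
    (h : LowerDense G a d X Y) (hX : X' ⊆ X) (hY : Y' ⊆ Y) : LowerDense G a d X' Y' :=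
  fun A hA B hB => h A (hA.trans hX) B (hB.trans hY)

/-- A regular colouring of vertex-role pairs: few role edges are lost, and kept pairs of colour
classes are lower dense in every required direction. -/
theorem exists_lowerDense_coloring {s : ℕ} (hs : 0 < s) {d e : ℝ} (he : 0 < e) (hed : e < d) :
    ∃ M N : ℕ, 0 < N ∧ ∀ n : ℕ, N ≤ n → ∀ G : Fin n → Fin n → Prop,
      ∃ (m : ℕ) (c : Fin n × Fin s → Fin m) (R : Fin m → Fin m → Prop), 0 < m ∧ m ≤ M ∧
        (∀ q q', R q q' → ∀ i j : Fin s, i ≠ j → (i : ℕ) ≠ j + 1 →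
          LowerDense G (2 * s * n * e / m) (d - e) {v | c (v, i) = q} {v | c (v, j) = q'}) ∧
        Set.ncard {p : (Fin n × Fin s) × (Fin n × Fin s) |
            (roleGraph s G).Adj p.1 p.2 ∧ ¬ R (c p.1) (c p.2)}
          ≤ 9 * d * ((s : ℝ) * n) ^ 2 := by
  classical
  obtain ⟨M, N, hN, h⟩ := exists_regular_coloring he hed.le
  refine ⟨M, N, hN, fun n hn G => ?_⟩
  have hcard : Fintype.card (Fin n × Fin s) = n * s := by simp
  obtain ⟨m, c, R, hm, hmM, hsize, hR, hbad⟩ := h (roleGraph s G)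
    (by rw [hcard]; exact hn.trans (Nat.le_mul_of_pos_right _ hs))
  rw [hcard] at hbad
  refine ⟨m, c, R, hm, hmM, ?_, hbad.trans (le_of_eq (by push_cast; ring))⟩
  intro q q' hq i j hij hij' A hA B hB hAc hBc
  obtain ⟨hU, hd⟩ := hR q q' hq
  let f : ∀ i : Fin s, Fin n ↪ Fin n × Fin s := fun i => ⟨fun v => (v, i), fun u v h => by
    simpa using h⟩
  have hbound : ∀ q, (#{p | c p = q} : ℝ) * e ≤ 2 * s * n * e / m := by
    intro q
    have h1 := mul_le_mul_of_nonneg_right (hsize q) he.le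
    rw [hcard] at h1
    refine h1.trans (le_of_eq ?_)
    push_cast
    ring
  obtain ⟨p, hp, hdeg⟩ := exists_degree_ge_of_isUniform (A := A.map (f i)) (B := B.map (f j)) hed
    hU hd
    (by intro p hp
        obtain ⟨v, hv, rfl⟩ := mem_map.1 hp
        exact mem_filter.2 ⟨mem_univ _, (mem_filter.1 (hA hv)).2⟩)
    (by intro p hp
        obtain ⟨v, hv, rfl⟩ := mem_map.1 hp
        exact mem_filter.2 ⟨mem_univ _, (mem_filter.1 (hB hv)).2⟩)
    (by rw [card_map]; exact (hbound q).trans hAc)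
    (by rw [card_map]; exact (hbound q').trans hBc)
  obtain ⟨x, hx, rfl⟩ := mem_map.1 hp
  refine ⟨x, hx, {y ∈ B | (roleGraph s G).Adj (x, i) (y, j)}, filter_subset _ _, ?_, ?_⟩
  · rw [filter_map, card_map, card_map] at hdeg
    exact hdeg
  · intro y hy
    exact ((mem_filter.1 hy).2.2.1) hij'

theorem card_filter_two_coords_mul_le {s n : ℕ} {i j : Fin s} (hij : i ≠ j) (u v : Fin n) :
    #{x : Fin s → Fin n | x i = u ∧ x j = v} * n ^ 2 ≤ n ^ s := by
  classical
  have h := card_le_card_of_injOn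
    (s := ({x : Fin s → Fin n | x i = u ∧ x j = v} : Finset _) ×ˢ
      (univ : Finset (Fin n × Fin n)))
    (t := (univ : Finset (Fin s → Fin n)))
    (fun z => Function.update (Function.update z.1 i z.2.1) j z.2.2)
    (fun _ _ => mem_coe.2 (mem_univ _)) (by
      rintro ⟨x, a, b⟩ hx ⟨y, a', b'⟩ hy h
      simp only [coe_product, Set.mem_prod, mem_coe, mem_filter, mem_univ, true_and,
        and_true] at hx hy
      have hfun := fun r => congrFun h r
      have hb : b = b' := by simpa using hfun j
      have ha : a = a' := by simpa [Function.update_of_ne hij] using hfun i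
      have hxy : x = y := by
        ext1 r
        by_cases hj : r = j
        · rw [hj, hx.2, hy.2]
        by_cases hi : r = i
        · rw [hi, hx.1, hy.1]
        simpa [Function.update_of_ne hj, Function.update_of_ne hi] using hfun r
      rw [ha, hb, hxy])
  simpa [card_product, sq] using h

/-- A spread-out weighting of tiles loses little weight when few role edges are deleted. -/
theorem sum_weight_bad_le {s n : ℕ} (hn : 0 < n) {G : Fin n → Fin n → Prop}
    {w : (Fin s → Fin n) → ℝ} (hw : ∀ x, 0 ≤ w x) (hT : ∀ x, 0 < w x → Tile G x) {c κ : ℝ}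
    (hc : 0 ≤ c) (hspread : ∀ x, w x * n ^ s ≤ c * n)
    {K : (Fin n × Fin s) → (Fin n × Fin s) → Prop}
    (hbad : Set.ncard {p : (Fin n × Fin s) × (Fin n × Fin s) |
      (roleGraph s G).Adj p.1 p.2 ∧ ¬ K p.1 p.2} ≤ κ * (n : ℝ) ^ 2)
    (S : Finset (Fin s → Fin n))
    (hS : ∀ x ∈ S, ∃ i j, i ≠ j ∧ ¬ K (x i, i) (x j, j)) :
    ∑ x ∈ S, w x ≤ c * κ * n := by
  classical
  have hnR : (0 : ℝ) < n := by exact_mod_cast hn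
  set D : Finset ((Fin n × Fin s) × (Fin n × Fin s)) :=
    {p | (roleGraph s G).Adj p.1 p.2 ∧ ¬ K p.1 p.2} with hD
  have hDc : (#D : ℝ) ≤ κ * (n : ℝ) ^ 2 := by
    rw [← Set.ncard_coe_finset, hD, coe_filter]
    simpa using hbad
  have hsub : {x ∈ S | 0 < w x} ⊆ D.biUnion fun p =>
      ({x | x p.1.2 = p.1.1 ∧ x p.2.2 = p.2.1} : Finset (Fin s → Fin n)) := by
    intro x hx
    obtain ⟨hxS, hwx⟩ := mem_filter.1 hx
    obtain ⟨i, j, hij, hK⟩ := hS x hxS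
    refine mem_biUnion.2 ⟨((x i, i), (x j, j)), ?_, by simp⟩
    exact mem_filter.2 ⟨mem_univ _, (hT x hwx).roleGraph_adj hij, hK⟩
  have hcount : #{x ∈ S | 0 < w x} * n ^ 2 ≤ #D * n ^ s := by
    calc _ ≤ (∑ p ∈ D, #{x : Fin s → Fin n | x p.1.2 = p.1.1 ∧ x p.2.2 = p.2.1}) * n ^ 2 :=
          Nat.mul_le_mul_right _ ((card_le_card hsub).trans card_biUnion_le)
      _ = ∑ p ∈ D, #{x : Fin s → Fin n | x p.1.2 = p.1.1 ∧ x p.2.2 = p.2.1} * n ^ 2 :=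
          sum_mul _ _ _
      _ ≤ ∑ p ∈ D, n ^ s := sum_le_sum fun p hp =>
          card_filter_two_coords_mul_le (mem_filter.1 hp).2.1.1 _ _
      _ = _ := by simp
  have hcountR : (#{x ∈ S | 0 < w x} : ℝ) * n ^ 2 ≤ #D * n ^ s := by exact_mod_cast hcount
  have hsum : ∑ x ∈ S, w x = ∑ x ∈ S with 0 < w x, w x := by
    rw [sum_filter]
    refine sum_congr rfl fun x _ => ?_
    split_ifs with h
    · rfl
    · exact le_antisymm (not_lt.1 h) (hw x)
  have hns : (0 : ℝ) < n ^ s := by positivity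
  have h1 : (∑ x ∈ S, w x) * n ^ s ≤ #{x ∈ S | 0 < w x} * (c * n) := by
    rw [hsum, sum_mul]
    refine (sum_le_sum fun x _ => hspread x).trans ?_
    rw [sum_const, nsmul_eq_mul]
  have h2 : (#{x ∈ S | 0 < w x} : ℝ) ≤ κ * n ^ s := by
    have : (#{x ∈ S | 0 < w x} : ℝ) * n ^ 2 ≤ κ * n ^ s * n ^ 2 := by
      calc _ ≤ _ := hcountR
        _ ≤ κ * (n : ℝ) ^ 2 * n ^ s := by gcongr
        _ = _ := by ring
    exact le_of_mul_le_mul_right this (by positivity)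
  have h3 : (∑ x ∈ S, w x) * n ^ s ≤ c * κ * n * n ^ s := by
    calc _ ≤ _ := h1
      _ ≤ κ * n ^ s * (c * n) := by gcongr
      _ = _ := by ring
  exact le_of_mul_le_mul_right h3 hns

theorem exists_disjoint_subsets_card_eq {V ι : Type*} [DecidableEq V] [DecidableEq ι]
    (S : Finset V) (D : ι → ℕ) (I : Finset ι) (h : ∑ i ∈ I, D i ≤ #S) :
    ∃ Z : ι → Finset V, (∀ i ∈ I, Z i ⊆ S ∧ #(Z i) = D i) ∧
      ∀ i ∈ I, ∀ j ∈ I, i ≠ j → Disjoint (Z i) (Z j) := by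
  induction I using Finset.induction_on generalizing S with
  | empty => exact ⟨fun _ => ∅, by simp⟩
  | insert r I hr ih =>
    rw [sum_insert hr] at h
    obtain ⟨Z₀, hZ₀, hc₀⟩ := exists_subset_card_eq ((Nat.le_add_right _ _).trans h)
    obtain ⟨Z, hZ, hd⟩ := ih (S \ Z₀) (by rw [card_sdiff_of_subset hZ₀, hc₀]; omega)
    have hdis : ∀ i ∈ I, Disjoint Z₀ (Z i) := fun i hi =>
      disjoint_sdiff.mono_right (hZ i hi).1
    have hne : ∀ i ∈ I, i ≠ r := fun i hi h => hr (h ▸ hi)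
    refine ⟨Function.update Z r Z₀, ?_, ?_⟩
    · intro i hi
      rcases mem_insert.1 hi with rfl | hi
      · simpa using ⟨hZ₀, hc₀⟩
      · rw [Function.update_of_ne (hne i hi)]
        exact ⟨(hZ i hi).1.trans sdiff_subset, (hZ i hi).2⟩
    · intro i hi j hj hij
      rcases mem_insert.1 hi with hir | hiI
      · rcases mem_insert.1 hj with hjr | hjI
        · exact absurd (hir.trans hjr.symm) hij
        · rw [hir, Function.update_self, Function.update_of_ne (hne j hjI)]
          exact hdis j hjI
      · rcases mem_insert.1 hj with hjr | hjI
        · rw [hjr, Function.update_self, Function.update_of_ne (hne i hiI)]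
          exact (hdis i hiI).symm
        · rw [Function.update_of_ne (hne i hiI), Function.update_of_ne (hne j hjI)]
          exact hd i hiI j hjI hij

/-- Rounding a fractional assignment of roles to vertices to a genuine partial assignment. -/
theorem exists_role_classes {V : Type*} [Fintype V] [DecidableEq V] {s m : ℕ}
    (c : V × Fin s → Fin m) (f : V → Fin s → ℝ) (hf : ∀ v i, 0 ≤ f v i)
    (hf1 : ∀ v, ∑ i, f v i ≤ 1) :
    ∃ Y : Fin m → Fin s → Finset V,
      (∀ q i q' i', ¬ (q = q' ∧ i = i') → Disjoint (Y q i) (Y q' i')) ∧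
      (∀ q i, Y q i ⊆ ({v | c (v, i) = q} : Finset V)) ∧
      ∀ q i, ∑ v with c (v, i) = q, f v i - (m : ℝ) ^ s ≤ #(Y q i) := by
  classical
  let key : V → Fin s → Fin m := fun v i => c (v, i)
  let S : (Fin s → Fin m) → Finset V := fun κ => {v | key v = κ}
  let D : (Fin s → Fin m) → Fin s → ℕ := fun κ i => ⌊∑ v ∈ S κ, f v i⌋₊
  have hD : ∀ κ, ∑ i, D κ i ≤ #(S κ) := by
    intro κ
    have : ((∑ i, D κ i : ℕ) : ℝ) ≤ #(S κ) := by
      push_cast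
      calc ∑ i, (D κ i : ℝ) ≤ ∑ i, ∑ v ∈ S κ, f v i :=
            sum_le_sum fun i _ => Nat.floor_le (sum_nonneg fun v _ => hf v i)
        _ = ∑ v ∈ S κ, ∑ i, f v i := sum_comm
        _ ≤ ∑ v ∈ S κ, 1 := sum_le_sum fun v _ => hf1 v
        _ = _ := by simp
    exact_mod_cast this
  choose Z hZ hZd using fun κ => exists_disjoint_subsets_card_eq (S κ) (D κ) univ (hD κ)
  have hkey : ∀ {κ i v}, v ∈ Z κ i → key v = κ := fun {κ i v} hv =>
    (mem_filter.1 ((hZ κ i (mem_univ _)).1 hv)).2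
  refine ⟨fun q i => ({κ | κ i = q} : Finset (Fin s → Fin m)).biUnion fun κ => Z κ i,
    ?_, ?_, ?_⟩
  · intro q i q' i' hne
    rw [disjoint_left]
    intro v hv hv'
    obtain ⟨κ, hκ, hvκ⟩ := mem_biUnion.1 hv
    obtain ⟨κ', hκ', hvκ'⟩ := mem_biUnion.1 hv'
    have hκκ : κ = κ' := (hkey hvκ).symm.trans (hkey hvκ')
    subst hκκ
    by_cases hii : i = i'
    · subst hii
      exact hne ⟨(mem_filter.1 hκ).2.symm.trans (mem_filter.1 hκ').2, rfl⟩
    · exact disjoint_left.1 (hZd κ i (mem_univ _) i' (mem_univ _) hii) hvκ hvκ'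
  · intro q i v hv
    obtain ⟨κ, hκ, hvκ⟩ := mem_biUnion.1 hv
    refine mem_filter.2 ⟨mem_univ _, ?_⟩
    rw [← (mem_filter.1 hκ).2, ← hkey hvκ]
  · intro q i
    rw [card_biUnion (fun κ _ κ' _ hne => disjoint_left.2
      fun v hv hv' => hne ((hkey hv).symm.trans (hkey hv')))]
    have hfib : ∑ v with c (v, i) = q, f v i =
        ∑ κ : Fin s → Fin m with κ i = q, ∑ v ∈ S κ, f v i := by
      rw [← sum_fiberwise_of_maps_to (s := ({v | c (v, i) = q} : Finset V))
        (t := ({κ | κ i = q} : Finset (Fin s → Fin m))) (g := key)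
        (fun v hv => mem_filter.2 ⟨mem_univ _, (mem_filter.1 hv).2⟩)]
      refine sum_congr rfl fun κ hκ => sum_congr ?_ fun _ _ => rfl
      ext v
      simp only [mem_filter, mem_univ, true_and, S]
      constructor
      · exact fun h => h.2
      · intro h
        refine ⟨?_, h⟩
        rw [← (mem_filter.1 hκ).2, ← h]
    have hcard : (#({κ | κ i = q} : Finset (Fin s → Fin m)) : ℝ) ≤ (m : ℝ) ^ s := by
      have : #({κ | κ i = q} : Finset (Fin s → Fin m)) ≤ m ^ s := by
        simpa using card_le_univ ({κ | κ i = q} : Finset (Fin s → Fin m))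
      exact_mod_cast this
    rw [hfib]
    push_cast
    have hle : ∑ κ : Fin s → Fin m with κ i = q, (∑ v ∈ S κ, f v i - 1) ≤
        ∑ κ : Fin s → Fin m with κ i = q, (#(Z κ i) : ℝ) := by
      refine sum_le_sum fun κ _ => ?_
      rw [(hZ κ i (mem_univ _)).2]
      exact (Nat.sub_one_lt_floor _).le
    rw [sum_sub_distrib, sum_const, nsmul_eq_mul, mul_one] at hle
    linarith

/-- Discarding the patterns that use a light position loses little weight. -/
theorem sum_light_patterns_le {s m : ℕ} {W : (Fin s → Fin m) → ℝ} (hW : ∀ B, 0 ≤ W B)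
    {τ : ℝ} (hτ : 0 ≤ τ) {S : Finset (Fin s → Fin m)}
    (hS : ∀ B ∈ S, 0 < W B → ∃ i, ∑ B' with B' i = B i, W B' < τ) :
    ∑ B ∈ S, W B ≤ s * m * τ := by
  classical
  obtain ⟨U, hU⟩ : ∃ U : Fin m → Fin s → ℝ, ∀ q i, U q i = ∑ B' with B' i = q, W B' :=
    ⟨_, fun _ _ => rfl⟩
  have hnn : ∀ B i, 0 ≤ if U (B i) i < τ then W B else 0 := fun B i => by
    split_ifs
    exacts [hW B, le_rfl]
  calc ∑ B ∈ S, W B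
      ≤ ∑ B ∈ S, ∑ i, if U (B i) i < τ then W B else 0 := by
        refine sum_le_sum fun B hB => ?_
        rcases (hW B).eq_or_lt with h0 | h0
        · rw [← h0]
          simp
        · obtain ⟨i, hi⟩ := hS B hB h0
          rw [← hU] at hi
          calc W B = if U (B i) i < τ then W B else 0 := (if_pos hi).symm
            _ ≤ _ := single_le_sum (f := fun i => if U (B i) i < τ then W B else 0)
                (fun i _ => hnn B i) (mem_univ i)
    _ ≤ ∑ B, ∑ i, if U (B i) i < τ then W B else 0 :=
        sum_le_sum_of_subset_of_nonneg (subset_univ _) fun B _ _ => sum_nonneg fun i _ => hnn B i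
    _ = ∑ i, ∑ q, ∑ B with B i = q, if U (B i) i < τ then W B else 0 := by
        rw [sum_comm]
        refine sum_congr rfl fun i _ => ?_
        rw [sum_fiberwise univ (fun B : Fin s → Fin m => B i)
          (fun B => if U (B i) i < τ then W B else 0)]
    _ ≤ ∑ i : Fin s, ∑ q : Fin m, τ := by
        refine sum_le_sum fun i _ => sum_le_sum fun q _ => ?_
        have : ∑ B with B i = q, (if U (B i) i < τ then W B else 0) =
            ∑ B with B i = q, if U q i < τ then W B else 0 :=
          sum_congr rfl fun B hB => by rw [(mem_filter.1 hB).2]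
        rw [this]
        by_cases h : U q i < τ
        · simp only [if_pos h]
          rw [← hU]
          exact h.le
        · simpa [if_neg h] using hτ
    _ = _ := by simp; ring

theorem sum_fiberwise_filter {X K : Type*} [Fintype X] [Fintype K] [DecidableEq K]
    (w : X → ℝ) (g : X → K) (p : K → Prop) [DecidablePred p] :
    ∑ y with p y, ∑ x with g x = y, w x = ∑ x with p (g x), w x := by
  rw [← sum_fiberwise_of_maps_to (s := ({x | p (g x)} : Finset X))
    (t := ({y | p y} : Finset K)) (g := g)
    (fun x hx => mem_filter.2 ⟨mem_univ _, (mem_filter.1 hx).2⟩)]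
  refine sum_congr rfl fun y hy => sum_congr ?_ fun _ _ => rfl
  ext x
  simp only [mem_filter, mem_univ, true_and]
  refine ⟨fun h => ⟨?_, h⟩, fun h => h.2⟩
  rw [h]
  exact (mem_filter.1 hy).2

/-- Turning a weighting of tiles supported on good colour patterns into few long `k`-paths. -/
theorem exists_kPaths_of_weights {n k m : ℕ} {G : Fin n → Fin n → Prop}
    {c : Fin n × Fin (k + 2) → Fin m} {R : Fin m → Fin m → Prop} {a b d θ τ : ℝ}
    (ha : 0 < a) (hd : 0 < d) (hd1 : d ≤ 1) (hb : 0 < b) (hab : (k + 1) * a ≤ d ^ k * b)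
    (hθ : 0 ≤ θ) (hθ1 : θ ≤ 1) (hbτ : (m : ℝ) ^ (k + 2) + b ≤ θ * τ)
    (hLD : ∀ q q', R q q' → ∀ i j : Fin (k + 2), i ≠ j → (i : ℕ) ≠ j + 1 →
      LowerDense G a d {v | c (v, i) = q} {v | c (v, j) = q'})
    {w : (Fin (k + 2) → Fin n) → ℝ} (hw : ∀ x, 0 ≤ w x)
    (hR : ∀ x, 0 < w x → ∀ i j, i ≠ j → R (c (x i, i)) (c (x j, j)))
    (hw1 : ∀ v, ∑ i, ∑ x with x i = v, w x ≤ 1) :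
    ∃ Ps : List (List (Fin n)), Ps.length ≤ m ^ (k + 2) ∧ (∀ P ∈ Ps, IsKPath k G P) ∧
      List.Pairwise (fun P Q => ∀ v ∈ P, v ∉ Q) Ps ∧
      (k + 2) * ((1 - θ) * (∑ x, w x - (k + 2) * m * τ) - (m : ℝ) ^ (k + 2)) ≤
        ((Ps.map List.length).sum : ℝ) := by
  obtain ⟨β, hβ⟩ : ∃ β : (Fin (k + 2) → Fin n) → Fin (k + 2) → Fin m,
      ∀ x i, β x i = c (x i, i) := ⟨fun x i => c (x i, i), fun _ _ => rfl⟩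
  obtain ⟨W, hWdef⟩ : ∃ W : (Fin (k + 2) → Fin m) → ℝ, ∀ B, W B = ∑ x with β x = B, w x :=
    ⟨_, fun _ => rfl⟩
  obtain ⟨U, hUdef⟩ : ∃ U : Fin m → Fin (k + 2) → ℝ, ∀ q i, U q i = ∑ B with B i = q, W B :=
    ⟨_, fun _ _ => rfl⟩
  have hW : ∀ B, 0 ≤ W B := fun B => hWdef B ▸ sum_nonneg fun x _ => hw x
  have hWtot : ∑ B, W B = ∑ x, w x := by
    simp only [hWdef]
    rw [sum_fiberwise univ β w]
  obtain ⟨f, hf⟩ : ∃ f : Fin n → Fin (k + 2) → ℝ, ∀ v i, f v i = ∑ x with x i = v, w x :=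
    ⟨_, fun _ _ => rfl⟩
  obtain ⟨Y, hYd, hYsub, hYc⟩ := exists_role_classes c f
    (fun v i => hf v i ▸ sum_nonneg fun x _ => hw x) (by simpa only [hf] using hw1)
  have hU : ∀ q i, U q i = ∑ v with c (v, i) = q, f v i := by
    intro q i
    simp only [hUdef, hWdef, hf]
    rw [sum_fiberwise_filter w β (fun B => B i = q),
      sum_fiberwise_filter w (fun x => x i) (fun v => c (v, i) = q)]
    simp only [hβ]
  obtain ⟨ℬ, hℬ⟩ : ∃ ℬ : Finset (Fin (k + 2) → Fin m),
      ∀ B, B ∈ ℬ ↔ 0 < W B ∧ ∀ i, τ ≤ U (B i) i :=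
    ⟨univ.filter fun B => 0 < W B ∧ ∀ i, τ ≤ U (B i) i, fun B => by simp⟩
  obtain ⟨L, hLdef⟩ : ∃ L : (Fin (k + 2) → Fin m) → ℕ, ∀ B, L B = ⌊(1 - θ) * W B⌋₊ :=
    ⟨_, fun _ => rfl⟩
  have hL : ∀ B, (L B : ℝ) ≤ (1 - θ) * W B := fun B => hLdef B ▸
    Nat.floor_le (mul_nonneg (by linarith) (hW B))
  have hcardB : #ℬ ≤ m ^ (k + 2) := by simpa using card_le_univ ℬ
  obtain ⟨Ps, hlen, hpath, hpair, hsum, -⟩ := exists_kPaths_of_boxes (G := G) ha hd hd1 hb hab hYd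
    ℬ L (by
      intro B hB i
      have hτ := ((hℬ B).1 hB).2 i
      have h1 : ((∑ B' ∈ ℬ with B' i = B i, L B' : ℕ) : ℝ) ≤ (1 - θ) * U (B i) i := by
        push_cast
        calc ∑ B' ∈ ℬ with B' i = B i, (L B' : ℝ)
            ≤ ∑ B' ∈ ℬ with B' i = B i, (1 - θ) * W B' := sum_le_sum fun B' _ => hL B'
          _ ≤ ∑ B' with B' i = B i, (1 - θ) * W B' := by
              refine sum_le_sum_of_subset_of_nonneg
                (filter_subset_filter _ (subset_univ _)) fun B' _ _ =>
                mul_nonneg (by linarith) (hW B')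
          _ = _ := by rw [hUdef, mul_sum]
      have h2 := hYc (B i) i
      rw [← hU] at h2
      have h3 := mul_le_mul_of_nonneg_left hτ hθ
      linarith)
    (by
      intro B hB i j hij hij'
      have hpos : W B ≠ 0 := ((hℬ B).1 hB).1.ne'
      rw [hWdef] at hpos
      obtain ⟨x, hx, hx0⟩ := exists_ne_zero_of_sum_ne_zero hpos
      have hxB : β x = B := (mem_filter.1 hx).2
      have hr := hR x ((hw x).lt_of_ne hx0.symm) i j hij
      rw [← hβ, ← hβ, hxB] at hr
      exact (hLD _ _ hr i j hij hij').mono (hYsub _ _) (hYsub _ _))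
  refine ⟨Ps, hlen.trans_le hcardB, hpath, hpair, ?_⟩
  have hlost : ∑ B with B ∉ ℬ, W B ≤ (k + 2) * m * τ := by
    have hτ0 : 0 ≤ τ := by
      by_contra! h
      have h1 : (0 : ℝ) ≤ (m : ℝ) ^ (k + 2) := by positivity
      nlinarith
    have h2 := sum_light_patterns_le hW hτ0 (S := {B | B ∉ ℬ}) (by
      intro B hB h0
      by_contra! h
      simp only [← hUdef] at h
      exact (mem_filter.1 hB).2 ((hℬ B).2 ⟨h0, h⟩))
    push_cast at h2
    exact h2
  have hsplit : ∑ B ∈ ℬ, W B + ∑ B with B ∉ ℬ, W B = ∑ x, w x := by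
    rw [← hWtot, ← sum_filter_add_sum_filter_not univ (· ∈ ℬ)]
    simp
  have hLsum : (1 - θ) * ∑ B ∈ ℬ, W B - (m : ℝ) ^ (k + 2) ≤ ∑ B ∈ ℬ, (L B : ℝ) := by
    have h1 : ∑ B ∈ ℬ, ((1 - θ) * W B - 1) ≤ ∑ B ∈ ℬ, (L B : ℝ) :=
      sum_le_sum fun B _ => hLdef B ▸ (Nat.sub_one_lt_floor _).le
    rw [sum_sub_distrib, ← mul_sum, sum_const, nsmul_eq_mul, mul_one] at h1
    have h2 : (#ℬ : ℝ) ≤ (m : ℝ) ^ (k + 2) := by exact_mod_cast hcardB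
    linarith
  rw [hsum]
  push_cast
  refine mul_le_mul_of_nonneg_left ?_ (by positivity)
  have h4 : (1 - θ) * (∑ x, w x - (k + 2) * m * τ) ≤ (1 - θ) * ∑ B ∈ ℬ, W B :=
    mul_le_mul_of_nonneg_left (by linarith) (by linarith)
  linarith

theorem sum_defect_add_degrees {n : ℕ} (G : Fin n → Fin n → Prop) (v : Fin n) :
    ∑ w, defect G v w + (outDeg G v + inDeg G v) = 2 * n := by
  classical
  have h : ∀ p : Fin n → Prop, ∑ w, (if p w then 0 else 1) + {w | p w}.ncard = n := by
    intro p
    have h1 : {w | p w}.ncard = #{w | p w} := by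
      rw [← Set.ncard_coe_finset, coe_filter]
      simp
    have h2 : ∑ w, (if p w then 0 else 1) = #{w | ¬ p w} := by
      rw [card_filter]
      exact sum_congr rfl fun w _ => by split_ifs <;> simp_all
    rw [h1, h2, add_comm, card_filter_add_card_filter_not]
    simp
  have hd : ∑ w, defect G v w =
      ∑ w, (if G v w then 0 else 1) + ∑ w, (if G w v then 0 else 1) := by
    rw [← sum_add_distrib]
    refine sum_congr rfl fun w _ => ?_
    unfold defect
    split_ifs <;> rfl
  have h1 := h (fun w => G v w)
  have h2 := h (fun w => G w v)
  rw [hd]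
  unfold outDeg inDeg
  omega

/-- Few long paths from a spread-out, nearly perfect fractional tiling. -/
theorem exists_kPaths_of_spread_weights (k : ℕ) {η c : ℝ} (hη : 0 < η) (hc : 0 < c) :
    ∃ n₀ T : ℕ, ∀ n : ℕ, n₀ ≤ n → ∀ G : Fin n → Fin n → Prop,
      ∀ w : (Fin (k + 2) → Fin n) → ℝ, (∀ x, 0 ≤ w x) → (∀ x, 0 < w x → Tile G x) →
      (∀ x, w x * (n : ℝ) ^ (k + 2) ≤ c * n) → (∀ v, ∑ i, ∑ x with x i = v, w x ≤ 1) →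
      ∃ Ps : List (List (Fin n)), Ps.length ≤ T ∧ (∀ P ∈ Ps, IsKPath k G P) ∧
        List.Pairwise (fun P Q => ∀ v ∈ P, v ∉ Q) Ps ∧
        (k + 2) * ∑ x, w x - η * n ≤ ((Ps.map List.length).sum : ℝ) := by
  classical
  obtain ⟨s, hs⟩ : ∃ s : ℝ, s = k + 2 := ⟨_, rfl⟩
  have hs0 : 0 < s := by rw [hs]; positivity
  obtain ⟨θ, hθ, hθ1, hθη⟩ : ∃ θ : ℝ, 0 < θ ∧ θ ≤ 1 ∧ θ ≤ η / 4 :=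
    ⟨min 1 (η / 4), by positivity, min_le_left _ _, min_le_right _ _⟩
  obtain ⟨d, hd, hd1, hdη⟩ : ∃ d : ℝ, 0 < d ∧ d ≤ 1 ∧ s * (c * (9 * d * s ^ 2)) ≤ η / 4 := by
    refine ⟨min 1 (η / 4 / (s * (c * (9 * s ^ 2)))), by positivity, min_le_left _ _, ?_⟩
    have h := min_le_right 1 (η / 4 / (s * (c * (9 * s ^ 2))))
    rw [le_div_iff₀ (by positivity)] at h
    linarith
  obtain ⟨γ, hγ, hγη⟩ : ∃ γ : ℝ, 0 < γ ∧ s * (s * γ) ≤ η / 4 :=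
    ⟨η / 4 / (s * s), by positivity, le_of_eq (by field_simp)⟩
  obtain ⟨e, he, hed, heγ⟩ : ∃ e : ℝ, 0 < e ∧ e ≤ d / 2 ∧
      (k + 1) * (2 * s * e) ≤ (d / 2) ^ k * (θ * γ / 2) := by
    refine ⟨min (d / 2) ((d / 2) ^ k * (θ * γ / 2) / ((k + 1) * (2 * s))), by positivity,
      min_le_left _ _, ?_⟩
    have h := min_le_right (d / 2) ((d / 2) ^ k * (θ * γ / 2) / ((k + 1) * (2 * s)))
    rw [le_div_iff₀ (by positivity)] at h
    linarith
  obtain ⟨M, N, hN, hcol⟩ := exists_lowerDense_coloring (s := k + 2) (by omega) he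
    (by linarith : e < d)
  obtain ⟨n₁, hn₁⟩ := exists_nat_ge ((M : ℝ) ^ (k + 3) / (θ * γ / 2))
  obtain ⟨n₂, hn₂⟩ := exists_nat_ge (s * (M : ℝ) ^ (k + 2) / (η / 4))
  refine ⟨max N (max n₁ n₂), M ^ (k + 2), ?_⟩
  intro n hn G w hw hT hspread hw1
  have hnN : N ≤ n := (le_max_left _ _).trans hn
  have hn1 : (M : ℝ) ^ (k + 3) ≤ θ * γ / 2 * n := by
    rw [div_le_iff₀ (by positivity)] at hn₁
    have : (n₁ : ℝ) ≤ n := by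
      exact_mod_cast (le_max_left _ _).trans ((le_max_right _ _).trans hn)
    nlinarith [mul_pos hθ hγ]
  have hn2 : s * (M : ℝ) ^ (k + 2) ≤ η / 4 * n := by
    rw [div_le_iff₀ (by positivity)] at hn₂
    have : (n₂ : ℝ) ≤ n := by
      exact_mod_cast (le_max_right _ _).trans ((le_max_right _ _).trans hn)
    nlinarith
  have hn0 : 0 < n := hN.trans_le hnN
  have hnR : (0 : ℝ) < n := by exact_mod_cast hn0
  obtain ⟨m, col, R, hm, hmM, hLD, hbad⟩ := hcol n hnN G
  have hmR : (0 : ℝ) < m := by exact_mod_cast hm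
  have hmMR : (m : ℝ) ≤ M := by exact_mod_cast hmM
  obtain ⟨good, hgood⟩ : ∃ good : (Fin (k + 2) → Fin n) → Prop,
      ∀ x, good x ↔ ∀ i j, i ≠ j → R (col (x i, i)) (col (x j, j)) := ⟨_, fun _ => Iff.rfl⟩
  obtain ⟨w', hw'def⟩ : ∃ w' : (Fin (k + 2) → Fin n) → ℝ, ∀ x, w' x = if good x then w x else 0 :=
    ⟨_, fun _ => rfl⟩
  have hw' : ∀ x, 0 ≤ w' x := fun x => by
    rw [hw'def]
    split_ifs
    exacts [hw x, le_rfl]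
  have hw'w : ∀ x, w' x ≤ w x := fun x => by
    rw [hw'def]
    split_ifs
    exacts [le_rfl, hw x]
  have hw'good : ∀ x, 0 < w' x → good x := fun x h => by
    by_contra hx
    rw [hw'def, if_neg hx] at h
    exact lt_irrefl _ h
  have hlost : ∑ x with ¬ good x, w x ≤ c * (9 * d * s ^ 2) * n := by
    refine sum_weight_bad_le hn0 hw hT hc.le hspread (K := fun p q => R (col p) (col q)) ?_ _ ?_
    · refine hbad.trans (le_of_eq ?_)
      rw [hs]
      push_cast
      ring
    · intro x hx
      have := (mem_filter.1 hx).2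
      rw [hgood] at this
      push Not at this
      obtain ⟨i, j, hij, h⟩ := this
      exact ⟨i, j, hij, h⟩
  have hsplit : ∑ x, w x = ∑ x, w' x + ∑ x with ¬ good x, w x := by
    rw [← sum_filter_add_sum_filter_not univ good w, sum_filter]
    simp only [hw'def]
  have htotal : s * ∑ x, w' x ≤ n := by
    calc s * ∑ x, w' x ≤ s * ∑ x, w x := by gcongr with x; exact hw'w x
      _ = ∑ i : Fin (k + 2), ∑ v, ∑ x with x i = v, w x := by
          have : ∀ i : Fin (k + 2), ∑ v, ∑ x with x i = v, w x = ∑ x, w x := fun i => by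
            rw [sum_fiberwise univ (fun x : Fin (k + 2) → Fin n => x i) w]
          simp [this, hs]
      _ = ∑ v, ∑ i : Fin (k + 2), ∑ x with x i = v, w x := by rw [sum_comm]
      _ ≤ ∑ v : Fin n, 1 := sum_le_sum fun v _ => hw1 v
      _ = n := by simp
  obtain ⟨Ps, hlen, hpath, hpair, hsum⟩ := exists_kPaths_of_weights (G := G) (c := col) (R := R)
    (a := 2 * s * n * e / m) (b := θ * γ / 2 * n / m) (d := d / 2) (θ := θ) (τ := γ * n / m)
    (w := w') (by positivity) (by positivity) (by linarith) (by positivity)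
    (by
      calc (k + 1) * (2 * s * n * e / m) = (k + 1) * (2 * s * e) * (n / m) := by ring
        _ ≤ (d / 2) ^ k * (θ * γ / 2) * (n / m) := by gcongr
        _ = _ := by ring)
    hθ.le hθ1
    (by
      have h1 : (m : ℝ) ^ (k + 2) ≤ θ * γ / 2 * n / m := by
        rw [le_div_iff₀ hmR, ← pow_succ]
        exact (by gcongr : (m : ℝ) ^ (k + 3) ≤ (M : ℝ) ^ (k + 3)).trans hn1
      have h2 : θ * (γ * n / m) = θ * γ / 2 * n / m + θ * γ / 2 * n / m := by ring
      rw [h2]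
      linarith)
    (by
      intro q q' hq i j hij hij' A hA B hB hAc hBc
      rw [hs] at hAc hBc
      obtain ⟨x, hx, N', hN', hcard, hG⟩ := hLD q q' hq i j hij hij' A hA B hB
        (by push_cast; exact hAc) (by push_cast; exact hBc)
      refine ⟨x, hx, N', hN', le_trans ?_ hcard, hG⟩
      gcongr
      linarith)
    hw' (fun x hx => (hgood x).1 (hw'good x hx))
    (fun v => le_trans (by gcongr with i _ x; exact hw'w x) (hw1 v))
  refine ⟨Ps, hlen.trans (Nat.pow_le_pow_left hmM _), hpath, hpair, le_trans ?_ hsum⟩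
  rw [← hs]
  have hmm : s * m * (γ * n / m) = s * γ * n := by field_simp
  rw [hmm]
  have h1 : s * (m : ℝ) ^ (k + 2) ≤ η / 4 * n :=
    (by gcongr : s * (m : ℝ) ^ (k + 2) ≤ s * (M : ℝ) ^ (k + 2)).trans hn2
  have h2 : s * (c * (9 * d * s ^ 2)) * n ≤ η / 4 * n := by gcongr
  have h3 : s * (s * γ) * n ≤ η / 4 * n := by gcongr
  have h4 : θ * (s * ∑ x, w' x) ≤ η / 4 * n :=
    mul_le_mul hθη htotal (mul_nonneg hs0.le (sum_nonneg fun x _ => hw' x)) (by positivity)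
  have h5 : 0 ≤ θ * (s * (s * γ) * n) := by positivity
  have h6 := mul_le_mul_of_nonneg_left hlost hs0.le
  rw [hsplit]
  linarith

end

/-- Almost covering lemma for digraphs: for every `k ≥ 2` and `η > 0` there are `n₀, T`
such that every digraph on `n ≥ n₀` vertices with minimum total degree at least
`2(1 - 1/(k+2) + η)n` contains at most `T` pairwise vertex-disjoint `k`-paths covering
all but at most `ηn` vertices. -/
theorem statement_6 (k : ℕ) (hk : 2 ≤ k) (η : ℝ) (hη : 0 < η) :
    ∃ n₀ T : ℕ, ∀ n : ℕ, n₀ ≤ n → ∀ G : Fin n → Fin n → Prop, IsDigraph G →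
      (∀ v, 2 * (1 - 1/((k:ℝ)+2) + η) * n ≤ ((outDeg G v + inDeg G v : ℕ) : ℝ)) →
      ∃ Ps : List (List (Fin n)),
        Ps.length ≤ T ∧
        (∀ P ∈ Ps, IsKPath k G P) ∧
        List.Pairwise (fun P Q => ∀ v ∈ P, v ∉ Q) Ps ∧
        (n : ℝ) - (((Ps.map List.length).sum : ℕ) : ℝ) ≤ η * n := by
  obtain ⟨c, hc, hspread⟩ := exists_spread_weights (k + 2) (by omega) (η / 2) (by positivity)
  obtain ⟨n₀, T, hpaths⟩ := exists_kPaths_of_spread_weights k (half_pos hη) hc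
  refine ⟨max 1 n₀, T, fun n hn G hG hdeg => ?_⟩
  have hn0 : 0 < n := (le_max_left _ _).trans hn
  obtain ⟨w, hw, hT, hsp, hw1, htot⟩ := hspread n hn0 G hG (by
    intro v
    have h1 : (∑ w, (defect G v w : ℝ)) + ((outDeg G v + inDeg G v : ℕ) : ℝ) = 2 * n := by
      exact_mod_cast sum_defect_add_degrees G v
    have h2 := hdeg v
    have h3 : 0 ≤ η * n := by positivity
    push_cast at h1 h2 ⊢
    have h4 : 2 / ((k : ℝ) + 2) = 2 * (1 / ((k : ℝ) + 2)) := by ring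
    rw [h4]
    linarith)
  obtain ⟨Ps, hlen, hpath, hpair, hsum⟩ :=
    hpaths n ((le_max_right _ _).trans hn) G w hw hT hsp hw1
  refine ⟨Ps, hlen, hpath, hpair, ?_⟩
  push_cast at htot hsum ⊢
  linarith

end Paper
end

section
/- For every k ∈ ℕ and every η > 0, there exist n₀ ∈ ℕ and ξ > 0 such that for every n ≥ n₀ the following holds: if G is an n-vertex digraph with minimum total degree δ(G) ≥ 2(1 − 1/(k+3) + η)n, then for every vertex v ∈ V(G) there are at least ξ·n^{2(k+2)} absorbers for v in G. -/
namespace Paper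

/-- `u` and `v` are not joined by edges in both directions. -/
def Miss {V : Type*} (G : V → V → Prop) (u v : V) : Prop := ¬ (G u v ∧ G v u)

/-- The entries of `x` lie in `W`, any two are adjacent, and the pairs that are not joined in
both directions form a matching. -/
structure IsMatchTuple {V ι : Type*} (G : V → V → Prop) (W : Set V) (x : ι → V) : Prop where
  mem : ∀ i, x i ∈ W
  adj : ∀ i j, i ≠ j → G (x i) (x j) ∨ G (x j) (x i)
  uniq : ∀ i j l, i ≠ j → i ≠ l → Miss G (x i) (x j) → Miss G (x i) (x l) → j = l

/-- `y` is adjacent to every entry of `x`, and to all but at most one in both directions. -/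
def Near {V ι : Type*} (G : V → V → Prop) (x : ι → V) (y : V) : Prop :=
  (∀ i, G (x i) y ∨ G y (x i)) ∧ ∀ i j, Miss G (x i) y → Miss G (x j) y → i = j

open Classical in
/-- The ordered pairs of indices whose entries are not joined in both directions. -/
noncomputable def singlePairs {V ι : Type*} [Fintype ι] (G : V → V → Prop) (x : ι → V) :
    Finset (ι × ι) :=
  Finset.univ.filter fun p => p.1 ≠ p.2 ∧ Miss G (x p.1) (x p.2)

lemma Miss.symm {V : Type*} {G : V → V → Prop} {u v : V} (h : Miss G u v) : Miss G v u :=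
  fun h' => h ⟨h'.2, h'.1⟩

/-- A near vertex either extends a match tuple or can replace one of its entries so that fewer
single pairs remain. -/
lemma IsMatchTuple.cons_or_update {V : Type*} {G : V → V → Prop} {W : Set V} {j : ℕ}
    {x : Fin j → V} (hx : IsMatchTuple G W x) {y : V} (hy : y ∈ W) (hxy : Near G x y) :
    IsMatchTuple G W (Fin.cons y x : Fin (j + 1) → V) ∨
      ∃ i, IsMatchTuple G W (Function.update x i y) ∧
        (singlePairs G (Function.update x i y)).card < (singlePairs G x).card := by
  classical
  by_cases h : ∃ i l, i ≠ l ∧ Miss G (x i) y ∧ Miss G (x i) (x l)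
  · obtain ⟨i, l, hil, hiy, hl⟩ := h
    right
    have hd : ∀ a, a ≠ i → ¬ Miss G (x a) y := fun a ha hm => ha (hxy.2 a i hm hiy)
    have hd' : ∀ a, a ≠ i → ¬ Miss G y (x a) := fun a ha hm => hd a ha hm.symm
    refine ⟨i, ⟨fun a => ?_, fun a b hab => ?_, fun a b d hab had => ?_⟩, ?_⟩
    · by_cases ha : a = i
      · subst ha; simpa using hy
      · simpa [ha] using hx.mem a
    · by_cases ha : a = i
      · subst ha
        simpa [hab.symm] using (hxy.1 b).symm
      · by_cases hb : b = i
        · subst hb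
          simpa [ha] using hxy.1 a
        · simpa [ha, hb] using hx.adj a b hab
    · by_cases ha : a = i
      · subst ha
        simp only [Function.update_self, Function.update_of_ne hab.symm]
        exact fun h => absurd h (hd' b hab.symm)
      · simp only [Function.update_of_ne ha]
        by_cases hb : b = i
        · subst hb
          simp only [Function.update_self]
          exact fun h => absurd h (hd a ha)
        · by_cases hc : d = i
          · subst hc
            simp only [Function.update_self]
            exact fun _ h => absurd h (hd a ha)
          · simp only [Function.update_of_ne hb, Function.update_of_ne hc]
            exact hx.uniq a b d hab had
    · apply Finset.card_lt_card
      rw [Finset.ssubset_iff_of_subset]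
      · exact ⟨(i, l), by simp [singlePairs, hil, hl],
          by simpa [singlePairs, hil, hil.symm] using hd' l hil.symm⟩
      · rintro ⟨a, b⟩ hab
        simp only [singlePairs, Finset.mem_filter, Finset.mem_univ, true_and] at hab ⊢
        refine ⟨hab.1, ?_⟩
        by_cases ha : a = i
        · subst ha
          have := hab.2
          simp only [Function.update_self, Function.update_of_ne hab.1.symm] at this
          exact absurd this (hd' b hab.1.symm)
        · by_cases hb : b = i
          · subst hb
            have := hab.2
            simp only [Function.update_self, Function.update_of_ne ha] at this
            exact absurd this (hd a ha)
          · simpa [ha, hb] using hab.2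
  · push Not at h
    left
    refine ⟨fun a => ?_, fun a b => ?_, fun a b d => ?_⟩
    · cases a using Fin.cases with
      | zero => simpa using hy
      | succ a => simpa using hx.mem a
    · cases a using Fin.cases with
      | zero =>
        cases b using Fin.cases with
        | zero => simp
        | succ b => simpa using fun _ => (hxy.1 b).symm
      | succ a =>
        cases b using Fin.cases with
        | zero => simpa using hxy.1 a
        | succ b => simpa using hx.adj a b
    · cases a using Fin.cases with
      | zero =>
        cases b using Fin.cases with
        | zero => simp
        | succ b =>
          cases d using Fin.cases with
          | zero => simp
          | succ d =>
            simpa using fun _ _ h1 h2 => hxy.2 b d (Miss.symm h1) (Miss.symm h2)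
      | succ a =>
        cases b using Fin.cases with
        | zero =>
          cases d using Fin.cases with
          | zero => simp
          | succ d =>
            simpa using fun had h1 h2 => absurd h2 (h a d had h1)
        | succ b =>
          cases d using Fin.cases with
          | zero => simpa using fun hab h1 h2 => absurd h1 (h a b hab h2)
          | succ d => simpa using hx.uniq a b d

open Classical in
lemma card_filter_update_le {n j : ℕ} (B : Finset (Fin j → Fin n)) (i : Fin j) :
    (Finset.univ.filter fun q : (Fin j → Fin n) × Fin n =>
      Function.update q.1 i q.2 ∈ B).card ≤ B.card * n := by
  have := Finset.card_le_card_of_injOn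
    (s := Finset.univ.filter fun q : (Fin j → Fin n) × Fin n => Function.update q.1 i q.2 ∈ B)
    (t := B ×ˢ (Finset.univ : Finset (Fin n)))
    (fun q => (Function.update q.1 i q.2, q.1 i))
    (fun q hq => by simpa using hq)
    (by
      rintro ⟨x, y⟩ - ⟨x', y'⟩ - h
      simp only [Prod.mk.injEq] at h
      obtain ⟨h1, h2⟩ := h
      have hy : y = y' := by simpa using congrFun h1 i
      have hx : x = x' := by
        funext a
        by_cases ha : a = i
        · rw [ha, h2]
        · simpa [ha] using congrFun h1 a
      rw [hx, hy])
  simpa using this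

open Classical in
lemma exists_density_succ (j : ℕ) (ε : ℝ) (hε : 0 < ε) (m : ℕ) : ∀ c : ℝ, 0 < c →
    ∃ c' : ℝ, 0 < c' ∧ ∀ (n : ℕ) (G : Fin n → Fin n → Prop) (W : Set (Fin n)),
      (∀ x : Fin j → Fin n,
        ε * n ≤ ((Finset.univ.filter fun y => y ∈ W ∧ Near G x y).card : ℝ)) →
      c * (n : ℝ) ^ j ≤ ((Finset.univ.filter fun x : Fin j → Fin n =>
        IsMatchTuple G W x ∧ (singlePairs G x).card < m).card : ℝ) →
      c' * (n : ℝ) ^ (j + 1) ≤ ((Finset.univ.filter fun x : Fin (j + 1) → Fin n =>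
        IsMatchTuple G W x).card : ℝ) := by
  induction m with
  | zero =>
    intro c hc
    refine ⟨1, one_pos, fun n G W _ h => ?_⟩
    simp only [not_lt_zero, and_false, Finset.filter_false, Finset.card_empty,
      Nat.cast_zero] at h
    have hn : (n : ℝ) ^ j ≤ 0 := by
      by_contra hn
      push Not at hn
      have := mul_pos hc hn
      linarith
    have hn' : (n : ℝ) ^ j = 0 := le_antisymm hn (by positivity)
    rw [pow_succ, hn']
    simp
  | succ m ih =>
    intro c hc
    obtain ⟨c₁, hc₁, ih⟩ := ih (c * ε / (2 * (j + 1))) (by positivity)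
    refine ⟨min c₁ (c * ε / 2), lt_min hc₁ (by positivity), fun n G W hW h => ?_⟩
    set A := Finset.univ.filter fun x : Fin j → Fin n =>
        IsMatchTuple G W x ∧ (singlePairs G x).card < m + 1 with hA
    set B := Finset.univ.filter fun x : Fin j → Fin n =>
        IsMatchTuple G W x ∧ (singlePairs G x).card < m with hB
    set C := Finset.univ.filter fun x : Fin (j + 1) → Fin n => IsMatchTuple G W x with hC
    have hpos : (0 : ℝ) ≤ (n : ℝ) ^ (j + 1) := by positivity
    by_cases hBc : c * ε / (2 * (j + 1)) * (n : ℝ) ^ j ≤ (B.card : ℝ)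
    · refine le_trans ?_ (ih n G W hW hBc)
      exact mul_le_mul_of_nonneg_right (min_le_left _ _) hpos
    · push Not at hBc
      refine le_trans (mul_le_mul_of_nonneg_right (min_le_right _ _) hpos) ?_
      let S : Finset ((Fin j → Fin n) × Fin n) :=
        Finset.univ.filter fun q => q.1 ∈ A ∧ q.2 ∈ W ∧ Near G q.1 q.2
      have hS : S.card = ∑ x ∈ A, (Finset.univ.filter fun y => y ∈ W ∧ Near G x y).card := by
        rw [← Finset.card_sigma]
        refine Finset.card_bij (fun q _ => ⟨q.1, q.2⟩) ?_ ?_ ?_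
        · intro q hq
          simpa [S] using hq
        · rintro ⟨a, b⟩ - ⟨a', b'⟩ - h
          simpa using h
        · rintro ⟨a, b⟩ hab
          exact ⟨(a, b), by simpa [S] using hab, rfl⟩
      have hS1 : c * ε * (n : ℝ) ^ (j + 1) ≤ S.card := by
        have : (A.card : ℝ) * (ε * n) ≤ S.card := by
          rw [hS]
          push_cast
          rw [← nsmul_eq_mul]
          exact Finset.card_nsmul_le_sum _ _ _ fun x _ => hW x
        calc c * ε * (n : ℝ) ^ (j + 1) = c * (n : ℝ) ^ j * (ε * n) := by ring
          _ ≤ A.card * (ε * n) := by gcongr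
          _ ≤ _ := this
      have hS2 : S ⊆ (Finset.univ.filter fun q : (Fin j → Fin n) × Fin n =>
            (Fin.cons q.2 q.1 : Fin (j + 1) → Fin n) ∈ C) ∪
          Finset.univ.biUnion fun i : Fin j =>
            Finset.univ.filter fun q : (Fin j → Fin n) × Fin n =>
              Function.update q.1 i q.2 ∈ B := by
        rintro ⟨x, y⟩ hq
        simp only [S, hA, Finset.mem_filter, Finset.mem_univ, true_and] at hq
        obtain ⟨⟨hx, hm⟩, hy, hxy⟩ := hq
        rcases hx.cons_or_update hy hxy with h1 | ⟨i, h1, h2⟩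
        · simp [hC, h1]
        · refine Finset.mem_union_right _ ?_
          simp only [Finset.mem_biUnion, Finset.mem_filter, Finset.mem_univ, true_and, hB]
          exact ⟨i, h1, by omega⟩
      have hC1 : (Finset.univ.filter fun q : (Fin j → Fin n) × Fin n =>
            (Fin.cons q.2 q.1 : Fin (j + 1) → Fin n) ∈ C).card ≤ C.card := by
        refine Finset.card_le_card_of_injOn
          (fun q => (Fin.cons q.2 q.1 : Fin (j + 1) → Fin n)) ?_ ?_
        · intro q hq
          simpa using hq
        · rintro ⟨x, y⟩ - ⟨x', y'⟩ - h
          obtain ⟨h1, h2⟩ := Fin.cons_injective2 h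
          exact Prod.ext h2 h1
      have hB1 : (Finset.univ.biUnion fun i : Fin j =>
            Finset.univ.filter fun q : (Fin j → Fin n) × Fin n =>
              Function.update q.1 i q.2 ∈ B).card ≤ j * (B.card * n) := by
        refine Finset.card_biUnion_le.trans ?_
        refine (Finset.sum_le_card_nsmul _ _ (B.card * n) fun i _ => ?_).trans (by simp)
        exact card_filter_update_le B i
      have hcard : (S.card : ℝ) ≤ C.card + j * (B.card * n) := by
        exact_mod_cast (Finset.card_le_card hS2).trans
          ((Finset.card_union_le _ _).trans (add_le_add hC1 hB1))
      have hBn : (j : ℝ) * (B.card * n) ≤ c * ε / 2 * (n : ℝ) ^ (j + 1) := by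
        calc (j : ℝ) * (B.card * n)
            ≤ (j + 1) * ((c * ε / (2 * (j + 1)) * (n : ℝ) ^ j) * n) := by
              gcongr
              linarith
          _ = _ := by field_simp; ring
      linarith

open Classical in
/-- Positive density of match tuples, given that every shorter tuple has many near vertices. -/
lemma exists_density_matchTuple (ε : ℝ) (hε : 0 < ε) (j : ℕ) :
    ∃ c : ℝ, 0 < c ∧ ∀ (n : ℕ) (G : Fin n → Fin n → Prop) (W : Set (Fin n)),
      (∀ i < j, ∀ x : Fin i → Fin n,
        ε * n ≤ ((Finset.univ.filter fun y => y ∈ W ∧ Near G x y).card : ℝ)) →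
      c * (n : ℝ) ^ j ≤ ((Finset.univ.filter fun x : Fin j → Fin n =>
        IsMatchTuple G W x).card : ℝ) := by
  induction j with
  | zero =>
    refine ⟨1, one_pos, fun n G W _ => ?_⟩
    have : ∀ x : Fin 0 → Fin n, IsMatchTuple G W x := fun x =>
      ⟨fun i => i.elim0, fun i => i.elim0, fun i => i.elim0⟩
    simp [this]
  | succ j ih =>
    obtain ⟨c, hc, ih⟩ := ih
    obtain ⟨c', hc', h⟩ := exists_density_succ j ε hε (j * j + 1) c hc
    refine ⟨c', hc', fun n G W hW => h n G W (hW j (Nat.lt_succ_self j)) ?_⟩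
    refine (ih n G W fun i hi => hW i (by omega)).trans ?_
    have : ∀ x : Fin j → Fin n, (singlePairs G x).card < j * j + 1 := fun x => by
      have := Finset.card_le_univ (singlePairs G x)
      simp at this
      omega
    simp [this]

open Classical in
/-- The pairs of tuples all of whose `2 ^ r` mixtures lie in `A`. -/
noncomputable def boxPairs {n r : ℕ} (A : Finset (Fin r → Fin n)) :
    Finset ((Fin r → Fin n) × (Fin r → Fin n)) :=
  Finset.univ.filter fun q => ∀ s : Fin r → Bool, (fun i => if s i then q.1 i else q.2 i) ∈ A

open Classical in
lemma sum_card_boxPairs_le {n r : ℕ} (A : Finset (Fin (r + 1) → Fin n)) :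
    ∑ u : Fin n × Fin n, (boxPairs (Finset.univ.filter fun x : Fin r → Fin n =>
      (Fin.cons u.1 x : Fin (r + 1) → Fin n) ∈ A ∧
      (Fin.cons u.2 x : Fin (r + 1) → Fin n) ∈ A)).card ≤ (boxPairs A).card := by
  rw [← Finset.card_sigma]
  refine Finset.card_le_card_of_injOn
    (fun p => ((Fin.cons p.1.1 p.2.1 : Fin (r + 1) → Fin n), Fin.cons p.1.2 p.2.2)) ?_ ?_
  · rintro ⟨⟨u, u'⟩, ⟨a, b⟩⟩ h
    simp only [boxPairs, Finset.coe_sigma, Set.mem_sigma_iff, Finset.coe_filter,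
      Finset.mem_filter, Finset.mem_univ, true_and, Set.mem_ofPred_eq, Finset.coe_univ,
      Set.mem_univ] at h ⊢
    intro s
    have h' := h (fun i => s i.succ)
    have key : (fun i => if s i = true then (Fin.cons u a : Fin (r + 1) → Fin n) i
        else (Fin.cons u' b : Fin (r + 1) → Fin n) i) =
        Fin.cons (if s 0 then u else u') (fun i => if s i.succ then a i else b i) := by
      funext i
      cases i using Fin.cases <;> simp
    rw [key]
    split_ifs
    · exact h'.1
    · exact h'.2
  · rintro ⟨⟨u, u'⟩, ⟨a, b⟩⟩ - ⟨⟨v, v'⟩, ⟨c, d⟩⟩ - h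
    simp only [Prod.mk.injEq] at h
    obtain ⟨h1, h2⟩ := Fin.cons_injective2 h.1
    obtain ⟨h3, h4⟩ := Fin.cons_injective2 h.2
    subst h1 h2 h3 h4
    rfl

open Classical in
lemma sq_card_le_sum_card {n r : ℕ} (A : Finset (Fin (r + 1) → Fin n)) :
    A.card ^ 2 ≤ n ^ r * ∑ u : Fin n × Fin n, (Finset.univ.filter fun x : Fin r → Fin n =>
      (Fin.cons u.1 x : Fin (r + 1) → Fin n) ∈ A ∧
      (Fin.cons u.2 x : Fin (r + 1) → Fin n) ∈ A).card := by
  have h1 : A.card = ∑ x : Fin r → Fin n,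
      ∑ u : Fin n, if (Fin.cons u x : Fin (r + 1) → Fin n) ∈ A then 1 else 0 := by
    rw [Finset.sum_comm, ← Fintype.sum_prod_type']
    refine Eq.trans ?_ (Equiv.sum_comp (Fin.consEquiv fun _ : Fin (r + 1) => Fin n)
      (fun x => if x ∈ A then 1 else 0)).symm
    simp
  have h2 : ∑ u : Fin n × Fin n, (Finset.univ.filter fun x : Fin r → Fin n =>
      (Fin.cons u.1 x : Fin (r + 1) → Fin n) ∈ A ∧
      (Fin.cons u.2 x : Fin (r + 1) → Fin n) ∈ A).card = ∑ x : Fin r → Fin n,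
      (∑ u : Fin n, if (Fin.cons u x : Fin (r + 1) → Fin n) ∈ A then 1 else 0) ^ 2 := by
    simp only [Finset.card_filter, sq, Finset.sum_mul_sum]
    rw [Finset.sum_comm]
    refine Finset.sum_congr rfl fun x _ => ?_
    rw [Fintype.sum_prod_type, Finset.sum_comm]
    simp [ite_and]
  rw [h2, h1]
  refine sq_sum_le_card_mul_sum_sq.trans ?_
  simp

/-- A dense set of tuples contains many boxes. -/
lemma pow_mul_le_card_boxPairs {n : ℕ} (hn : 0 < n) (r : ℕ) : ∀ (c : ℝ), 0 ≤ c →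
    ∀ A : Finset (Fin r → Fin n), c * (n : ℝ) ^ r ≤ A.card →
      c ^ (2 ^ r) * (n : ℝ) ^ (2 * r) ≤ (boxPairs A).card := by
  classical
  have hn' : (0 : ℝ) < n := by exact_mod_cast hn
  induction r with
  | zero =>
    intro c hc A hA
    have : A.card ≤ (boxPairs A).card := by
      refine Finset.card_le_card_of_injOn (fun x => (x, x)) ?_ ?_
      · intro x hx
        simpa [boxPairs] using hx
      · intro x _ y _ h
        exact (Prod.mk.inj h).1
    simp only [pow_zero, mul_one, pow_one, mul_zero] at hA ⊢
    exact hA.trans (by exact_mod_cast this)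
  | succ r ih =>
    intro c hc A hA
    let B : Fin n × Fin n → Finset (Fin r → Fin n) := fun u =>
      Finset.univ.filter fun x : Fin r → Fin n =>
        (Fin.cons u.1 x : Fin (r + 1) → Fin n) ∈ A ∧
        (Fin.cons u.2 x : Fin (r + 1) → Fin n) ∈ A
    let f : Fin n × Fin n → ℝ := fun u => (B u).card / (n : ℝ) ^ r
    have hf : ∀ u, 0 ≤ f u := fun u => by positivity
    have h1 : ∑ u, f u ^ (2 ^ r) * (n : ℝ) ^ (2 * r) ≤ (boxPairs A).card := by
      refine le_trans (Finset.sum_le_sum fun u _ => ih (f u) (hf u) (B u) ?_)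
        (by exact_mod_cast sum_card_boxPairs_le A)
      simp only [f]
      rw [div_mul_cancel₀ _ (by positivity)]
    have h2 : c ^ 2 * (n : ℝ) ^ 2 ≤ ∑ u, f u := by
      have h : ((A.card : ℝ)) ^ 2 ≤ (n : ℝ) ^ r * ∑ u, ((B u).card : ℝ) := by
        exact_mod_cast sq_card_le_sum_card A
      have h' : (c * (n : ℝ) ^ (r + 1)) ^ 2 ≤ (n : ℝ) ^ r * ∑ u, ((B u).card : ℝ) :=
        le_trans (by gcongr) h
      simp only [f]
      rw [← Finset.sum_div, le_div_iff₀ (by positivity)]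
      refine le_of_mul_le_mul_left ?_ (show (0 : ℝ) < (n : ℝ) ^ r by positivity)
      calc _ = (c * (n : ℝ) ^ (r + 1)) ^ 2 := by ring
        _ ≤ _ := h'
    obtain ⟨p, hp⟩ : ∃ p, 2 ^ r = p + 1 := ⟨2 ^ r - 1, by have := Nat.two_pow_pos r; omega⟩
    have h3 : (∑ u, f u) ^ (p + 1) / ((n : ℝ) ^ 2) ^ p ≤ ∑ u, f u ^ (p + 1) := by
      have := pow_sum_div_card_le_sum_pow (s := Finset.univ) (f := f) (fun u _ => hf u) p
      simpa [sq] using this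
    have h4 : (c ^ 2) ^ (p + 1) * (n : ℝ) ^ 2 ≤ ∑ u, f u ^ (p + 1) := by
      refine le_trans ?_ h3
      rw [le_div_iff₀ (by positivity)]
      calc _ = (c ^ 2 * (n : ℝ) ^ 2) ^ (p + 1) := by ring
        _ ≤ _ := by gcongr
    rw [← Finset.sum_mul, hp] at h1
    refine le_trans ?_ h1
    calc c ^ 2 ^ (r + 1) * (n : ℝ) ^ (2 * (r + 1))
        = ((c ^ 2) ^ (p + 1) * (n : ℝ) ^ 2) * (n : ℝ) ^ (2 * r) := by
          rw [← hp]; ring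
      _ ≤ _ := by gcongr

open Classical in
/-- Few pairs of tuples agree somewhere. -/
lemma card_filter_exists_eq_mul_le (n r : ℕ) :
    (Finset.univ.filter fun q : (Fin r → Fin n) × (Fin r → Fin n) =>
      ∃ i, q.1 i = q.2 i).card * n ≤ r * n ^ (2 * r) := by
  have hi : ∀ i : Fin r, (Finset.univ.filter fun q : (Fin r → Fin n) × (Fin r → Fin n) =>
      q.1 i = q.2 i).card * n ≤ n ^ (2 * r) := fun i => by
    have := Finset.card_le_card_of_injOn
      (s := (Finset.univ.filter fun q : (Fin r → Fin n) × (Fin r → Fin n) =>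
        q.1 i = q.2 i) ×ˢ (Finset.univ : Finset (Fin n)))
      (t := Finset.univ)
      (fun p => (p.1.1, Function.update p.1.2 i p.2))
      (fun _ _ => Finset.mem_coe.2 (Finset.mem_univ _))
      (by
        rintro ⟨⟨a, b⟩, u⟩ h ⟨⟨a', b'⟩, u'⟩ h' heq
        simp only [Finset.coe_product, Set.mem_prod, Finset.coe_filter, Finset.mem_univ,
          true_and, Set.mem_ofPred_eq, Finset.coe_univ, Set.mem_univ, and_true] at h h'
        simp only [Prod.mk.injEq] at heq
        obtain ⟨rfl, h2⟩ := heq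
        have hu : u = u' := by simpa using congrFun h2 i
        have hb : b = b' := by
          funext l
          by_cases hl : l = i
          · rw [hl, ← h, ← h']
          · simpa [hl] using congrFun h2 l
        rw [hb, hu])
    simpa [two_mul, pow_add] using this
  have hsub : (Finset.univ.filter fun q : (Fin r → Fin n) × (Fin r → Fin n) =>
      ∃ i, q.1 i = q.2 i) ⊆ Finset.univ.biUnion fun i =>
      Finset.univ.filter fun q : (Fin r → Fin n) × (Fin r → Fin n) => q.1 i = q.2 i := by
    intro q hq
    simpa using hq
  calc _ ≤ (∑ i : Fin r, (Finset.univ.filter fun q : (Fin r → Fin n) × (Fin r → Fin n) =>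
      q.1 i = q.2 i).card) * n :=
        Nat.mul_le_mul_right _ ((Finset.card_le_card hsub).trans Finset.card_biUnion_le)
    _ ≤ ∑ _i : Fin r, n ^ (2 * r) := by
        rw [Finset.sum_mul]
        exact Finset.sum_le_sum fun i _ => hi i
    _ = _ := by simp

open Classical in
lemma two_mul_card_not_near_le {n j : ℕ} (G : Fin n → Fin n → Prop) (W : Set (Fin n))
    (x : Fin j → Fin n) :
    2 * (Finset.univ.filter fun y => y ∈ W ∧ ¬ Near G x y).card ≤
      ∑ i, ((Finset.univ.filter fun y => ¬ G (x i) y).card +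
        (Finset.univ.filter fun y => ¬ G y (x i)).card) := by
  simp only [Finset.card_filter, ← Finset.sum_add_distrib]
  rw [Finset.sum_comm, Finset.mul_sum]
  refine Finset.sum_le_sum fun y _ => ?_
  split_ifs with h
  swap
  · simp
  set f : Fin j → ℕ := fun i => (if ¬ G (x i) y then 1 else 0) + (if ¬ G y (x i) then 1 else 0)
    with hf
  change 2 * 1 ≤ ∑ i, f i
  have hmiss : ∀ i, Miss G (x i) y → 1 ≤ f i := fun i hi => by
    simp only [hf, Miss] at hi ⊢
    split_ifs <;> simp_all
  by_cases hadj : ∀ i, G (x i) y ∨ G y (x i)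
  · have : ∃ i l, i ≠ l ∧ Miss G (x i) y ∧ Miss G (x l) y := by
      by_contra hcon
      push Not at hcon
      refine h.2 ⟨hadj, fun i l hi hl => ?_⟩
      by_contra hil
      exact hcon i l hil hi hl
    obtain ⟨i, l, hil, hi, hl⟩ := this
    have h2 : f i + f l ≤ ∑ i, f i := by
      rw [← Finset.sum_pair hil]
      exact Finset.sum_le_sum_of_subset (Finset.subset_univ _)
    have := hmiss i hi
    have := hmiss l hl
    omega
  · push Not at hadj
    obtain ⟨i, h1, h2⟩ := hadj
    have : f i ≤ ∑ i, f i := Finset.single_le_sum (fun _ _ => Nat.zero_le _) (Finset.mem_univ i)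
    have h3 : f i = 2 := by simp [hf, h1, h2]
    omega

/-- The vertices joined to `v` in both directions. -/
def doubleNbrs {n : ℕ} (G : Fin n → Fin n → Prop) (v : Fin n) : Set (Fin n) :=
  {w | G v w ∧ G w v}

open Classical in
lemma le_card_near {k n : ℕ} {η : ℝ} (hη : 0 < η) {G : Fin n → Fin n → Prop}
    (hdeg : ∀ u, 2 * (1 - 1 / ((k : ℝ) + 3) + η) * n ≤ ((outDeg G u + inDeg G u : ℕ) : ℝ))
    (v : Fin n) {j : ℕ} (hj : j < k + 2) (x : Fin j → Fin n) :
    η * n ≤ ((Finset.univ.filter fun y => y ∈ doubleNbrs G v ∧ Near G x y).card : ℝ) := by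
  have hout : ∀ u, outDeg G u = (Finset.univ.filter fun y => G u y).card := fun u => by
    rw [outDeg, Set.ncard_eq_toFinset_card']; simp
  have hin : ∀ u, inDeg G u = (Finset.univ.filter fun y => G y u).card := fun u => by
    rw [inDeg, Set.ncard_eq_toFinset_card']; simp
  have hW : outDeg G v + inDeg G v ≤
      (Finset.univ.filter fun y => y ∈ doubleNbrs G v).card + n := by
    rw [hout, hin, ← Finset.card_union_add_card_inter, ← Finset.filter_and, add_comm]
    refine add_le_add (Finset.card_le_card fun y hy =>
      Finset.mem_filter.2 ⟨Finset.mem_univ y, (Finset.mem_filter.1 hy).2⟩) ?_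
    exact (Finset.card_le_univ _).trans (by simp)
  have hsplit : (Finset.univ.filter fun y => y ∈ doubleNbrs G v).card =
      (Finset.univ.filter fun y => y ∈ doubleNbrs G v ∧ Near G x y).card +
      (Finset.univ.filter fun y => y ∈ doubleNbrs G v ∧ ¬ Near G x y).card := by
    rw [← Finset.card_filter_add_card_filter_not (s := Finset.univ.filter fun y =>
      y ∈ doubleNbrs G v) (Near G x), Finset.filter_filter, Finset.filter_filter]
  have hmiss : ∀ u, (((Finset.univ.filter fun y => ¬ G u y).card +
      (Finset.univ.filter fun y => ¬ G y u).card : ℕ) : ℝ) ≤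
      2 * (1 / ((k : ℝ) + 3)) * n - 2 * η * n := fun u => by
    have h1 := Finset.card_filter_add_card_filter_not (s := Finset.univ) (fun y => G u y)
    have h2 := Finset.card_filter_add_card_filter_not (s := Finset.univ) (fun y => G y u)
    rw [← hout, Finset.card_univ, Fintype.card_fin] at h1
    rw [← hin, Finset.card_univ, Fintype.card_fin] at h2
    have h3 := hdeg u
    have h4 : ((outDeg G u + inDeg G u : ℕ) : ℝ) +
        (((Finset.univ.filter fun y => ¬ G u y).card +
        (Finset.univ.filter fun y => ¬ G y u).card : ℕ) : ℝ) = 2 * n := by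
      exact_mod_cast (by omega)
    linarith
  have hnot : 2 * ((Finset.univ.filter fun y => y ∈ doubleNbrs G v ∧ ¬ Near G x y).card : ℝ) ≤
      j * (2 * (1 / ((k : ℝ) + 3)) * n - 2 * η * n) := by
    calc 2 * ((Finset.univ.filter fun y => y ∈ doubleNbrs G v ∧ ¬ Near G x y).card : ℝ)
        ≤ ((∑ i, ((Finset.univ.filter fun y => ¬ G (x i) y).card +
          (Finset.univ.filter fun y => ¬ G y (x i)).card) : ℕ) : ℝ) := by
          exact_mod_cast two_mul_card_not_near_le G _ x
      _ ≤ ∑ _i : Fin j, (2 * (1 / ((k : ℝ) + 3)) * n - 2 * η * n) := by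
          rw [Nat.cast_sum]
          exact Finset.sum_le_sum fun i _ => hmiss (x i)
      _ = _ := by rw [Finset.sum_const, Finset.card_univ, Fintype.card_fin, nsmul_eq_mul]
  have hjk : (j : ℝ) ≤ k + 1 := by exact_mod_cast Nat.lt_succ_iff.mp hj
  have ht : 1 / ((k : ℝ) + 3) * (k + 3) = 1 := by field_simp
  set t := 1 / ((k : ℝ) + 3) with ht'
  have ht0 : 0 ≤ t := by positivity
  have hn0 : (0 : ℝ) ≤ n := by positivity
  have hj0 : (0 : ℝ) ≤ j := by positivity
  have e1 : (j : ℝ) * (2 * t * n - 2 * η * n) ≤ (k + 1) * (2 * t * n) := by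
    have : (j : ℝ) * (2 * t * n) ≤ (k + 1) * (2 * t * n) := by gcongr
    have : 0 ≤ (j : ℝ) * (2 * η * n) := by positivity
    linarith
  have e2 : (k + 1) * (2 * t * n) = 2 * n - 4 * t * n := by
    linear_combination 2 * (n : ℝ) * ht
  have hWr : ((outDeg G v + inDeg G v : ℕ) : ℝ) ≤
      ((Finset.univ.filter fun y => y ∈ doubleNbrs G v ∧ Near G x y).card : ℝ) +
      (Finset.univ.filter fun y => y ∈ doubleNbrs G v ∧ ¬ Near G x y).card + n := by
    exact_mod_cast hsplit ▸ hW
  have := hdeg v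
  have : 0 ≤ η * n := by positivity
  linarith

/-- Indices carrying a digraph whose non-double pairs form a matching can be listed so that the
only missing edges are backward ones between consecutive entries. -/
lemma exists_list_of_matching {ι : Type*} [DecidableEq ι] {E : ι → ι → Prop}
    (hadj : ∀ i j, i ≠ j → E i j ∨ E j i)
    (huniq : ∀ i j l, i ≠ j → i ≠ l → Miss E i j → Miss E i l → j = l) (S : Finset ι) :
    ∃ L : List ι, L.Nodup ∧ L.toFinset = S ∧ ∀ (a b : ℕ) (ha : a < L.length)
      (hb : b < L.length), a ≠ b → b + 1 ≠ a → E L[a] L[b] := by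
  induction S using Finset.strongInduction with
  | H S ih =>
    rcases S.eq_empty_or_nonempty with rfl | ⟨i, hi⟩
    · exact ⟨[], by simp⟩
    by_cases h : ∃ l ∈ S, i ≠ l ∧ Miss E i l
    · obtain ⟨p, q, hp, hq, hpq, hE, hm⟩ : ∃ p q, p ∈ S ∧ q ∈ S ∧ p ≠ q ∧ E p q ∧ Miss E p q := by
        obtain ⟨l, hl, hil, hm⟩ := h
        rcases hadj i l hil with h | h
        · exact ⟨i, l, hi, hl, hil, h, hm⟩
        · exact ⟨l, i, hl, hi, hil.symm, h, hm.symm⟩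
      obtain ⟨L, hL, hLS, hLE⟩ := ih ((S.erase p).erase q)
        ((Finset.erase_subset _ _).trans_ssubset (Finset.erase_ssubset hp))
      have hmem : ∀ z ∈ L, z ≠ p ∧ z ≠ q := fun z hz => by
        have : z ∈ (S.erase p).erase q := hLS ▸ List.mem_toFinset.2 hz
        simp only [Finset.mem_erase] at this
        exact ⟨this.2.1, this.1⟩
      have hp2 : ∀ z ∈ L, E p z ∧ E z p := fun z hz => by
        by_contra hcon
        exact (hmem z hz).2 (huniq p q z hpq (hmem z hz).1.symm hm hcon).symm
      have hq2 : ∀ z ∈ L, E q z ∧ E z q := fun z hz => by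
        by_contra hcon
        exact (hmem z hz).1 (huniq q p z hpq.symm (hmem z hz).2.symm hm.symm hcon).symm
      refine ⟨p :: q :: L, ?_, ?_, ?_⟩
      · simp only [List.nodup_cons, List.mem_cons, not_or]
        exact ⟨⟨hpq, fun h => (hmem p h).1 rfl⟩, fun h => (hmem q h).2 rfl, hL⟩
      · rw [List.toFinset_cons, List.toFinset_cons, hLS,
          Finset.insert_erase (by simp [hq, hpq.symm]), Finset.insert_erase hp]
      · rintro (_ | _ | a) (_ | _ | b) ha hb hab hba
        · simp at hab
        · exact hE
        · exact (hp2 _ (List.getElem_mem _)).1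
        · simp at hba
        · simp at hab
        · exact (hq2 _ (List.getElem_mem _)).1
        · exact (hp2 _ (List.getElem_mem _)).2
        · exact (hq2 _ (List.getElem_mem _)).2
        · exact hLE a b _ _ (by omega) (by omega)
    · push Not at h
      obtain ⟨L, hL, hLS, hLE⟩ := ih (S.erase i) (Finset.erase_ssubset hi)
      have hmem : ∀ z ∈ L, i ≠ z ∧ z ∈ S := fun z hz => by
        have : z ∈ S.erase i := hLS ▸ List.mem_toFinset.2 hz
        simp only [Finset.mem_erase] at this
        exact ⟨this.1.symm, this.2⟩
      have h2 : ∀ z ∈ L, E i z ∧ E z i := fun z hz => by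
        by_contra hcon
        exact h z (hmem z hz).2 (hmem z hz).1 hcon
      refine ⟨i :: L, ?_, ?_, ?_⟩
      · exact List.nodup_cons.2 ⟨fun h => (hmem i h).1 rfl, hL⟩
      · rw [List.toFinset_cons, hLS, Finset.insert_erase hi]
      · rintro (_ | a) (_ | b) ha hb hab hba
        · simp at hab
        · exact (h2 _ (List.getElem_mem _)).1
        · exact (h2 _ (List.getElem_mem _)).2
        · exact hLE a b _ _ (by omega) (by omega)

/-- The entries of `x` lie in `W` and all edges between them are present except possibly backward
ones between consecutive entries. -/
def IsOrderedTuple {V : Type*} {r : ℕ} (G : V → V → Prop) (W : Set V) (x : Fin r → V) : Prop :=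
  (∀ i, x i ∈ W) ∧ ∀ i j : Fin r, i ≠ j → (j : ℕ) + 1 ≠ i → G (x i) (x j)

lemma IsMatchTuple.exists_perm {V : Type*} {G : V → V → Prop} {W : Set V} {r : ℕ}
    {x : Fin r → V} (hx : IsMatchTuple G W x) :
    ∃ σ : Equiv.Perm (Fin r), IsOrderedTuple G W (x ∘ σ) := by
  obtain ⟨L, hL, hLS, hE⟩ := exists_list_of_matching (E := fun i j => G (x i) (x j))
    hx.adj hx.uniq Finset.univ
  have hlen : L.length = r := by
    rw [← List.toFinset_card_of_nodup hL, hLS]; simp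
  let f : Fin r → Fin r := fun i => L[(i : ℕ)]'(by rw [hlen]; exact i.2)
  have hf : Function.Injective f := fun i j h => Fin.ext ((hL.getElem_inj_iff).1 h)
  refine ⟨Equiv.ofBijective f (Finite.injective_iff_bijective.1 hf), fun i => hx.mem _, ?_⟩
  intro i j hij hji
  exact hE i j _ _ (fun h => hij (Fin.ext h)) hji

open Classical in
lemma card_matchTuple_le {n r : ℕ} (G : Fin n → Fin n → Prop) (W : Set (Fin n)) :
    (Finset.univ.filter fun x : Fin r → Fin n => IsMatchTuple G W x).card ≤
      r.factorial * (Finset.univ.filter fun x : Fin r → Fin n => IsOrderedTuple G W x).card := by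
  have hsub : (Finset.univ.filter fun x : Fin r → Fin n => IsMatchTuple G W x) ⊆
      (Finset.univ : Finset (Equiv.Perm (Fin r))).biUnion fun σ =>
        Finset.univ.filter fun x : Fin r → Fin n => IsOrderedTuple G W (x ∘ σ) := by
    intro x hx
    simpa using (Finset.mem_filter.1 hx).2.exists_perm
  refine (Finset.card_le_card hsub).trans (Finset.card_biUnion_le.trans ?_)
  refine (Finset.sum_le_card_nsmul _ _ (Finset.univ.filter fun x : Fin r → Fin n =>
    IsOrderedTuple G W x).card fun σ _ => ?_).trans ?_
  · refine Finset.card_le_card_of_injOn (fun x => x ∘ σ) ?_ ?_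
    · intro x hx
      simpa using hx
    · intro x _ y _ h
      exact σ.surjective.injective_comp_right h
  · simp [Finset.card_univ, Fintype.card_perm]

/-- The two concatenations of a box of ordered tuples of double neighbours of `v` are `k`-paths. -/
lemma isKPath_of_box {n k : ℕ} {G : Fin n → Fin n → Prop} (hG : IsDigraph G) {v : Fin n}
    {a b : Fin (k + 2) → Fin n}
    (h : ∀ s : Fin (k + 2) → Bool,
      IsOrderedTuple G (doubleNbrs G v) fun i => if s i then a i else b i)
    (hne : ∀ i, a i ≠ b i) :
    IsKPath k G (List.ofFn a ++ List.ofFn b) ∧ v ∉ List.ofFn a ++ List.ofFn b ∧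
      IsKPath k G (List.ofFn a ++ v :: List.ofFn b) := by
  have ha : IsOrderedTuple G (doubleNbrs G v) a := by simpa using h fun _ => true
  have hb : IsOrderedTuple G (doubleNbrs G v) b := by simpa using h fun _ => false
  have hab : ∀ i j : Fin (k + 2), i ≠ j → (j : ℕ) + 1 ≠ i → G (a i) (b j) := fun i j hij hji => by
    simpa [hij.symm] using (h fun l => decide (l = i)).2 i j hij hji
  have hba : ∀ i j : Fin (k + 2), i ≠ j → (j : ℕ) + 1 ≠ i → G (b i) (a j) := fun i j hij hji => by
    simpa [hij] using (h fun l => decide (l = j)).2 i j hij hji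
  have hne' : ∀ {x y}, G x y → x ≠ y := fun hxy e => hG _ (e ▸ hxy)
  have inj : ∀ {x : Fin (k + 2) → Fin n}, IsOrderedTuple G (doubleNbrs G v) x →
      Function.Injective x := fun {x} hx i j hij => by
    by_contra hcon
    rcases lt_or_gt_of_ne hcon with hlt | hlt
    · exact hne' (hx.2 i j hcon (by have := Fin.lt_def.1 hlt; omega)) hij
    · exact hne' (hx.2 j i (Ne.symm hcon) (by have := Fin.lt_def.1 hlt; omega)) hij.symm
  have hdisj : ∀ i j, a i ≠ b j := fun i j => by
    rcases lt_trichotomy i j with hlt | rfl | hlt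
    · exact hne' (hab i j hlt.ne (by have := Fin.lt_def.1 hlt; omega))
    · exact hne i
    · exact (hne' (hba j i hlt.ne (by have := Fin.lt_def.1 hlt; omega))).symm
  have hva : ∀ i, v ≠ a i := fun i => hne' (ha.1 i).1
  have hvb : ∀ i, v ≠ b i := fun i => hne' (hb.1 i).1
  refine ⟨⟨?_, ?_⟩, ?_, ?_, ?_⟩
  · rw [List.nodup_append]
    refine ⟨List.nodup_ofFn.2 (inj ha), List.nodup_ofFn.2 (inj hb), ?_⟩
    simp only [List.mem_ofFn]
    rintro _ ⟨i, rfl⟩ _ ⟨j, rfl⟩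
    exact hdisj i j
  · rintro ⟨i, hi⟩ ⟨j, hj⟩ hij hjk
    simp only [List.length_append, List.length_ofFn] at hi hj hij hjk
    simp only [List.get_eq_getElem, List.getElem_append, List.length_ofFn, List.getElem_ofFn]
    split_ifs with h1 h2 h2
    · refine ha.2 _ _ (Fin.ne_of_val_ne ?_) ?_ <;> dsimp only <;> omega
    · refine hab _ _ (Fin.ne_of_val_ne ?_) ?_ <;> dsimp only <;> omega
    · omega
    · refine hb.2 _ _ (Fin.ne_of_val_ne ?_) ?_ <;> dsimp only <;> omega
  · simp only [List.mem_append, List.mem_ofFn, not_or, not_exists]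
    exact ⟨fun i e => hva i e.symm, fun i e => hvb i e.symm⟩
  · rw [List.nodup_append]
    refine ⟨List.nodup_ofFn.2 (inj ha), List.nodup_cons.2 ⟨?_, List.nodup_ofFn.2 (inj hb)⟩, ?_⟩
    · simp only [List.mem_ofFn, not_exists]
      exact fun i e => hvb i e.symm
    · simp only [List.mem_ofFn, List.mem_cons]
      rintro _ ⟨i, rfl⟩ _ (rfl | ⟨j, rfl⟩)
      · exact (hva i).symm
      · exact hdisj i j
  · rintro ⟨i, hi⟩ ⟨j, hj⟩ hij hjk
    simp only [List.length_append, List.length_ofFn, List.length_cons] at hi hj hij hjk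
    simp only [List.get_eq_getElem, List.getElem_append, List.length_ofFn, List.getElem_ofFn,
      List.getElem_cons]
    split_ifs
    · refine ha.2 _ _ (Fin.ne_of_val_ne ?_) ?_ <;> dsimp only <;> omega
    · exact (ha.1 _).2
    · refine hab _ _ (Fin.ne_of_val_ne ?_) ?_ <;> dsimp only <;> omega
    · omega
    · omega
    · exact (hb.1 _).1
    · omega
    · omega
    · refine hb.2 _ _ (Fin.ne_of_val_ne ?_) ?_ <;> dsimp only <;> omega

/-- Absorbing lemma for digraphs: for every `k ≥ 1` and `η > 0` there are `n₀` and `ξ > 0`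
such that in every digraph on `n ≥ n₀` vertices with minimum total degree at least
`2(1 - 1/(k+3) + η)n`, every vertex `v` has at least `ξ n^(2(k+2))` absorbers, i.e.
`k`-paths `P` on `2(k+2)` vertices avoiding `v` such that inserting `v` in the middle of
`P` again yields a `k`-path. -/
theorem statement_7 (k : ℕ) (hk : 1 ≤ k) (η : ℝ) (hη : 0 < η) :
    ∃ (n₀ : ℕ) (ξ : ℝ), 0 < ξ ∧ ∀ n : ℕ, n₀ ≤ n → ∀ G : Fin n → Fin n → Prop,
      IsDigraph G →
      (∀ u, 2 * (1 - 1/((k:ℝ)+3) + η) * n ≤ ((outDeg G u + inDeg G u : ℕ) : ℝ)) →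
      ∀ v : Fin n,
        ξ * (n:ℝ)^(2*(k+2)) ≤
          (({P : List (Fin n) | P.length = 2*(k+2) ∧ IsKPath k G P ∧ v ∉ P ∧
            IsKPath k G (P.take (k+2) ++ v :: P.drop (k+2))}).ncard : ℝ) := by
  classical
  obtain ⟨c, hc, hmatch⟩ := exists_density_matchTuple η hη (k + 2)
  set c₁ : ℝ := c / (k + 2).factorial with hc₁
  have hc₁pos : 0 < c₁ := by positivity
  set C : ℝ := c₁ ^ 2 ^ (k + 2) with hC
  have hCpos : 0 < C := by positivity
  obtain ⟨n₀, hn₀⟩ := exists_nat_ge (2 * ((k + 2 : ℕ) : ℝ) / C)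
  refine ⟨n₀, C / 2, by positivity, fun n hn G hG hdeg v => ?_⟩
  have hnpos : 0 < n := v.pos
  have hnpos' : (0 : ℝ) < n := by exact_mod_cast hnpos
  set W := doubleNbrs G v with hW
  set A := Finset.univ.filter fun x : Fin (k + 2) → Fin n => IsOrderedTuple G W x with hA
  have hAcard : c₁ * (n : ℝ) ^ (k + 2) ≤ A.card := by
    have h1 := hmatch n G W fun i hi x => le_card_near hη hdeg v hi x
    have h2 : ((Finset.univ.filter fun x : Fin (k + 2) → Fin n => IsMatchTuple G W x).card : ℝ)
        ≤ (k + 2).factorial * A.card := by exact_mod_cast card_matchTuple_le G W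
    rw [hc₁, div_mul_eq_mul_div, div_le_iff₀ (by positivity)]
    linarith
  have hbox := pow_mul_le_card_boxPairs hnpos (k + 2) c₁ hc₁pos.le A hAcard
  set D := Finset.univ.filter fun q : (Fin (k + 2) → Fin n) × (Fin (k + 2) → Fin n) =>
      ∃ i, q.1 i = q.2 i with hD
  have hDcard : (D.card : ℝ) ≤ C / 2 * (n : ℝ) ^ (2 * (k + 2)) := by
    have h1 : (D.card : ℝ) * n ≤ ((k + 2 : ℕ) : ℝ) * (n : ℝ) ^ (2 * (k + 2)) := by
      exact_mod_cast card_filter_exists_eq_mul_le n (k + 2)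
    have h2 : ((k + 2 : ℕ) : ℝ) ≤ C / 2 * n := by
      have : (n₀ : ℝ) ≤ n := by exact_mod_cast hn
      have h3 := hn₀.trans this
      rw [div_le_iff₀ hCpos] at h3
      linarith
    refine le_of_mul_le_mul_right (h1.trans ?_) hnpos'
    calc _ ≤ C / 2 * n * (n : ℝ) ^ (2 * (k + 2)) := by gcongr
      _ = _ := by ring
  have hdiff : ((boxPairs A).card : ℝ) ≤ (boxPairs A \ D).card + D.card := by
    exact_mod_cast Finset.card_le_card_sdiff_add_card
  set T := {P : List (Fin n) | P.length = 2*(k+2) ∧ IsKPath k G P ∧ v ∉ P ∧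
            IsKPath k G (P.take (k+2) ++ v :: P.drop (k+2))} with hT
  have hTfin : T.Finite := (List.finite_length_eq (Fin n) (2 * (k + 2))).subset fun P hP => hP.1
  have hle : (boxPairs A \ D).card ≤ T.ncard := by
    rw [← Set.ncard_coe_finset]
    refine Set.ncard_le_ncard_of_injOn (fun q => List.ofFn q.1 ++ List.ofFn q.2) ?_ ?_ hTfin
    · rintro ⟨a, b⟩ hq
      simp only [Finset.mem_coe, Finset.mem_sdiff, boxPairs, hA, hD, Finset.mem_filter,
        Finset.mem_univ, true_and, not_exists] at hq
      obtain ⟨h1, h2, h3⟩ := isKPath_of_box hG hq.1 hq.2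
      refine ⟨by rw [List.length_append, List.length_ofFn, List.length_ofFn, two_mul], h1, h2, ?_⟩
      simpa [List.take_append, List.drop_append] using h3
    · rintro ⟨a, b⟩ - ⟨a', b'⟩ - h
      obtain ⟨h1, h2⟩ := List.append_inj h (by simp)
      exact Prod.ext (List.ofFn_injective h1) (List.ofFn_injective h2)
  have : ((boxPairs A \ D).card : ℝ) ≤ T.ncard := by exact_mod_cast hle
  linarith

end Paper
end
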